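/- Let α,β>-1 and γ>0. The vector-valued kernel 𝒢_{α,β}^{γ}(θ,φ)={∂_t^γ ℋ_t^{α,β}(θ,φ)}_{t>0} satisfies the standard Calderón–Zygmund estimates with respect to the space of homogeneous type ((0,π),dμ_{α,β},|·|) and the Banach space B=L²((0,∞),t^{2γ-1}dt): there is a constant C such that for all θ,φ∈(0,π) with θ≠φ, (i) ‖𝒢_{α,β}^{γ}(θ,φ)‖_B ≤ C/μ_{α,β}(B(θ,|θ-φ|)), and (ii) ‖{∂_θ ∂_t^γ ℋ_t^{α,β}(θ,φ)}_{t>0}‖_B + ‖{∂_φ ∂_t^γ ℋ_t^{α,β}(θ,φ)}_{t>0}‖_B ≤ C/(|θ-φ|·μ_{α,β}(B(θ,|θ-φ|))), where B(θ,r) is the interval in (0,π) centered at θ of radius r. -/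

import Mathlib

noncomputable section

open MeasureTheory Real Set Filter
open scoped ENNReal Topology

namespace JacobiPaper

/-- Lebesgue measure on the interval `(0, π)`. -/
def μ0 : Measure ℝ := volume.restrict (Ioo 0 π)

/-- The Jacobi eigenvalues `λ_n^{α,β} = (n + (α+β+1)/2)^2`. -/
def lam (α β : ℝ) (n : ℕ) : ℝ := ((n : ℝ) + (α + β + 1) / 2) ^ 2

/-- `Ψ^{α,β}(θ) = (sin(θ/2))^(α+1/2) (cos(θ/2))^(β+1/2)`. -/
def Psi (α β θ : ℝ) : ℝ := sin (θ / 2) ^ (α + 1 / 2) * cos (θ / 2) ^ (β + 1 / 2)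

/-- `φ` is the system of Jacobi trigonometric functions `φ_n^{α,β}`:
`φ_n = Ψ^{α,β} · (c_n P_n^{α,β}(cos θ))` on `(0,π)` with `c_n > 0`, and the system is
orthonormal in `L²(0,π)`.  These properties determine the system uniquely. -/
structure IsJacobiSystem (α β : ℝ) (φ : ℕ → ℝ → ℝ) : Prop where
  meas : ∀ n, Measurable (φ n)
  form : ∀ n : ℕ, ∃ P : Polynomial ℝ, P.natDegree = n ∧ 0 < P.leadingCoeff ∧
    ∀ θ ∈ Ioo (0 : ℝ) π, φ n θ = Psi α β θ * P.eval (cos θ)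
  ortho : ∀ n m : ℕ, ∫ θ, φ n θ * φ m θ ∂μ0 = if n = m then 1 else 0

/-- The Fourier–Jacobi coefficient `a_n^{α,β}(f)`. -/
def coeffJ (φ : ℕ → ℝ → ℝ) (f : ℝ → ℂ) (n : ℕ) : ℂ := ∫ θ, f θ * (φ n θ : ℂ) ∂μ0

/-- The Poisson–Jacobi semigroup `H_t^{α,β} f(θ)`. -/
def poisson (α β : ℝ) (φ : ℕ → ℝ → ℝ) (f : ℝ → ℂ) (t θ : ℝ) : ℂ :=
  ∑' n : ℕ, Real.exp (-(t * Real.sqrt (lam α β n))) • (coeffJ φ f n * (φ n θ : ℂ))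

/-- Caputo-type fractional derivative `∂_t^γ F` of order `γ`, with `m = ⌊γ⌋ + 1`. -/
def caputo (γ : ℝ) (F : ℝ → ℂ) (t : ℝ) : ℂ :=
  (Real.Gamma ((⌊γ⌋₊ : ℝ) + 1 - γ))⁻¹ •
    ∫ s in Ioi (0 : ℝ), s ^ ((⌊γ⌋₊ : ℝ) - γ) • iteratedDeriv (⌊γ⌋₊ + 1) F (t + s)

/-- The fractional square function `𝔤_{α,β}^γ(f)`. -/
def gSq (α β γ : ℝ) (φ : ℕ → ℝ → ℝ) (f : ℝ → ℂ) (θ : ℝ) : ℝ :=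
  Real.sqrt (∫ t in Ioi (0 : ℝ),
    ‖caputo γ (fun u => poisson α β φ f u θ) t‖ ^ 2 * t ^ (2 * γ - 1))

/-- The fractional square function `𝔤_{α,β}^{γ,k}(f)`. -/
def gSqK (α β γ : ℝ) (k : ℕ) (φ : ℕ → ℝ → ℝ) (f : ℝ → ℂ) (θ : ℝ) : ℝ :=
  Real.sqrt (∫ t in Ioi (0 : ℝ),
    ‖iteratedDeriv k (fun u => poisson α β φ f u θ) t‖ ^ 2 * t ^ (2 * ((k : ℝ) - γ) - 1))

/-- The modified fractional square function `𝔤̃_{α,β}^{γ,k}(f)`, built on `e^{-t}H_t^{α,β}`. -/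
def gSqTildeK (α β γ : ℝ) (k : ℕ) (φ : ℕ → ℝ → ℝ) (f : ℝ → ℂ) (θ : ℝ) : ℝ :=
  Real.sqrt (∫ t in Ioi (0 : ℝ),
    ‖iteratedDeriv k (fun u => Real.exp (-u) • poisson α β φ f u θ) t‖ ^ 2 *
      t ^ (2 * ((k : ℝ) - γ) - 1))

/-- `p(α,β) = -1/min(α+1/2, β+1/2)` (relevant when `min(α+1/2,β+1/2) < 0`). -/
def pMaxR (α β : ℝ) : ℝ := -1 / min (α + 1 / 2) (β + 1 / 2)

/-- `p ∈ E(α,β) = (p'(α,β), p(α,β))`. -/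
def memE (α β p : ℝ) : Prop :=
  if -(1 / 2) ≤ α ∧ -(1 / 2) ≤ β then 1 < p
  else pMaxR α β / (pMaxR α β - 1) < p ∧ p < pMaxR α β

/-- `q < p(α,β)`. -/
def ltPMax (α β q : ℝ) : Prop := ¬(-(1 / 2) ≤ α ∧ -(1 / 2) ≤ β) → q < pMaxR α β

/-- Eigenvalues of the potential operator: `λ_n^{-σ}` when `α+β ≠ -1` and `(1+λ_n)^{-σ}`
when `α+β = -1`. -/
def potEig (α β σ : ℝ) (n : ℕ) : ℝ :=
  (if α + β = -1 then 1 + lam α β n else lam α β n) ^ (-σ)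

def cotHalf (θ : ℝ) : ℝ := cos (θ / 2) / sin (θ / 2)

/-- `g` is the weak (distributional) derivative of `f` on `(0,π)`. -/
def HasWeakDeriv (f g : ℝ → ℂ) : Prop :=
  ∀ ψ : ℝ → ℝ, ContDiff ℝ (⊤ : ℕ∞) ψ → HasCompactSupport ψ → tsupport ψ ⊆ Ioo 0 π →
    ∫ θ, f θ * ((deriv ψ θ : ℝ) : ℂ) ∂μ0 = -∫ θ, g θ * (ψ θ : ℂ) ∂μ0

/-- `g = D_{α,β} f` in the weak sense, where
`D_{α,β} = d/dθ - ((2α+1)/4)cot(θ/2) + ((2β+1)/4)tan(θ/2)`. -/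
def HasJacobiD (α β : ℝ) (f g : ℝ → ℂ) : Prop :=
  ∃ f' : ℝ → ℂ, HasWeakDeriv f f' ∧
    g =ᵐ[μ0] fun θ =>
      f' θ - ((2 * α + 1) / 4 * cotHalf θ) • f θ + ((2 * β + 1) / 4 * Real.tan (θ / 2)) • f θ

/-- `g = D^{(k)} f = D_{α+k-1,β+k-1} ∘ ⋯ ∘ D_{α,β} f` in the weak sense. -/
def HasDIter (α β : ℝ) : ℕ → (ℝ → ℂ) → (ℝ → ℂ) → Prop
  | 0, f, g => g =ᵐ[μ0] f
  | (k + 1), f, g => ∃ h, HasDIter α β k f h ∧ HasJacobiD (α + k) (β + k) h g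

/-- The eigenvalue coefficient of the Riesz–Jacobi transform `R_{α,β}^k`:
`R^k φ_n^{α,β} = rieszCoeff α β k n · φ_{n-k}^{α+k,β+k}`. -/
def rieszCoeff (α β : ℝ) (k n : ℕ) : ℝ :=
  (-1 : ℝ) ^ k *
    (∏ j ∈ Finset.range k, Real.sqrt (lam α β n - ((α + β + 1) / 2 + (j : ℝ)) ^ 2)) *
    potEig α β ((k : ℝ) / 2) n

/-- Solution of the Schrödinger-type equation: `exp(itL_{α,β})f(θ)`. -/
def schrodinger (α β : ℝ) (φ : ℕ → ℝ → ℝ) (f : ℝ → ℂ) (t θ : ℝ) : ℂ :=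
  ∑' n : ℕ, Complex.exp (Complex.I * ((t * lam α β n : ℝ) : ℂ)) * (coeffJ φ f n * (φ n θ : ℂ))

/-! Jacobi trigonometric polynomial setting. -/

/-- The measure `dμ_{α,β}(θ) = (sin(θ/2))^{2α+1} (cos(θ/2))^{2β+1} dθ` on `(0,π)`. -/
def μJ (α β : ℝ) : Measure ℝ :=
  (volume.restrict (Ioo 0 π)).withDensity fun θ =>
    ENNReal.ofReal (sin (θ / 2) ^ (2 * α + 1) * cos (θ / 2) ^ (2 * β + 1))

/-- `Pn` is the system of normalized Jacobi trigonometric polynomials `Pn_n^{α,β}`. -/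
structure IsJacobiPolySystem (α β : ℝ) (Pn : ℕ → ℝ → ℝ) : Prop where
  form : ∀ n : ℕ, ∃ P : Polynomial ℝ, P.natDegree = n ∧ 0 < P.leadingCoeff ∧
    ∀ θ : ℝ, Pn n θ = P.eval (cos θ)
  ortho : ∀ n m : ℕ, ∫ θ, Pn n θ * Pn m θ ∂(μJ α β) = if n = m then 1 else 0

/-- `⟨f, Pn_n^{α,β}⟩_{dμ_{α,β}}`. -/
def coeffP (α β : ℝ) (Pn : ℕ → ℝ → ℝ) (f : ℝ → ℂ) (n : ℕ) : ℂ :=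
  ∫ θ, f θ * (Pn n θ : ℂ) ∂(μJ α β)

/-- The Jacobi–Poisson semigroup `ℋ_t^{α,β} f(θ)` in the polynomial setting. -/
def poissonP (α β : ℝ) (Pn : ℕ → ℝ → ℝ) (f : ℝ → ℂ) (t θ : ℝ) : ℂ :=
  ∑' n : ℕ, Real.exp (-(t * Real.sqrt (lam α β n))) • (coeffP α β Pn f n * (Pn n θ : ℂ))

/-- The vertical fractional square function `g_{α,β}^γ(f)` in the polynomial setting. -/
def gSqP (α β γ : ℝ) (Pn : ℕ → ℝ → ℝ) (f : ℝ → ℂ) (θ : ℝ) : ℝ :=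
  Real.sqrt (∫ t in Ioi (0 : ℝ),
    ‖caputo γ (fun u => poissonP α β Pn f u θ) t‖ ^ 2 * t ^ (2 * γ - 1))

/-- The interval (ball) `B(θ, r)`. -/
def ballI (θ r : ℝ) : Set ℝ := Ioo (θ - r) (θ + r)

/-- The weighted measure `w dμ_{α,β}`. -/
def wMeasure (α β : ℝ) (w : ℝ → ℝ) : Measure ℝ :=
  (μJ α β).withDensity fun x => ENNReal.ofReal (w x)

/-- The Muckenhoupt class `A_p^{α,β}`, `1 < p < ∞`, on the space of homogeneous type
`((0,π), dμ_{α,β}, |·|)`. -/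
def IsApWeight (α β p : ℝ) (w : ℝ → ℝ) : Prop :=
  ∃ C : ℝ, 0 < C ∧ ∀ θ ∈ Ioo (0 : ℝ) π, ∀ r : ℝ, 0 < r →
    (∫ x in ballI θ r, w x ∂(μJ α β)) *
      (∫ x in ballI θ r, w x ^ (-(1 / (p - 1))) ∂(μJ α β)) ^ (p - 1) ≤
      C * ((μJ α β (ballI θ r)).toReal) ^ p

/-- The Muckenhoupt class `A_1^{α,β}` on `((0,π), dμ_{α,β}, |·|)`. -/
def IsA1Weight (α β : ℝ) (w : ℝ → ℝ) : Prop :=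
  ∃ C : ℝ, 0 < C ∧ ∀ θ ∈ Ioo (0 : ℝ) π, ∀ r : ℝ, 0 < r →
    ∀ᵐ y ∂(μJ α β), y ∈ ballI θ r →
      ∫ x in ballI θ r, w x ∂(μJ α β) ≤ C * (μJ α β (ballI θ r)).toReal * w y

/-- Caputo-type fractional derivative for real-valued functions. -/
def caputoR (γ : ℝ) (F : ℝ → ℝ) (t : ℝ) : ℝ :=
  (Real.Gamma ((⌊γ⌋₊ : ℝ) + 1 - γ))⁻¹ *
    ∫ s in Ioi (0 : ℝ), s ^ ((⌊γ⌋₊ : ℝ) - γ) * iteratedDeriv (⌊γ⌋₊ + 1) F (t + s)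

/-- The Jacobi–Poisson kernel `ℋ_t^{α,β}(θ,ψ)`. -/
def kernelP (α β : ℝ) (Pn : ℕ → ℝ → ℝ) (t θ ψ : ℝ) : ℝ :=
  ∑' n : ℕ, Real.exp (-(t * Real.sqrt (lam α β n))) * Pn n θ * Pn n ψ

/-- `L²(t^{2γ-1} dt)`-norm of `{∂_t^γ ℋ_t^{α,β}(θ,ψ)}_{t>0}`. -/
def kernelBNorm (α β γ : ℝ) (Pn : ℕ → ℝ → ℝ) (θ ψ : ℝ) : ℝ :=
  Real.sqrt (∫ t in Ioi (0 : ℝ),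
    (caputoR γ (fun u => kernelP α β Pn u θ ψ) t) ^ 2 * t ^ (2 * γ - 1))

/-- `L²(t^{2γ-1} dt)`-norm of `{∂_θ ∂_t^γ ℋ_t^{α,β}(θ,ψ)}_{t>0}`. -/
def kernelBNormDθ (α β γ : ℝ) (Pn : ℕ → ℝ → ℝ) (θ ψ : ℝ) : ℝ :=
  Real.sqrt (∫ t in Ioi (0 : ℝ),
    (deriv (fun θ' => caputoR γ (fun u => kernelP α β Pn u θ' ψ) t) θ) ^ 2 * t ^ (2 * γ - 1))

/-- `L²(t^{2γ-1} dt)`-norm of `{∂_ψ ∂_t^γ ℋ_t^{α,β}(θ,ψ)}_{t>0}`. -/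
def kernelBNormDψ (α β γ : ℝ) (Pn : ℕ → ℝ → ℝ) (θ ψ : ℝ) : ℝ :=
  Real.sqrt (∫ t in Ioi (0 : ℝ),
    (deriv (fun ψ' => caputoR γ (fun u => kernelP α β Pn u θ ψ') t) ψ) ^ 2 * t ^ (2 * γ - 1))

/-! Fourier coefficients on the circle, for Wainger's inequality. -/

/-- The `k`-th Fourier coefficient `F̂(k)` of a function on `(0,2π)`. -/
def fCoeff (F : ℝ → ℂ) (k : ℤ) : ℂ :=
  (2 * π)⁻¹ • ∫ t in Ioo (0 : ℝ) (2 * π), F t * Complex.exp (-(Complex.I * k * t))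

/-- Symmetric partial sums of the Wainger multiplier series. -/
def waingerSum (r q : ℝ) (F : ℝ → ℂ) (N : ℕ) (t : ℝ) : ℂ :=
  ∑ k ∈ Finset.Icc (-(N : ℤ)) (N : ℤ),
    if k = 0 then 0 else
      (|(k : ℝ)| ^ (-(1 / r) + 1 / q)) • (fCoeff F k * Complex.exp (Complex.I * k * t))

/-- A sequence of real polynomials `p n` of exact degree `n`, with positive leading coefficients,
such that `p n (cos θ)` is orthonormal with respect to `μJ α β`. -/
structure IsOrthoSeq (α β : ℝ) (p : ℕ → Polynomial ℝ) : Prop where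
  natDegree : ∀ n, (p n).natDegree = n
  lead : ∀ n, 0 < (p n).leadingCoeff
  ortho : ∀ n m, ∫ θ, (p n).eval (cos θ) * (p m).eval (cos θ) ∂(μJ α β) = if n = m then 1 else 0

/-- The density of `μJ α β`. -/
def jweight (α β θ : ℝ) : ℝ := sin (θ / 2) ^ (2 * α + 1) * cos (θ / 2) ^ (2 * β + 1)

lemma sin_half_pos {θ : ℝ} (h : θ ∈ Ioo 0 π) : 0 < sin (θ / 2) :=
  sin_pos_of_pos_of_lt_pi (by linarith [h.1]) (by linarith [h.1, h.2, pi_pos])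

lemma cos_half_pos {θ : ℝ} (h : θ ∈ Ioo 0 π) : 0 < cos (θ / 2) :=
  cos_pos_of_mem_Ioo ⟨by linarith [h.1, pi_pos], by linarith [h.2]⟩

lemma jweight_pos (α β : ℝ) {θ : ℝ} (h : θ ∈ Ioo 0 π) : 0 < jweight α β θ :=
  mul_pos (rpow_pos_of_pos (sin_half_pos h) _) (rpow_pos_of_pos (cos_half_pos h) _)

lemma measurable_jweight (α β : ℝ) : Measurable (jweight α β) := by
  unfold jweight
  fun_prop

lemma ae_mem_Ioo (α β : ℝ) : ∀ᵐ θ ∂(μJ α β), θ ∈ Ioo 0 π :=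
  (withDensity_absolutelyContinuous _ _).ae_le (ae_restrict_mem measurableSet_Ioo)

lemma integral_μJ (α β : ℝ) (f : ℝ → ℝ) :
    ∫ θ, f θ ∂(μJ α β) = ∫ θ in Ioo 0 π, jweight α β θ * f θ := by
  change ∫ θ, f θ ∂((volume.restrict (Ioo 0 π)).withDensity
    fun θ => ENNReal.ofReal (jweight α β θ)) = _
  rw [integral_withDensity_eq_integral_toReal_smul
    (measurable_jweight α β).ennreal_ofReal (by simp)]
  refine setIntegral_congr_fun measurableSet_Ioo fun θ hθ => ?_
  simp only [smul_eq_mul, ENNReal.toReal_ofReal (jweight_pos α β hθ).le]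

lemma integrable_μJ_iff (α β : ℝ) (f : ℝ → ℝ) :
    Integrable f (μJ α β) ↔ IntegrableOn (fun θ => jweight α β θ * f θ) (Ioo 0 π) := by
  change Integrable f ((volume.restrict (Ioo 0 π)).withDensity
    fun θ => ENNReal.ofReal (jweight α β θ)) ↔ _
  rw [integrable_withDensity_iff_integrable_smul'
    (measurable_jweight α β).ennreal_ofReal (by simp)]
  refine integrableOn_congr_fun (fun θ hθ => ?_) measurableSet_Ioo
  simp only [smul_eq_mul, ENNReal.toReal_ofReal (jweight_pos α β hθ).le]

section
variable {α β : ℝ}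

lemma IsOrthoSeq.isFiniteMeasure {p : ℕ → Polynomial ℝ} (hp : IsOrthoSeq α β p) :
    IsFiniteMeasure (μJ α β) := by
  have h0 := hp.ortho 0 0
  rw [Polynomial.eq_C_of_natDegree_eq_zero (hp.natDegree 0)] at h0
  simp only [Polynomial.eval_C, if_true] at h0
  by_contra hcon
  rw [integral_undef] at h0
  · norm_num at h0
  · rw [integrable_const_iff]
    rintro (h | h)
    · rw [h] at h0; simp at h0
    · exact hcon h

lemma integrable_of_continuousOn [IsFiniteMeasure (μJ α β)] {f : ℝ → ℝ}
    (hf : ContinuousOn f (Icc 0 π)) :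
    Integrable f (μJ α β) := by
  obtain ⟨C, hC⟩ := isCompact_Icc.exists_bound_of_continuousOn hf
  refine Integrable.of_bound (C := C) ?_ ?_
  · refine AEStronglyMeasurable.mono_ac (withDensity_absolutelyContinuous _ _) ?_
    exact (hf.mono Ioo_subset_Icc_self).aestronglyMeasurable measurableSet_Ioo
  · filter_upwards [ae_mem_Ioo α β] with θ hθ using hC θ (Ioo_subset_Icc_self hθ)

lemma integrable_of_continuous [IsFiniteMeasure (μJ α β)] {f : ℝ → ℝ} (hf : Continuous f) :
    Integrable f (μJ α β) := integrable_of_continuousOn hf.continuousOn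

/-- The Jacobi differential operator in the variable `x = cos θ`. -/
def jop (α β : ℝ) (p : Polynomial ℝ) : Polynomial ℝ :=
  (1 - Polynomial.X ^ 2) * p.derivative.derivative
    - (Polynomial.C (α + β + 2) * Polynomial.X + Polynomial.C (α - β)) * p.derivative

/-- The derivative of `θ ↦ p (cos θ)`. -/
def dcos (p : Polynomial ℝ) (θ : ℝ) : ℝ := -sin θ * p.derivative.eval (cos θ)

lemma hasDerivAt_eval_cos (p : Polynomial ℝ) (θ : ℝ) :
    HasDerivAt (fun θ => p.eval (cos θ)) (dcos p θ) θ := by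
  refine ((p.hasDerivAt (cos θ)).comp θ (hasDerivAt_cos θ)).congr_deriv ?_
  unfold dcos; ring

lemma continuous_eval_cos (p : Polynomial ℝ) : Continuous (fun θ => p.eval (cos θ)) := by
  fun_prop

lemma continuous_dcos (p : Polynomial ℝ) : Continuous (dcos p) := by
  unfold dcos; fun_prop

/-- The logarithmic derivative of the Jacobi weight. -/
def jlog (α β θ : ℝ) : ℝ :=
  (α + 1 / 2) * (cos (θ / 2) / sin (θ / 2)) - (β + 1 / 2) * (sin (θ / 2) / cos (θ / 2))

lemma hasDerivAt_jweight (α β : ℝ) {θ : ℝ} (h : θ ∈ Ioo 0 π) :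
    HasDerivAt (jweight α β) (jweight α β θ * jlog α β θ) θ := by
  have hs := sin_half_pos h
  have hc := cos_half_pos h
  have h1 : HasDerivAt (fun x : ℝ => sin (x / 2)) (cos (θ / 2) * (1 / 2)) θ :=
    ((hasDerivAt_id θ).div_const 2).sin
  have h2 : HasDerivAt (fun x : ℝ => cos (x / 2)) (-sin (θ / 2) * (1 / 2)) θ :=
    ((hasDerivAt_id θ).div_const 2).cos
  refine ((h1.rpow_const (p := 2 * α + 1) (Or.inl hs.ne')).mul
    (h2.rpow_const (p := 2 * β + 1) (Or.inl hc.ne'))).congr_deriv ?_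
  unfold jweight jlog
  rw [rpow_sub hs, rpow_sub hc, rpow_one, rpow_one]
  field_simp
  ring

lemma hasDerivAt_dcos (p : Polynomial ℝ) {θ : ℝ} (h : θ ∈ Ioo 0 π) :
    HasDerivAt (dcos p) ((jop α β p).eval (cos θ) - jlog α β θ * dcos p θ) θ := by
  have h1 := (hasDerivAt_sin θ).neg.mul (hasDerivAt_eval_cos p.derivative θ)
  refine h1.congr_deriv ?_
  have hs := (sin_half_pos h).ne'
  have hc := (cos_half_pos h).ne'
  have e1 : sin θ = 2 * sin (θ / 2) * cos (θ / 2) := by rw [← sin_two_mul]; ring_nf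
  have e2 : cos θ = 2 * cos (θ / 2) ^ 2 - 1 := by rw [← cos_two_mul]; ring_nf
  have e3 : sin (θ / 2) ^ 2 = 1 - cos (θ / 2) ^ 2 := by rw [sin_sq]
  have e4 : jlog α β θ * sin θ = (α + β + 1) * cos θ + (α - β) := by
    unfold jlog
    rw [e1, e2]
    field_simp
    rw [e3]; ring
  simp only [jop, dcos, Polynomial.eval_sub, Polynomial.eval_mul, Polynomial.eval_add,
    Polynomial.eval_pow, Polynomial.eval_X, Polynomial.eval_C, Polynomial.eval_one, Pi.neg_apply]
  have e5 := sin_sq θ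
  linear_combination -(Polynomial.eval (cos θ) p.derivative) * e4
    + (Polynomial.eval (cos θ) p.derivative.derivative) * e5

lemma continuous_sin_mul_jweight (hα : -1 < α) (hβ : -1 < β) :
    Continuous fun θ : ℝ => 2 * (sin (θ / 2) ^ (2 * α + 2) * cos (θ / 2) ^ (2 * β + 2)) := by
  refine continuous_const.mul (Continuous.mul ?_ ?_)
  · exact (by fun_prop : Continuous fun θ : ℝ => sin (θ / 2)).rpow_const
      fun x => Or.inr (by linarith)
  · exact (by fun_prop : Continuous fun θ : ℝ => cos (θ / 2)).rpow_const
      fun x => Or.inr (by linarith)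

lemma jweight_mul_sin (α β : ℝ) {θ : ℝ} (h : θ ∈ Ioo 0 π) :
    jweight α β θ * sin θ = 2 * (sin (θ / 2) ^ (2 * α + 2) * cos (θ / 2) ^ (2 * β + 2)) := by
  have hs := sin_half_pos h
  have hc := cos_half_pos h
  have e1 : sin θ = 2 * sin (θ / 2) * cos (θ / 2) := by rw [← sin_two_mul]; ring_nf
  rw [e1, jweight, show 2 * α + 2 = (2 * α + 1) + 1 by ring,
    show 2 * β + 2 = (2 * β + 1) + 1 by ring, rpow_add_one hs.ne' (2 * α + 1),
    rpow_add_one hc.ne' (2 * β + 1)]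
  ring

/-- Integration of the derivative of `w · g · deriv v` up to `y ≤ π`, where `v = q (cos θ)`. -/
lemma integral_mul_jop_upto (hα : -1 < α) (hβ : -1 < β) [IsFiniteMeasure (μJ α β)] {g g' : ℝ → ℝ}
    (hg : ∀ x, HasDerivAt g (g' x) x) (hg' : Continuous g') (q : Polynomial ℝ)
    {y : ℝ} (hy0 : 0 ≤ y) (hy : y ≤ π) :
    ∫ θ in (0 : ℝ)..y, jweight α β θ * (g θ * (jop α β q).eval (cos θ) + g' θ * dcos q θ) =
      2 * (sin (y / 2) ^ (2 * α + 2) * cos (y / 2) ^ (2 * β + 2)) *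
        (-(g y * q.derivative.eval (cos y))) := by
  have hgc : Continuous g := continuous_iff_continuousAt.2 fun x => (hg x).continuousAt
  set Φ : ℝ → ℝ := fun θ => 2 * (sin (θ / 2) ^ (2 * α + 2) * cos (θ / 2) ^ (2 * β + 2)) *
    (-(g θ * q.derivative.eval (cos θ))) with hΦ
  have hΦc : Continuous Φ := (continuous_sin_mul_jweight hα hβ).mul
    (by have := continuous_eval_cos q.derivative; fun_prop)
  have h0 : Φ 0 = 0 := by
    simp only [hΦ]
    rw [zero_div, sin_zero, zero_rpow (by linarith)]; ring
  have hInteg : Integrable (fun θ => g θ * (jop α β q).eval (cos θ) + g' θ * dcos q θ) (μJ α β) := by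
    apply integrable_of_continuous
    have := continuous_eval_cos (jop α β q)
    have := continuous_dcos q
    fun_prop
  rw [integrable_μJ_iff] at hInteg
  have key := intervalIntegral.integral_eq_sub_of_hasDerivAt_of_le (f := Φ)
    (f' := fun θ => jweight α β θ * (g θ * (jop α β q).eval (cos θ) + g' θ * dcos q θ))
    hy0 hΦc.continuousOn ?_ ?_
  · rw [key, h0, sub_zero]
  · intro x hx
    have hx' : x ∈ Ioo 0 π := ⟨hx.1, hx.2.trans_le hy⟩
    have hd := (hasDerivAt_jweight α β hx').mul ((hg x).mul (hasDerivAt_dcos (α := α) (β := β) q hx'))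
    have heq : Φ =ᶠ[𝓝 x] fun θ => jweight α β θ * (g θ * dcos q θ) := by
      filter_upwards [isOpen_Ioo.mem_nhds hx'] with z hz
      simp only [hΦ, ← jweight_mul_sin α β hz, dcos]; ring
    refine HasDerivAt.congr_of_eventuallyEq ?_ heq
    refine hd.congr_deriv ?_
    simp only [Pi.mul_apply]; ring
  · rw [intervalIntegrable_iff_integrableOn_Ioo_of_le hy0]
    exact hInteg.mono_set (Ioo_subset_Ioo_right hy)

lemma integral_mul_jop (hα : -1 < α) (hβ : -1 < β) [IsFiniteMeasure (μJ α β)] {g g' : ℝ → ℝ}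
    (hg : ∀ x, HasDerivAt g (g' x) x) (hg' : Continuous g') (q : Polynomial ℝ) :
    ∫ θ, g θ * (jop α β q).eval (cos θ) ∂(μJ α β) = -∫ θ, g' θ * dcos q θ ∂(μJ α β) := by
  have hgc : Continuous g := continuous_iff_continuousAt.2 fun x => (hg x).continuousAt
  have h1 := integral_mul_jop_upto hα hβ hg hg' q pi_pos.le le_rfl
  rw [cos_pi_div_two, zero_rpow (by linarith)] at h1
  rw [eq_neg_iff_add_eq_zero, ← integral_add, integral_μJ, ← integral_Ioc_eq_integral_Ioo,
    ← intervalIntegral.integral_of_le pi_pos.le, h1]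
  · ring
  · exact integrable_of_continuous (hgc.mul (continuous_eval_cos _))
  · exact integrable_of_continuous (hg'.mul (continuous_dcos _))

lemma integral_jop_comm (hα : -1 < α) (hβ : -1 < β) [IsFiniteMeasure (μJ α β)]
    (p q : Polynomial ℝ) :
    ∫ θ, p.eval (cos θ) * (jop α β q).eval (cos θ) ∂(μJ α β) =
      ∫ θ, (jop α β p).eval (cos θ) * q.eval (cos θ) ∂(μJ α β) := by
  rw [integral_mul_jop hα hβ (hasDerivAt_eval_cos p) (continuous_dcos p)]
  simp_rw [mul_comm (Polynomial.eval _ (jop α β p))]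
  rw [integral_mul_jop hα hβ (hasDerivAt_eval_cos q) (continuous_dcos q)]
  simp_rw [mul_comm (dcos p _)]

end

/-- The Fourier–Jacobi coefficient of `f` with respect to the sequence `p`. -/
def fcoef (α β : ℝ) (p : ℕ → Polynomial ℝ) (f : ℝ → ℝ) (k : ℕ) : ℝ :=
  ∫ θ, f θ * (p k).eval (cos θ) ∂(μJ α β)

section
variable {α β : ℝ} {p : ℕ → Polynomial ℝ}

lemma IsOrthoSeq.exists_expansion (hp : IsOrthoSeq α β p) (N : ℕ) :
    ∀ q : Polynomial ℝ, q.degree < N →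
      ∃ c : ℕ → ℝ, q = ∑ k ∈ Finset.range N, Polynomial.C (c k) * p k := by
  induction N with
  | zero =>
    intro q hq
    refine ⟨0, ?_⟩
    simpa using hq
  | succ N ih =>
    intro q hq
    have hlead : (p N).coeff N ≠ 0 := by
      have := hp.lead N
      rw [Polynomial.leadingCoeff, hp.natDegree] at this
      exact this.ne'
    obtain ⟨c, hc⟩ := ih (q - Polynomial.C (q.coeff N / (p N).coeff N) * p N) (by
      rw [Polynomial.degree_lt_iff_coeff_zero] at hq ⊢
      intro m hm
      rw [Polynomial.coeff_sub, Polynomial.coeff_C_mul]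
      rcases hm.eq_or_lt with rfl | hm
      · field_simp; ring
      · rw [hq m hm, Polynomial.coeff_eq_zero_of_natDegree_lt (p := p N) (n := m) (by rw [hp.natDegree]; exact hm)]
        ring)
    refine ⟨Function.update c N (q.coeff N / (p N).coeff N), ?_⟩
    rw [Finset.sum_range_succ, Function.update_self]
    have : ∑ k ∈ Finset.range N, Polynomial.C (Function.update c N (q.coeff N / (p N).coeff N) k)
        * p k = ∑ k ∈ Finset.range N, Polynomial.C (c k) * p k := by
      refine Finset.sum_congr rfl fun k hk => ?_
      rw [Function.update_of_ne (Finset.mem_range.1 hk).ne]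
    rw [this, ← hc]; ring

lemma IsOrthoSeq.fcoef_sum (hp : IsOrthoSeq α β p) (N : ℕ) (c : ℕ → ℝ) (k : ℕ) :
    fcoef α β p (fun θ => (∑ j ∈ Finset.range N, Polynomial.C (c j) * p j).eval (cos θ)) k =
      if k < N then c k else 0 := by
  have := hp.isFiniteMeasure
  unfold fcoef
  simp only [Polynomial.eval_finsetSum, Polynomial.eval_mul, Polynomial.eval_C, Finset.sum_mul]
  rw [integral_finsetSum]
  · simp only [mul_assoc, integral_const_mul, hp.ortho]
    simp
  · intro i _
    apply integrable_of_continuous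
    have := continuous_eval_cos (p i)
    have := continuous_eval_cos (p k)
    fun_prop

lemma IsOrthoSeq.expansion (hp : IsOrthoSeq α β p) {N : ℕ} {q : Polynomial ℝ}
    (hq : q.degree < N) :
    q = ∑ k ∈ Finset.range N,
      Polynomial.C (fcoef α β p (fun θ => q.eval (cos θ)) k) * p k := by
  obtain ⟨c, hc⟩ := hp.exists_expansion N q hq
  have h := hp.fcoef_sum N c
  rw [← hc] at h
  conv_lhs => rw [hc]
  refine Finset.sum_congr rfl fun k hk => ?_
  rw [h, if_pos (Finset.mem_range.1 hk)]

lemma IsOrthoSeq.fcoef_eq_zero (hp : IsOrthoSeq α β p) {k : ℕ} {q : Polynomial ℝ}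
    (hq : q.degree < k) : fcoef α β p (fun θ => q.eval (cos θ)) k = 0 := by
  obtain ⟨c, hc⟩ := hp.exists_expansion k q hq
  have h := hp.fcoef_sum k c k
  rw [← hc] at h
  simpa using h

lemma coeff_jop (α β : ℝ) (q : Polynomial ℝ) (m : ℕ) :
    (jop α β q).coeff m = (m + 2) * (m + 1) * q.coeff (m + 2) - m * (m + α + β + 1) * q.coeff m
      - (α - β) * (m + 1) * q.coeff (m + 1) := by
  have h1 : jop α β q = q.derivative.derivative - Polynomial.X ^ 2 * q.derivative.derivative
      - Polynomial.C (α + β + 2) * (Polynomial.X * q.derivative)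
      - Polynomial.C (α - β) * q.derivative := by unfold jop; ring
  rw [h1]
  simp only [Polynomial.coeff_sub, Polynomial.coeff_C_mul, Polynomial.coeff_derivative]
  rcases m with _ | _ | m
  · simp [Polynomial.coeff_derivative]; ring
  · simp [Polynomial.coeff_X_pow_mul', Polynomial.coeff_derivative]; ring
  · simp [Polynomial.coeff_X_pow_mul', Polynomial.coeff_derivative]; ring

lemma degree_jop_lt {q : Polynomial ℝ} {N : ℕ} (hq : q.degree < N) :
    (jop α β q).degree < N := by
  rw [Polynomial.degree_lt_iff_coeff_zero] at hq ⊢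
  intro m hm
  rw [coeff_jop, hq m hm, hq (m + 1) (by omega), hq (m + 2) (by omega)]; ring

lemma IsOrthoSeq.degree_lt (hp : IsOrthoSeq α β p) {k N : ℕ} (h : k < N) :
    (p k).degree < N := by
  rw [Polynomial.degree_lt_iff_coeff_zero]
  intro m hm
  exact Polynomial.coeff_eq_zero_of_natDegree_lt (by rw [hp.natDegree]; omega)

lemma IsOrthoSeq.jop_eq (hp : IsOrthoSeq α β p) (hα : -1 < α) (hβ : -1 < β) (n : ℕ) :
    jop α β (p n) = Polynomial.C (-(n * (n + α + β + 1))) * p n := by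
  have := hp.isFiniteMeasure
  have h1 := hp.expansion (N := n + 1) (degree_jop_lt (α := α) (β := β)
    (hp.degree_lt (Nat.lt_succ_self n)))
  have h2 : ∀ k ∈ Finset.range n, Polynomial.C (fcoef α β p
      (fun θ => (jop α β (p n)).eval (cos θ)) k) * p k = 0 := by
    intro k hk
    have : fcoef α β p (fun θ => (jop α β (p n)).eval (cos θ)) k = 0 := by
      unfold fcoef
      rw [← integral_jop_comm hα hβ]
      have h3 := hp.fcoef_eq_zero (degree_jop_lt (α := α) (β := β)
        (hp.degree_lt (Finset.mem_range.1 hk)))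
      unfold fcoef at h3
      simpa only [mul_comm] using h3
    rw [this]; simp
  rw [Finset.sum_range_succ, Finset.sum_eq_zero h2, zero_add] at h1
  have h4 := congrArg (fun r => Polynomial.coeff r n) h1
  simp only [Polynomial.coeff_C_mul, coeff_jop] at h4
  have hlead : (p n).coeff n ≠ 0 := by
    have := hp.lead n
    rw [Polynomial.leadingCoeff, hp.natDegree] at this
    exact this.ne'
  rw [Polynomial.coeff_eq_zero_of_natDegree_lt (n := n + 2) (by rw [hp.natDegree]; omega),
    Polynomial.coeff_eq_zero_of_natDegree_lt (n := n + 1) (by rw [hp.natDegree]; omega)] at h4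
  have h5 := mul_right_cancel₀ hlead (show -(n * (n + α + β + 1)) * (p n).coeff n = _ by
    rw [← h4]; ring)
  rw [h1, ← h5]

lemma IsOrthoSeq.integral_dcos_sq (hp : IsOrthoSeq α β p) (hα : -1 < α) (hβ : -1 < β) (n : ℕ) :
    ∫ θ, dcos (p n) θ ^ 2 ∂(μJ α β) = n * (n + α + β + 1) := by
  have := hp.isFiniteMeasure
  have h := integral_mul_jop hα hβ (hasDerivAt_eval_cos (p n)) (continuous_dcos _) (p n)
  rw [hp.jop_eq hα hβ] at h
  have h2 := hp.ortho n n
  simp only [Polynomial.eval_mul, Polynomial.eval_C, if_true] at h h2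
  simp only [mul_left_comm _ (-((n : ℝ) * (n + α + β + 1))), integral_const_mul, h2] at h
  simp only [pow_two]
  linarith

/-- The reflected sequence `(-1)^n p_n(-x)`, orthonormal for the swapped parameters. -/
def reflSeq (p : ℕ → Polynomial ℝ) (n : ℕ) : Polynomial ℝ :=
  Polynomial.C ((-1) ^ n) * (p n).comp (-Polynomial.X)

lemma reflSeq_eval (p : ℕ → Polynomial ℝ) (n : ℕ) (θ : ℝ) :
    (reflSeq p n).eval (cos (π - θ)) = (-1) ^ n * (p n).eval (cos θ) := by
  simp [reflSeq, cos_pi_sub]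

lemma reflSeq_dcos (p : ℕ → Polynomial ℝ) (n : ℕ) (θ : ℝ) :
    dcos (reflSeq p n) (π - θ) = -((-1) ^ n * dcos (p n) θ) := by
  unfold reflSeq dcos
  rw [Polynomial.derivative_C_mul, Polynomial.eval_C_mul, Polynomial.derivative_comp]
  simp [cos_pi_sub]
  ring

lemma jweight_refl (α β θ : ℝ) : jweight β α (π - θ) = jweight α β θ := by
  unfold jweight
  rw [sub_div, sin_pi_div_two_sub, cos_pi_div_two_sub, mul_comm]

lemma integral_μJ_refl (α β : ℝ) (f : ℝ → ℝ) :
    ∫ θ, f (π - θ) ∂(μJ β α) = ∫ θ, f θ ∂(μJ α β) := by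
  rw [integral_μJ, integral_μJ, ← integral_Ioc_eq_integral_Ioo, ← integral_Ioc_eq_integral_Ioo,
    ← intervalIntegral.integral_of_le pi_pos.le, ← intervalIntegral.integral_of_le pi_pos.le]
  have := intervalIntegral.integral_comp_sub_left (a := 0) (b := π)
    (fun θ => jweight β α θ * f (π - θ)) π
  rw [sub_self, sub_zero] at this
  rw [← this]
  simp only [jweight_refl, sub_sub_cancel]

lemma IsOrthoSeq.refl (hp : IsOrthoSeq α β p) : IsOrthoSeq β α (reflSeq p) where
  natDegree n := by
    unfold reflSeq
    rw [Polynomial.natDegree_C_mul (by positivity), Polynomial.natDegree_comp,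
      Polynomial.natDegree_neg, Polynomial.natDegree_X, mul_one, hp.natDegree]
  lead n := by
    unfold reflSeq
    rw [Polynomial.leadingCoeff_mul, Polynomial.leadingCoeff_C, Polynomial.leadingCoeff_comp
      (by simp), hp.natDegree, Polynomial.leadingCoeff_neg, Polynomial.leadingCoeff_X]
    have : ((-1 : ℝ) ^ n * ((p n).leadingCoeff * (-1) ^ n)) = (p n).leadingCoeff := by
      rw [mul_left_comm, ← mul_pow]; simp
    rw [this]; exact hp.lead n
  ortho n m := by
    rw [← hp.ortho n m, ← integral_μJ_refl α β]
    have h := fun k θ => reflSeq_eval p k (π - θ)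
    simp only [sub_sub_cancel] at h
    have h2 : ∀ θ, (reflSeq p n).eval (cos θ) * (reflSeq p m).eval (cos θ) =
        ((-1) ^ n * (-1) ^ m) * ((p n).eval (cos (π - θ)) * (p m).eval (cos (π - θ))) := by
      intro θ; rw [h, h]; ring
    simp_rw [h2, integral_const_mul]
    rw [integral_μJ_refl α β (fun θ => (p n).eval (cos θ) * (p m).eval (cos θ)), hp.ortho]
    split_ifs with hnm
    · subst hnm; rw [← mul_pow]; simp
    · simp
end

lemma rpow_le_max_rpow {l x h : ℝ} (hl : 0 < l) (hlx : l ≤ x) (hxh : x ≤ h) (a : ℝ) :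
    x ^ a ≤ max (l ^ a) (h ^ a) := by
  rcases le_total 0 a with ha | ha
  · exact le_max_of_le_right (rpow_le_rpow (hl.le.trans hlx) hxh ha)
  · exact le_max_of_le_left (rpow_le_rpow_of_nonpos hl hlx ha)

lemma min_rpow_le_rpow {l x h : ℝ} (hl : 0 < l) (hlx : l ≤ x) (hxh : x ≤ h) (a : ℝ) :
    min (l ^ a) (h ^ a) ≤ x ^ a := by
  rcases le_total 0 a with ha | ha
  · exact min_le_of_left_le (rpow_le_rpow hl.le hlx ha)
  · exact min_le_of_right_le (rpow_le_rpow_of_nonpos (hl.trans_le hlx) hxh ha)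

lemma sin_half_bounds {θ : ℝ} (h0 : 0 ≤ θ) (h1 : θ ≤ π) :
    1 / π * θ ≤ sin (θ / 2) ∧ sin (θ / 2) ≤ 1 / 2 * θ := by
  constructor
  · have := mul_le_sin (x := θ / 2) (by linarith) (by linarith)
    calc 1 / π * θ = 2 / π * (θ / 2) := by ring
      _ ≤ _ := this
  · have := sin_le (x := θ / 2) (by linarith)
    linarith

lemma cos_half_bounds {θ : ℝ} (h0 : 0 ≤ θ) (h1 : θ ≤ π) :
    1 / π * (π - θ) ≤ cos (θ / 2) ∧ cos (θ / 2) ≤ 1 / 2 * (π - θ) := by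
  have := sin_half_bounds (θ := π - θ) (by linarith) (by linarith)
  rwa [sub_div, sin_pi_div_two_sub] at this

lemma cos_half_ge {θ : ℝ} (h0 : 0 < θ) (h1 : θ ≤ 3 * π / 4) : 1 / 4 ≤ cos (θ / 2) := by
  refine le_trans ?_ (cos_half_bounds h0.le (by linarith [pi_pos])).1
  rw [div_mul_eq_mul_div, one_mul, le_div_iff₀ pi_pos]
  linarith

/-- The density of the Jacobi weight is comparable with a power near `0`. -/
lemma exists_jweight_bounds (α β : ℝ) : ∃ c C : ℝ, 0 < c ∧ 0 < C ∧ ∀ θ ∈ Ioc 0 (3 * π / 4),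
    c * θ ^ (2 * α + 1) ≤ jweight α β θ ∧ jweight α β θ ≤ C * θ ^ (2 * α + 1) := by
  have hpi := pi_pos
  refine ⟨min ((1 / π) ^ (2 * α + 1)) ((1 / 2) ^ (2 * α + 1)) *
      min ((1 / 4) ^ (2 * β + 1)) (1 ^ (2 * β + 1)),
    max ((1 / π) ^ (2 * α + 1)) ((1 / 2) ^ (2 * α + 1)) *
      max ((1 / 4) ^ (2 * β + 1)) (1 ^ (2 * β + 1)), ?_, ?_, ?_⟩
  · refine mul_pos (lt_min ?_ ?_) (lt_min ?_ ?_) <;> positivity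
  · refine mul_pos (lt_max_of_lt_left ?_) (lt_max_of_lt_left ?_) <;> positivity
  · intro θ hθ
    have hs := sin_half_bounds hθ.1.le (by linarith [hθ.2])
    have hc := cos_half_ge hθ.1 hθ.2
    have hc1 := cos_le_one (θ / 2)
    have e : sin (θ / 2) = (sin (θ / 2) / θ) * θ := by field_simp [hθ.1.ne']
    have q1 : 1 / π ≤ sin (θ / 2) / θ := by rw [le_div_iff₀ hθ.1]; exact hs.1
    have q2 : sin (θ / 2) / θ ≤ 1 / 2 := by rw [div_le_iff₀ hθ.1]; exact hs.2
    have q0 : 0 < 1 / π := by positivity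
    have hpow : sin (θ / 2) ^ (2 * α + 1) = (sin (θ / 2) / θ) ^ (2 * α + 1) * θ ^ (2 * α + 1) := by
      rw [← mul_rpow (q0.le.trans q1) hθ.1.le, ← e]
    have hθp : 0 < θ ^ (2 * α + 1) := rpow_pos_of_pos hθ.1 _
    unfold jweight
    rw [hpow]
    have a1 := min_rpow_le_rpow q0 q1 q2 (2 * α + 1)
    have a2 := rpow_le_max_rpow q0 q1 q2 (2 * α + 1)
    have b1 := min_rpow_le_rpow (by norm_num) hc hc1 (2 * β + 1)
    have b2 := rpow_le_max_rpow (by norm_num) hc hc1 (2 * β + 1)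
    have a0 : 0 < min ((1 / π) ^ (2 * α + 1)) ((1 / 2) ^ (2 * α + 1)) :=
      lt_min (by positivity) (by positivity)
    have b0 : 0 < min ((1 / 4 : ℝ) ^ (2 * β + 1)) (1 ^ (2 * β + 1)) :=
      lt_min (by positivity) (by positivity)
    constructor
    · rw [mul_right_comm]
      have := mul_nonneg (a0.le.trans a1) hθp.le
      gcongr
    · rw [mul_right_comm _ _ (θ ^ (2 * α + 1))]
      have := b0.le.trans b1
      have := a0.le.trans (a1.trans a2)
      gcongr

/-- The derivative of `jlog`. -/
def jlogDeriv (α β θ : ℝ) : ℝ :=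
  -(α + 1 / 2) / (2 * sin (θ / 2) ^ 2) - (β + 1 / 2) / (2 * cos (θ / 2) ^ 2)

lemma hasDerivAt_jlog (α β : ℝ) {θ : ℝ} (h : θ ∈ Ioo 0 π) :
    HasDerivAt (jlog α β) (jlogDeriv α β θ) θ := by
  have hs := (sin_half_pos h).ne'
  have hc := (cos_half_pos h).ne'
  have h1 : HasDerivAt (fun x : ℝ => sin (x / 2)) (cos (θ / 2) * (1 / 2)) θ :=
    ((hasDerivAt_id θ).div_const 2).sin
  have h2 : HasDerivAt (fun x : ℝ => cos (x / 2)) (-sin (θ / 2) * (1 / 2)) θ :=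
    ((hasDerivAt_id θ).div_const 2).cos
  refine (((h2.div h1 hs).const_mul (α + 1 / 2)).sub
    ((h1.div h2 hc).const_mul (β + 1 / 2))).congr_deriv ?_
  unfold jlogDeriv
  have e := sin_sq_add_cos_sq (θ / 2)
  have e1 : -sin (θ / 2) * (1 / 2) * sin (θ / 2) - cos (θ / 2) * (cos (θ / 2) * (1 / 2)) =
    -(1 / 2) := by linear_combination (-1 / 2) * e
  have e2 : cos (θ / 2) * (1 / 2) * cos (θ / 2) - sin (θ / 2) * (-sin (θ / 2) * (1 / 2)) =
    1 / 2 := by linear_combination (1 / 2) * e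
  rw [e1, e2]
  field_simp

lemma exists_jlog_bounds (α β : ℝ) : ∃ C : ℝ, 0 < C ∧ ∀ θ ∈ Ioc 0 (3 * π / 4),
    |jlog α β θ| ≤ C / θ ∧ |jlogDeriv α β θ| ≤ C / θ ^ 2 := by
  have hpi := pi_pos
  have hpi3 := pi_gt_three
  refine ⟨(|α + 1 / 2| + |β + 1 / 2|) * (9 * π ^ 2) + 1, by positivity, fun θ hθ => ?_⟩
  have h0 := hθ.1
  have hs := (sin_half_bounds h0.le (by linarith [hθ.2])).1
  have hc := cos_half_ge h0 hθ.2
  have hc1 := cos_le_one (θ / 2)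
  have hs1 := sin_le_one (θ / 2)
  have hsp : 0 < sin (θ / 2) := lt_of_lt_of_le (by positivity) hs
  have hcp : 0 < cos (θ / 2) := by linarith
  have hθs : θ ≤ π * sin (θ / 2) := by
    have := mul_le_mul_of_nonneg_left hs hpi.le
    field_simp at this; exact this
  have hθc : θ ≤ 3 * π * cos (θ / 2) := by nlinarith [hθ.2]
  have hbig : π ≤ 9 * π ^ 2 := by nlinarith
  have hbig2 : 3 * π ≤ 9 * π ^ 2 := by nlinarith
  constructor
  · have k1 : cos (θ / 2) / sin (θ / 2) ≤ 9 * π ^ 2 / θ := by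
      rw [div_le_div_iff₀ hsp h0]
      nlinarith
    have k2 : sin (θ / 2) / cos (θ / 2) ≤ 9 * π ^ 2 / θ := by
      rw [div_le_div_iff₀ hcp h0]
      nlinarith
    have k1' : 0 ≤ cos (θ / 2) / sin (θ / 2) := by positivity
    have k2' : 0 ≤ sin (θ / 2) / cos (θ / 2) := by positivity
    unfold jlog
    calc _ ≤ |α + 1 / 2| * (cos (θ / 2) / sin (θ / 2)) + |β + 1 / 2| * (sin (θ / 2) / cos (θ / 2)) := by
          refine (abs_sub _ _).trans ?_
          rw [abs_mul, abs_mul, abs_of_nonneg k1', abs_of_nonneg k2']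
      _ ≤ |α + 1 / 2| * (9 * π ^ 2 / θ) + |β + 1 / 2| * (9 * π ^ 2 / θ) := by gcongr
      _ = ((|α + 1 / 2| + |β + 1 / 2|) * (9 * π ^ 2)) / θ := by ring
      _ ≤ _ := by gcongr; linarith
  · have k1 : 1 / (2 * sin (θ / 2) ^ 2) ≤ 9 * π ^ 2 / θ ^ 2 := by
      rw [div_le_div_iff₀ (by positivity) (by positivity)]
      nlinarith [pow_le_pow_left₀ h0.le hθs 2]
    have k2 : 1 / (2 * cos (θ / 2) ^ 2) ≤ 9 * π ^ 2 / θ ^ 2 := by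
      rw [div_le_div_iff₀ (by positivity) (by positivity)]
      nlinarith [pow_le_pow_left₀ h0.le hθc 2]
    have e : jlogDeriv α β θ = -((α + 1 / 2) * (1 / (2 * sin (θ / 2) ^ 2))) -
      (β + 1 / 2) * (1 / (2 * cos (θ / 2) ^ 2)) := by unfold jlogDeriv; ring
    rw [e]
    calc _ ≤ |α + 1 / 2| * (1 / (2 * sin (θ / 2) ^ 2)) + |β + 1 / 2| * (1 / (2 * cos (θ / 2) ^ 2)) := by
          refine (abs_sub _ _).trans ?_
          rw [abs_neg, abs_mul, abs_mul, abs_of_nonneg (a := 1 / (2 * sin (θ / 2) ^ 2)) (by positivity),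
            abs_of_nonneg (a := 1 / (2 * cos (θ / 2) ^ 2)) (by positivity)]
      _ ≤ |α + 1 / 2| * (9 * π ^ 2 / θ ^ 2) + |β + 1 / 2| * (9 * π ^ 2 / θ ^ 2) := by gcongr
      _ = ((|α + 1 / 2| + |β + 1 / 2|) * (9 * π ^ 2)) / θ ^ 2 := by ring
      _ ≤ _ := by gcongr; linarith

lemma exists_primitive_jweight_bound {α β : ℝ} (hα : -1 < α) : ∃ C : ℝ, 0 < C ∧
    ∀ y ∈ Ioc 0 (3 * π / 4), IntervalIntegrable (jweight α β) volume 0 y ∧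
      ∫ θ in (0 : ℝ)..y, jweight α β θ ≤ C * y * jweight α β y := by
  obtain ⟨c, C, hc, hC, h⟩ := exists_jweight_bounds α β
  refine ⟨C / (2 * α + 2) / c, by have : 0 < 2 * α + 2 := by linarith
                                  positivity, fun y hy => ?_⟩
  have ha : 0 < 2 * α + 2 := by linarith
  have hInteg : IntervalIntegrable (fun θ : ℝ => C * θ ^ (2 * α + 1)) volume 0 y :=
    (intervalIntegral.intervalIntegrable_rpow' (by linarith)).const_mul C
  have hw : IntervalIntegrable (jweight α β) volume 0 y := by
    refine hInteg.mono_fun (measurable_jweight α β).aestronglyMeasurable ?_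
    filter_upwards [ae_restrict_mem measurableSet_uIoc] with θ hθ
    rw [uIoc_of_le hy.1.le] at hθ
    have hθ' : θ ∈ Ioc 0 (3 * π / 4) := ⟨hθ.1, hθ.2.trans hy.2⟩
    have hpos := jweight_pos α β (θ := θ) ⟨hθ'.1, by linarith [hθ'.2, pi_pos]⟩
    rw [norm_of_nonneg hpos.le, norm_of_nonneg (hpos.le.trans (h θ hθ').2)]
    exact (h θ hθ').2
  refine ⟨hw, ?_⟩
  calc ∫ θ in (0 : ℝ)..y, jweight α β θ ≤ ∫ θ in (0 : ℝ)..y, C * θ ^ (2 * α + 1) := by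
        refine intervalIntegral.integral_mono_on_of_le_Ioo hy.1.le hw hInteg fun θ hθ => ?_
        exact (h θ ⟨hθ.1, hθ.2.le.trans hy.2⟩).2
    _ = C / (2 * α + 2) * (y * y ^ (2 * α + 1)) := by
        rw [intervalIntegral.integral_const_mul, integral_rpow (Or.inl (by linarith)),
          zero_rpow (by linarith), mul_comm y, ← rpow_add_one hy.1.ne',
          show 2 * α + 1 + 1 = 2 * α + 2 by ring]
        ring
    _ = C / (2 * α + 2) / c * y * (c * y ^ (2 * α + 1)) := by field_simp
    _ ≤ _ := by
        have := (h y hy).1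
        have := hy.1.le
        gcongr

lemma rpow_le_of_comparable {x y k : ℝ} (a : ℝ) (hx : 0 < x) (hy : 0 < y) (h1 : y ≤ k * x)
    (h2 : x ≤ k * y) : y ^ a ≤ k ^ |a| * x ^ a := by
  have hk : 0 < k := by
    by_contra h
    nlinarith
  rcases le_total 0 a with ha | ha
  · rw [abs_of_nonneg ha, ← mul_rpow hk.le hx.le]
    exact rpow_le_rpow hy.le h1 ha
  · rw [abs_of_nonpos ha, rpow_neg hk.le, ← inv_rpow hk.le, ← mul_rpow (by positivity) hx.le]
    refine rpow_le_rpow_of_nonpos (by positivity) ?_ ha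
    rw [inv_mul_le_iff₀ hk]
    exact h2

/-- The energy density of an eigenfunction. -/
def eigenEnergy (Λ : ℝ) (q : Polynomial ℝ) (θ : ℝ) : ℝ :=
  Λ * q.eval (cos θ) ^ 2 + dcos q θ ^ 2

lemma continuous_eigenEnergy (Λ : ℝ) (q : Polynomial ℝ) : Continuous (eigenEnergy Λ q) := by
  have := continuous_eval_cos q
  have := continuous_dcos q
  unfold eigenEnergy
  fun_prop

section
variable {α β Λ : ℝ} {q : Polynomial ℝ}

lemma hasDerivAt_dcos_of_eigen (hq : jop α β q = Polynomial.C (-Λ) * q) {θ : ℝ}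
    (h : θ ∈ Ioo 0 π) :
    HasDerivAt (dcos q) (-Λ * q.eval (cos θ) - jlog α β θ * dcos q θ) θ := by
  have := hasDerivAt_dcos (α := α) (β := β) q h
  rwa [hq, Polynomial.eval_C_mul] at this

lemma hasDerivAt_eigenEnergy (hq : jop α β q = Polynomial.C (-Λ) * q) {θ : ℝ}
    (h : θ ∈ Ioo 0 π) :
    HasDerivAt (eigenEnergy Λ q) (-2 * jlog α β θ * dcos q θ ^ 2) θ := by
  have h1 := hasDerivAt_eval_cos q θ
  have h2 := hasDerivAt_dcos_of_eigen hq h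
  refine (((h1.pow 2).const_mul Λ).add (h2.pow 2)).congr_deriv ?_
  push_cast
  ring

/-- The energy grows at most like a power when `θ` decreases. -/
lemma eigenEnergy_le_rpow_mul (hq : jop α β q = Polynomial.C (-Λ) * q) (hΛ : 0 ≤ Λ) {C : ℝ}
    (hC : ∀ θ ∈ Ioc 0 (3 * π / 4), |jlog α β θ| ≤ C / θ) {a b : ℝ} (ha : 0 < a) (hab : a ≤ b)
    (hb : b ≤ 3 * π / 4) :
    eigenEnergy Λ q a ≤ (b / a) ^ (2 * C) * eigenEnergy Λ q b := by
  have hpi := pi_pos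
  have hder : ∀ θ ∈ Ioc 0 (3 * π / 4), HasDerivAt (fun x => x ^ (2 * C) * eigenEnergy Λ q x)
      (2 * C * θ ^ (2 * C - 1) * eigenEnergy Λ q θ +
        θ ^ (2 * C) * (-2 * jlog α β θ * dcos q θ ^ 2)) θ := fun θ hθ => by
    refine ((hasDerivAt_id θ).rpow_const (p := 2 * C) (Or.inl hθ.1.ne')).mul
      (hasDerivAt_eigenEnergy hq ⟨hθ.1, by linarith [hθ.2]⟩) |>.congr_deriv ?_
    simp
  have hmono : MonotoneOn (fun x => x ^ (2 * C) * eigenEnergy Λ q x) (Icc a b) := by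
    refine monotoneOn_of_deriv_nonneg (convex_Icc a b) ?_ ?_ ?_
    · exact fun θ hθ => (hder θ ⟨ha.trans_le hθ.1, hθ.2.trans hb⟩).continuousAt.continuousWithinAt
    · intro θ hθ
      rw [interior_Icc] at hθ
      exact (hder θ ⟨ha.trans hθ.1, hθ.2.le.trans hb⟩).differentiableAt.differentiableWithinAt
    · intro θ hθ
      rw [interior_Icc] at hθ
      have hθ' : θ ∈ Ioc 0 (3 * π / 4) := ⟨ha.trans hθ.1, hθ.2.le.trans hb⟩
      rw [(hder θ hθ').deriv, rpow_sub hθ'.1, rpow_one]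
      have h0 := hθ'.1
      have hj := hC θ hθ'
      have hC0 : 0 ≤ C / θ := (abs_nonneg _).trans hj
      have e : 2 * C * (θ ^ (2 * C) / θ) * eigenEnergy Λ q θ +
          θ ^ (2 * C) * (-2 * jlog α β θ * dcos q θ ^ 2) =
          2 * θ ^ (2 * C) * (C / θ * (Λ * q.eval (cos θ) ^ 2) +
            (C / θ - jlog α β θ) * dcos q θ ^ 2) := by
        unfold eigenEnergy; ring
      rw [e]
      have : 0 ≤ C / θ - jlog α β θ := by linarith [le_abs_self (jlog α β θ)]
      positivity
  have := hmono (left_mem_Icc.2 hab) (right_mem_Icc.2 hab) hab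
  simp only at this
  rw [div_rpow (ha.le.trans hab) ha.le, div_mul_eq_mul_div, le_div_iff₀ (by positivity)]
  linarith

/-- The corrected energy, almost constant away from the endpoint. -/
lemma hasDerivAt_corrected (hq : jop α β q = Polynomial.C (-Λ) * q) {θ : ℝ}
    (h : θ ∈ Ioo 0 π) :
    HasDerivAt (fun x => jweight α β x * (eigenEnergy Λ q x +
        jlog α β x * (q.eval (cos x) * dcos q x)))
      (jweight α β θ * (jlogDeriv α β θ * (q.eval (cos θ) * dcos q θ))) θ := by
  have h1 := hasDerivAt_eval_cos q θ
  have h2 := hasDerivAt_dcos_of_eigen hq h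
  have h3 := hasDerivAt_eigenEnergy hq h
  have h4 := hasDerivAt_jlog α β h
  have h5 := hasDerivAt_jweight α β h
  refine (h5.mul (h3.add (h4.mul (h1.mul h2)))).congr_deriv ?_
  simp only [Pi.add_apply, Pi.mul_apply]
  unfold eigenEnergy
  ring

lemma abs_mul_le_eigenEnergy (hΛ : 0 < Λ) (θ : ℝ) :
    |q.eval (cos θ) * dcos q θ| ≤ eigenEnergy Λ q θ / (2 * √Λ) := by
  have hs := sqrt_pos.2 hΛ
  rw [le_div_iff₀ (by positivity), abs_mul]
  unfold eigenEnergy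
  have h := sq_sqrt hΛ.le
  nlinarith [sq_nonneg (√Λ * |q.eval (cos θ)| - |dcos q θ|), sq_abs (q.eval (cos θ)),
    sq_abs (dcos q θ)]

lemma weighted_energy_le (hq : jop α β q = Polynomial.C (-Λ) * q) (hΛ : 0 < Λ) {C : ℝ}
    (hC0 : 0 < C)
    (hC : ∀ θ ∈ Ioc 0 (3 * π / 4), |jlog α β θ| ≤ C / θ ∧ |jlogDeriv α β θ| ≤ C / θ ^ 2)
    {a b : ℝ} (ha : C / √Λ ≤ a) (hab : a ≤ b) (hb : b ≤ 3 * π / 4) :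
    jweight α β a * eigenEnergy Λ q a ≤ 3 * exp 1 * (jweight α β b * eigenEnergy Λ q b) := by
  have hpi := pi_pos
  have hs := sqrt_pos.2 hΛ
  have ha0 : 0 < a := lt_of_lt_of_le (by positivity) ha
  set F : ℝ → ℝ := fun x => jweight α β x * (eigenEnergy Λ q x +
        jlog α β x * (q.eval (cos x) * dcos q x)) with hF
  have hE0 : ∀ θ, 0 ≤ eigenEnergy Λ q θ := fun θ => by unfold eigenEnergy; positivity
  have hmem : ∀ θ ∈ Icc a b, θ ∈ Ioc 0 (3 * π / 4) ∧ θ ∈ Ioo 0 π := fun θ hθ =>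
    ⟨⟨ha0.trans_le hθ.1, hθ.2.trans hb⟩, ⟨ha0.trans_le hθ.1, by linarith [hθ.2]⟩⟩
  have hcmp : ∀ θ ∈ Icc a b, |jlog α β θ * (q.eval (cos θ) * dcos q θ)| ≤
      eigenEnergy Λ q θ / 2 := fun θ hθ => by
    obtain ⟨h1, h2⟩ := hmem θ hθ
    rw [abs_mul]
    calc _ ≤ √Λ * (eigenEnergy Λ q θ / (2 * √Λ)) := by
          refine mul_le_mul ((hC θ h1).1.trans ?_) (abs_mul_le_eigenEnergy hΛ θ) (abs_nonneg _)
            hs.le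
          rw [div_le_iff₀ h1.1, ← div_le_iff₀' hs]
          exact ha.trans hθ.1
      _ = _ := by field_simp
  have hF1 : ∀ θ ∈ Icc a b, jweight α β θ * eigenEnergy Λ q θ ≤ 2 * F θ := fun θ hθ => by
    have := (abs_le.1 (hcmp θ hθ)).1
    have hw := jweight_pos α β (hmem θ hθ).2
    simp only [hF]; nlinarith
  have hF2 : ∀ θ ∈ Icc a b, F θ ≤ 3 / 2 * (jweight α β θ * eigenEnergy Λ q θ) := fun θ hθ => by
    have := (abs_le.1 (hcmp θ hθ)).2
    have hw := jweight_pos α β (hmem θ hθ).2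
    simp only [hF]; nlinarith
  have hder : ∀ θ ∈ Icc a b, HasDerivAt (fun x => F x * exp (-(C / √Λ) * x⁻¹))
      (exp (-(C / √Λ) * θ⁻¹) * (jweight α β θ * (jlogDeriv α β θ * (q.eval (cos θ) * dcos q θ))
        + F θ * (C / √Λ / θ ^ 2))) θ := fun θ hθ => by
    obtain ⟨h1, h2⟩ := hmem θ hθ
    refine ((hasDerivAt_corrected hq h2).mul
      (((hasDerivAt_inv h1.1.ne').const_mul (-(C / √Λ))).exp)).congr_deriv ?_
    simp only [hF]
    field_simp
    try ring
  have hmono : MonotoneOn (fun x => F x * exp (-(C / √Λ) * x⁻¹)) (Icc a b) := by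
    refine monotoneOn_of_deriv_nonneg (convex_Icc a b) ?_ ?_ ?_
    · exact fun θ hθ => (hder θ hθ).continuousAt.continuousWithinAt
    · intro θ hθ
      exact (hder θ (interior_subset hθ)).differentiableAt.differentiableWithinAt
    · intro θ hθ
      have hθ := interior_subset hθ
      obtain ⟨h1, h2⟩ := hmem θ hθ
      have h0 := h1.1
      rw [(hder θ hθ).deriv]
      refine mul_nonneg (exp_pos _).le ?_
      have hw := jweight_pos α β h2
      have k1 : |jlogDeriv α β θ * (q.eval (cos θ) * dcos q θ)| ≤
          C / θ ^ 2 * (eigenEnergy Λ q θ / (2 * √Λ)) := by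
        rw [abs_mul]
        exact mul_le_mul (hC θ h1).2 (abs_mul_le_eigenEnergy hΛ θ) (abs_nonneg _)
          (by positivity)
      have k2 := (abs_le.1 k1).1
      have k3 : jweight α β θ * (C / θ ^ 2 * (eigenEnergy Λ q θ / (2 * √Λ))) ≤
          F θ * (C / √Λ / θ ^ 2) := by
        calc _ = (jweight α β θ * eigenEnergy Λ q θ) / 2 * (C / √Λ / θ ^ 2) := by
              field_simp
          _ ≤ _ := by
              refine mul_le_mul_of_nonneg_right ?_ (by positivity)
              linarith [hF1 θ hθ]
      have k4 := mul_le_mul_of_nonneg_left k2 hw.le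
      linarith
  have key := hmono (left_mem_Icc.2 hab) (right_mem_Icc.2 hab) hab
  simp only at key
  have hFb0 : 0 ≤ F b := by
    have := hF1 b (right_mem_Icc.2 hab)
    have := jweight_pos α β (hmem b (right_mem_Icc.2 hab)).2
    have := mul_nonneg this.le (hE0 b)
    linarith
  have e1 : exp (-(C / √Λ) * b⁻¹) ≤ 1 := by
    rw [exp_le_one_iff]
    have : 0 ≤ C / √Λ * b⁻¹ := by have := ha0.trans_le hab; positivity
    linarith
  have e2 : exp (-1) ≤ exp (-(C / √Λ) * a⁻¹) := by
    rw [exp_le_exp, neg_mul, neg_le_neg_iff, ← div_eq_mul_inv, div_le_one ha0]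
    exact ha
  have hFa0 : 0 ≤ F a := by
    have := hF1 a (left_mem_Icc.2 hab)
    have := jweight_pos α β (hmem a (left_mem_Icc.2 hab)).2
    have := mul_nonneg this.le (hE0 a)
    linarith
  have k5 : F a * exp (-1) ≤ F b := by
    calc _ ≤ F a * exp (-(C / √Λ) * a⁻¹) := mul_le_mul_of_nonneg_left e2 hFa0
      _ ≤ _ := key
      _ ≤ F b * 1 := mul_le_mul_of_nonneg_left e1 hFb0
      _ = _ := mul_one _
  have k6 : F a ≤ exp 1 * F b := by
    rw [exp_neg, ← div_eq_mul_inv, div_le_iff₀ (exp_pos 1)] at k5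
    linarith
  have := hF1 a (left_mem_Icc.2 hab)
  have := mul_le_mul_of_nonneg_left (hF2 b (right_mem_Icc.2 hab)) (exp_pos 1).le
  linarith

/-- Near the endpoint the energy is controlled by its value slightly further away. -/
lemma eigenEnergy_le_near (hα : -1 < α) (hβ : -1 < β) [IsFiniteMeasure (μJ α β)]
    (hq : jop α β q = Polynomial.C (-Λ) * q) (hΛ : 0 < Λ) {C : ℝ} (hC0 : 0 < C)
    (hC : ∀ y ∈ Ioc 0 (3 * π / 4), IntervalIntegrable (jweight α β) volume 0 y ∧
      ∫ θ in (0 : ℝ)..y, jweight α β θ ≤ C * y * jweight α β y)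
    {η : ℝ} (hη : η ∈ Ioc 0 (3 * π / 4)) (hCη : C * Λ * η ^ 2 ≤ 1 / 2)
    {y : ℝ} (hy : y ∈ Ioc 0 η) :
    eigenEnergy Λ q y ≤ (4 + 2 * C) * eigenEnergy Λ q η := by
  have hpi := pi_pos
  obtain ⟨y₀, hy₀, hmax⟩ := isCompact_Icc.exists_isMaxOn (nonempty_Icc.2 hη.1.le)
    (continuous_eval_cos q).abs.continuousOn
  set M := |q.eval (cos y₀)| with hM
  have hM0 : 0 ≤ M := abs_nonneg _
  have hu : ∀ x ∈ Icc 0 η, |q.eval (cos x)| ≤ M := fun x hx => hmax hx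
  have hv : ∀ x ∈ Icc 0 η, |dcos q x| ≤ Λ * C * M * x := fun x hx => by
    rcases hx.1.eq_or_lt with h0 | h0
    · subst h0; simp [dcos]
    have hx' : x ∈ Ioc 0 (3 * π / 4) := ⟨h0, hx.2.trans hη.2⟩
    have hxo : x ∈ Ioo 0 π := ⟨h0, by linarith [hx'.2]⟩
    have hw := jweight_pos α β hxo
    have h1 := integral_mul_jop_upto hα hβ (g := fun _ => 1) (g' := fun _ => 0)
      (fun x => hasDerivAt_const x 1) continuous_const q h0.le hxo.2.le
    rw [← jweight_mul_sin α β hxo] at h1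
    have h2 : jweight α β x * dcos q x = -Λ * ∫ θ in (0 : ℝ)..x,
        jweight α β θ * q.eval (cos θ) := by
      rw [← intervalIntegral.integral_const_mul]
      unfold dcos
      rw [show jweight α β x * (-sin x * q.derivative.eval (cos x)) =
        jweight α β x * sin x * (-(1 * q.derivative.eval (cos x))) by ring, ← h1]
      refine intervalIntegral.integral_congr fun θ _ => ?_
      simp only [hq, Polynomial.eval_C_mul]
      ring
    have h3 : |∫ θ in (0 : ℝ)..x, jweight α β θ * q.eval (cos θ)| ≤
        ∫ θ in (0 : ℝ)..x, M * jweight α β θ := by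
      rw [← Real.norm_eq_abs]
      refine intervalIntegral.norm_integral_le_of_norm_le h0.le ?_ ((hC x hx').1.const_mul M)
      refine Eventually.of_forall fun θ hθ => ?_
      have hw' := jweight_pos α β (θ := θ) ⟨hθ.1, by linarith [hθ.2, hxo.2]⟩
      rw [Real.norm_eq_abs, abs_mul, abs_of_pos hw', mul_comm]
      exact mul_le_mul_of_nonneg_right (hu θ ⟨hθ.1.le, hθ.2.trans hx.2⟩) hw'.le
    rw [intervalIntegral.integral_const_mul] at h3
    have h4 : jweight α β x * |dcos q x| ≤ jweight α β x * (Λ * C * M * x) := by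
      calc _ = |jweight α β x * dcos q x| := by rw [abs_mul, abs_of_pos hw]
        _ = Λ * |∫ θ in (0 : ℝ)..x, jweight α β θ * q.eval (cos θ)| := by
          rw [h2, abs_mul, abs_neg, abs_of_pos hΛ]
        _ ≤ Λ * (M * (C * x * jweight α β x)) := by
          refine mul_le_mul_of_nonneg_left (h3.trans ?_) hΛ.le
          exact mul_le_mul_of_nonneg_left (hC x hx').2 hM0
        _ = _ := by ring
    exact le_of_mul_le_mul_left h4 hw
  have hη0 := hη.1
  have hMη : M ≤ 2 * |q.eval (cos η)| := by
    have h1 : |q.eval (cos η) - q.eval (cos y₀)| ≤ Λ * C * M * η * |η - y₀| := by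
      have := (convex_Icc (0 : ℝ) η).norm_image_sub_le_of_norm_hasDerivWithin_le
        (f := fun x => q.eval (cos x)) (f' := dcos q) (C := Λ * C * M * η)
        (fun x _ => (hasDerivAt_eval_cos q x).hasDerivWithinAt)
        (fun x hx => (hv x hx).trans (mul_le_mul_of_nonneg_left hx.2 (by positivity)))
        hy₀ (right_mem_Icc.2 hη0.le)
      simpa using this
    have h2 : |η - y₀| ≤ η := by rw [abs_of_nonneg (by linarith [hy₀.2])]; linarith [hy₀.1]
    have h3 : Λ * C * M * η * |η - y₀| ≤ Λ * C * M * η * η := by gcongr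
    have h4 : Λ * C * M * η * η ≤ M / 2 := by nlinarith
    have h5 := abs_sub_abs_le_abs_sub (q.eval (cos y₀)) (q.eval (cos η))
    rw [abs_sub_comm] at h5
    linarith
  have hyI : y ∈ Icc 0 η := ⟨hy.1.le, hy.2⟩
  have k1 : q.eval (cos y) ^ 2 ≤ M ^ 2 := by
    rw [← sq_abs]; exact pow_le_pow_left₀ (abs_nonneg _) (hu y hyI) 2
  have k2 : dcos q y ^ 2 ≤ (Λ * C * M * η) ^ 2 := by
    rw [← sq_abs]
    refine pow_le_pow_left₀ (abs_nonneg _) ((hv y hyI).trans ?_) 2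
    exact mul_le_mul_of_nonneg_left hy.2 (by positivity)
  have k3 : (Λ * C * M * η) ^ 2 ≤ Λ * C * M ^ 2 * (1 / 2) := by
    calc _ = Λ * C * M ^ 2 * (C * Λ * η ^ 2) := by ring
      _ ≤ _ := by gcongr
  have k4 : M ^ 2 ≤ 4 * q.eval (cos η) ^ 2 := by
    rw [← sq_abs (q.eval (cos η))]
    nlinarith [abs_nonneg (q.eval (cos η))]
  unfold eigenEnergy
  calc _ ≤ Λ * M ^ 2 + Λ * C * M ^ 2 * (1 / 2) := by
        have := mul_le_mul_of_nonneg_left k1 hΛ.le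
        linarith
    _ = Λ * (1 + C / 2) * M ^ 2 := by ring
    _ ≤ Λ * (1 + C / 2) * (4 * q.eval (cos η) ^ 2) := by gcongr
    _ = (4 + 2 * C) * (Λ * q.eval (cos η) ^ 2) := by ring
    _ ≤ _ := by
      refine mul_le_mul_of_nonneg_left ?_ (by positivity)
      linarith [sq_nonneg (dcos q η)]

end

/-- The eigenvalue `n (n + α + β + 1)` of minus the Jacobi operator. -/
def jeig (α β : ℝ) (n : ℕ) : ℝ := n * (n + α + β + 1)

lemma exists_jeig_bounds {α β : ℝ} (hα : -1 < α) (hβ : -1 < β) : ∃ k : ℝ, 1 ≤ k ∧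
    ∀ n : ℕ, 1 ≤ n → (n / k) ^ 2 ≤ jeig α β n ∧ jeig α β n ≤ (k * n) ^ 2 := by
  set κ := α + β + 2 with hκ
  have hκ0 : 0 < κ := by linarith
  refine ⟨1 + κ + 1 / κ, by have : 0 < 1 / κ := by positivity
                            linarith, fun n hn => ?_⟩
  have hn' : (1 : ℝ) ≤ n := by exact_mod_cast hn
  have hk : 0 < 1 + κ + 1 / κ := by positivity
  have hinv : 0 < 1 / κ := by positivity
  unfold jeig
  rw [show (n : ℝ) + α + β + 1 = n + κ - 1 by rw [hκ]; ring]
  constructor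
  · rw [div_pow, sq, mul_div_assoc]
    refine mul_le_mul_of_nonneg_left ?_ (by positivity)
    rw [div_le_iff₀ (by positivity)]
    have h1 : 1 ≤ (1 + κ + 1 / κ) ^ 2 := by nlinarith
    have h2 : 1 ≤ κ * (1 + κ + 1 / κ) ^ 2 := by
      have : κ * (1 / κ) = 1 := by field_simp
      nlinarith
    rcases le_total 1 κ with h | h
    · nlinarith
    · nlinarith [mul_nonneg (sub_nonneg.2 hn') (sub_nonneg.2 h)]
  · rw [mul_pow]
    have : n + κ - 1 ≤ (1 + κ + 1 / κ) * n := by nlinarith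
    have h1 : (1 + κ + 1 / κ) ≤ (1 + κ + 1 / κ) ^ 2 := by nlinarith
    calc (n : ℝ) * (n + κ - 1) ≤ n * ((1 + κ + 1 / κ) * n) := by gcongr
      _ ≤ n * ((1 + κ + 1 / κ) ^ 2 * n) := by gcongr
      _ = _ := by ring

section
variable {α β : ℝ} {p : ℕ → Polynomial ℝ}

lemma IsOrthoSeq.integral_eigenEnergy (hp : IsOrthoSeq α β p) (hα : -1 < α) (hβ : -1 < β)
    (n : ℕ) : ∫ θ, eigenEnergy (jeig α β n) (p n) θ ∂(μJ α β) = 2 * jeig α β n := by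
  have := hp.isFiniteMeasure
  unfold eigenEnergy
  rw [integral_add, integral_const_mul, hp.integral_dcos_sq hα hβ]
  · simp_rw [sq]
    rw [hp.ortho n n]
    simp [jeig]; ring
  · exact integrable_of_continuous (((continuous_eval_cos _).pow 2).const_mul _)
  · exact integrable_of_continuous ((continuous_dcos _).pow 2)

lemma IsOrthoSeq.weighted_energy_le_of_le (hp : IsOrthoSeq α β p) (hα : -1 < α) (hβ : -1 < β)
    {C : ℝ} (hC0 : 0 < C)
    (hC : ∀ θ ∈ Ioc 0 (3 * π / 4), |jlog α β θ| ≤ C / θ ∧ |jlogDeriv α β θ| ≤ C / θ ^ 2)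
    {n : ℕ} (hΛ : 0 < jeig α β n) {a : ℝ} (ha : C / √(jeig α β n) ≤ a) (ha2 : a ≤ π / 2) :
    jweight α β a * eigenEnergy (jeig α β n) (p n) a ≤ 24 * jeig α β n := by
  have := hp.isFiniteMeasure
  have hpi := pi_pos
  have hpi3 := pi_gt_three
  set w := jweight α β
  set E := eigenEnergy (jeig α β n) (p n)
  have hE : Integrable E (μJ α β) := integrable_of_continuous (continuous_eigenEnergy _ _)
  have hI := hp.integral_eigenEnergy hα hβ n
  rw [integral_μJ] at hI
  have hInteg := (integrable_μJ_iff α β E).1 hE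
  have hsub : Ioo (π / 2) (3 * π / 4) ⊆ Ioo 0 π := Ioo_subset_Ioo (by linarith) (by linarith)
  have hE0 : ∀ θ, 0 ≤ E θ := fun θ => by
    simp only [E]; unfold eigenEnergy; positivity
  have h1 : ∫ θ in Ioo (π / 2) (3 * π / 4), w θ * E θ ≤ 2 * jeig α β n := by
    rw [← hI]
    refine setIntegral_mono_set hInteg ?_ hsub.eventuallyLE
    filter_upwards [ae_restrict_mem measurableSet_Ioo] with θ hθ
    exact mul_nonneg (jweight_pos α β hθ).le (hE0 θ)
  have h2 : ∫ _ in Ioo (π / 2) (3 * π / 4), w a * E a ≤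
      ∫ θ in Ioo (π / 2) (3 * π / 4), 3 * exp 1 * (w θ * E θ) := by
    refine setIntegral_mono_on (integrable_const _) ((hInteg.mono_set hsub).const_mul _)
      measurableSet_Ioo fun θ hθ => ?_
    exact weighted_energy_le (by rw [hp.jop_eq hα hβ n]; rfl) hΛ hC0 hC ha
      (ha2.trans hθ.1.le) hθ.2.le
  rw [setIntegral_const, integral_const_mul] at h2
  simp only [measureReal_def, Real.volume_Ioo, smul_eq_mul] at h2
  rw [ENNReal.toReal_ofReal (by linarith), show 3 * π / 4 - π / 2 = π / 4 by ring] at h2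
  have he := exp_one_lt_d9
  have he0 := exp_pos 1
  have h3 : 3 * exp 1 * ∫ θ in Ioo (π / 2) (3 * π / 4), w θ * E θ ≤ 3 * 3 * (2 * jeig α β n) := by
    gcongr
    · exact setIntegral_nonneg measurableSet_Ioo fun θ hθ =>
        mul_nonneg (jweight_pos α β (hsub hθ)).le (hE0 θ)
    · linarith
  have h4 : 0 ≤ w a * E a := mul_nonneg (jweight_pos α β
    ⟨lt_of_lt_of_le (by have := sqrt_pos.2 hΛ; positivity) ha, by linarith⟩).le (hE0 a)
  nlinarith

lemma IsOrthoSeq.exists_energy_bound_large (hp : IsOrthoSeq α β p) (hα : -1 < α) (hβ : -1 < β) :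
    ∃ C R : ℝ, 0 < C ∧ ∀ n : ℕ, 0 < jeig α β n → R ≤ √(jeig α β n) → ∀ θ ∈ Ioc 0 (π / 2),
      eigenEnergy (jeig α β n) (p n) θ ≤
        C * jeig α β n * (θ + 1 / √(jeig α β n)) ^ (-(2 * α + 1)) := by
  have := hp.isFiniteMeasure
  have hpi := pi_pos
  obtain ⟨c, _, hc, _, hw⟩ := exists_jweight_bounds α β
  obtain ⟨A, hA, hlog⟩ := exists_jlog_bounds α β
  obtain ⟨B, hB, hprim⟩ := exists_primitive_jweight_bound (β := β) hα
  set δ := min A (1 / (1 + 2 * B)) with hδ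
  have hδ0 : 0 < δ := lt_min hA (by positivity)
  have hδA : δ ≤ A := min_le_left _ _
  have hδB : B * δ ^ 2 ≤ 1 / 2 := by
    have h1 : δ ≤ 1 / (1 + 2 * B) := min_le_right _ _
    have h3 : (1 + 2 * B) * δ ≤ 1 := by rwa [le_div_iff₀' (by positivity)] at h1
    nlinarith
  set k := 1 + A + 1 / A with hk
  have hA' : 0 < 1 / A := by positivity
  have hk0 : 0 < k := by positivity
  set K := (4 + 2 * B) * (A / δ) ^ (2 * A) with hK
  have hδ1 : 1 ≤ (A / δ) ^ (2 * A) := one_le_rpow (by rwa [le_div_iff₀ hδ0, one_mul])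
    (by positivity)
  have hK1 : 1 ≤ K := by nlinarith
  refine ⟨K * (24 / c) * k ^ |-(2 * α + 1)|, 2 * A / π, by positivity, fun n hΛ hR θ hθ => ?_⟩
  set Λ := jeig α β n
  set ν := √Λ with hν
  have hν0 : 0 < ν := sqrt_pos.2 hΛ
  have hνΛ : ν ^ 2 = Λ := sq_sqrt hΛ.le
  have hq : jop α β (p n) = Polynomial.C (-Λ) * p n := hp.jop_eq hα hβ n
  set E := eigenEnergy Λ (p n)
  have hE0 : ∀ θ, 0 ≤ E θ := fun θ => by
    simp only [E]; unfold eigenEnergy; positivity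
  have hx0 : A / ν ≤ π / 2 := by
    rw [div_le_iff₀ hν0]
    rw [div_le_iff₀ hpi] at hR
    linarith
  have far : ∀ x, A / ν ≤ x → x ≤ π / 2 → E x ≤ 24 / c * Λ * x ^ (-(2 * α + 1)) := fun x h1 h2 => by
    have hxp : 0 < x := lt_of_lt_of_le (by positivity) h1
    have h3 := hp.weighted_energy_le_of_le hα hβ hA hlog hΛ h1 h2
    have h4 := (hw x ⟨hxp, by linarith⟩).1
    rw [rpow_neg hxp.le, ← div_eq_mul_inv, le_div_iff₀ (by positivity), div_mul_eq_mul_div,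
      le_div_iff₀ hc]
    calc E x * x ^ (2 * α + 1) * c = (c * x ^ (2 * α + 1)) * E x := by ring
      _ ≤ jweight α β x * E x := mul_le_mul_of_nonneg_right h4 (hE0 x)
      _ ≤ _ := h3
  have hcomb : ∀ x, A / ν ≤ x → x ≤ π / 2 → x ≤ k * (θ + 1 / ν) → θ + 1 / ν ≤ k * x →
      E θ ≤ K * E x →
      E θ ≤ K * (24 / c) * k ^ |-(2 * α + 1)| * Λ * (θ + 1 / ν) ^ (-(2 * α + 1)) :=
    fun x h1 h2 h3 h4 h5 => by
    have hxp : 0 < x := lt_of_lt_of_le (by positivity) h1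
    have h6 := rpow_le_of_comparable (-(2 * α + 1)) (x := θ + 1 / ν) (y := x)
      (by have := hθ.1; positivity) hxp h3 h4
    calc E θ ≤ K * (24 / c * Λ * x ^ (-(2 * α + 1))) :=
          h5.trans (mul_le_mul_of_nonneg_left (far x h1 h2) (by positivity))
      _ ≤ K * (24 / c * Λ * (k ^ |-(2 * α + 1)| * (θ + 1 / ν) ^ (-(2 * α + 1)))) := by gcongr
      _ = _ := by ring
  have hθ0 := hθ.1
  have hν1 : 0 < 1 / ν := by positivity
  rcases le_or_gt (A / ν) θ with h | h
  · refine hcomb θ h hθ.2 ?_ ?_ ?_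
    · nlinarith
    · have : 1 / ν ≤ 1 / A * θ := by
        calc 1 / ν = 1 / A * (A / ν) := by field_simp
          _ ≤ _ := by gcongr
      nlinarith
    · nlinarith [hE0 θ]
  · refine hcomb (A / ν) le_rfl hx0 ?_ ?_ ?_
    · have : A / ν = A * (1 / ν) := by ring
      nlinarith
    · have h1 : 1 / ν = 1 / A * (A / ν) := by field_simp
      have : 0 < A / ν := by positivity
      nlinarith
    · have hstep : ∀ x, δ / ν ≤ x → x ≤ A / ν → E x ≤ (A / δ) ^ (2 * A) * E (A / ν) :=
        fun x h1 h2 => by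
        have hxp : 0 < x := lt_of_lt_of_le (by positivity) h1
        refine (eigenEnergy_le_rpow_mul hq hΛ.le (fun θ hθ => (hlog θ hθ).1) hxp h2
          (by linarith)).trans ?_
        refine mul_le_mul_of_nonneg_right (rpow_le_rpow (by positivity) ?_ (by positivity)) (hE0 _)
        rw [div_le_iff₀ hxp]
        calc A / ν = A / δ * (δ / ν) := by field_simp
          _ ≤ _ := by gcongr
      rcases le_or_gt (δ / ν) θ with h' | h'
      · refine (hstep θ h' h.le).trans (mul_le_mul_of_nonneg_right ?_ (hE0 _))
        rw [hK]; nlinarith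
      · have hle : δ / ν ≤ A / ν := by gcongr
        have h1 := eigenEnergy_le_near hα hβ hq hΛ hB hprim (η := δ / ν)
          ⟨by positivity, by linarith⟩ (by
            rw [div_pow, hνΛ, ← hνΛ]
            calc _ = B * δ ^ 2 := by field_simp
              _ ≤ _ := hδB) (y := θ) ⟨hθ0, h'.le⟩
        have h2 := hstep (δ / ν) le_rfl hle
        calc E θ ≤ (4 + 2 * B) * E (δ / ν) := h1
          _ ≤ (4 + 2 * B) * ((A / δ) ^ (2 * A) * E (A / ν)) := by gcongr
          _ = _ := by rw [hK]; ring

end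

/-- A regularization of the Jacobi weight at scale `r`. -/
def jscale (α β r θ : ℝ) : ℝ := (θ + r) ^ (2 * α + 1) * (π - θ + r) ^ (2 * β + 1)

lemma jscale_pos (α β : ℝ) {r θ : ℝ} (hr : 0 < r) (hθ : θ ∈ Ioo 0 π) : 0 < jscale α β r θ :=
  mul_pos (rpow_pos_of_pos (by linarith [hθ.1]) _) (rpow_pos_of_pos (by linarith [hθ.2]) _)

lemma jscale_refl (α β r θ : ℝ) : jscale β α r (π - θ) = jscale α β r θ := by
  unfold jscale
  rw [sub_sub_cancel, mul_comm]

section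
variable {α β : ℝ} {p : ℕ → Polynomial ℝ}

lemma IsOrthoSeq.exists_half_bound (hp : IsOrthoSeq α β p) (hα : -1 < α) (hβ : -1 < β) :
    ∃ C : ℝ, 0 < C ∧ ∀ n : ℕ, 1 ≤ n → ∀ θ ∈ Ioc 0 (π / 2),
      eigenEnergy (n ^ 2) (p n) θ ≤ C * n ^ 2 * (θ + 1 / n) ^ (-(2 * α + 1)) := by
  obtain ⟨k, hk1, hk⟩ := exists_jeig_bounds hα hβ
  obtain ⟨C, R, hC, hlarge⟩ := hp.exists_energy_bound_large hα hβ
  have hk0 : 0 < k := by linarith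
  have hsmall : ∀ n : ℕ, ∃ c : ℝ, 1 ≤ n → ∀ θ ∈ Ioc 0 (π / 2),
      eigenEnergy (n ^ 2) (p n) θ ≤ c * (n ^ 2 * (θ + 1 / n) ^ (-(2 * α + 1))) := fun n => by
    rcases Nat.eq_zero_or_pos n with rfl | hn
    · exact ⟨0, by simp⟩
    have hn' : (0 : ℝ) < n := by exact_mod_cast hn
    have hpos : ∀ θ ∈ Icc 0 (π / 2), 0 < θ + 1 / n := fun θ hθ => by
      have := hθ.1; positivity
    obtain ⟨c, hc⟩ := (isCompact_Icc (a := (0 : ℝ)) (b := π / 2)).exists_bound_of_continuousOn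
      (f := fun θ => eigenEnergy (n ^ 2) (p n) θ / (n ^ 2 * (θ + 1 / n) ^ (-(2 * α + 1)))) (by
        refine (continuous_eigenEnergy _ _).continuousOn.div (ContinuousOn.const_mul ?_ _) ?_
        · exact ContinuousOn.rpow_const (by fun_prop) fun θ hθ => Or.inl (hpos θ hθ).ne'
        · intro θ hθ
          have := rpow_pos_of_pos (hpos θ hθ) (-(2 * α + 1))
          positivity)
    refine ⟨c, fun _ θ hθ => ?_⟩
    have h1 := (le_abs_self _).trans (hc θ ⟨hθ.1.le, hθ.2⟩)
    have := rpow_pos_of_pos (hpos θ ⟨hθ.1.le, hθ.2⟩) (-(2 * α + 1))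
    rwa [div_le_iff₀ (by positivity)] at h1
  choose c hc using hsmall
  obtain ⟨N, hN⟩ := exists_nat_ge (R * k)
  set S := ∑ n ∈ Finset.range N, |c n|
  set L := k ^ 2 * C * k ^ 2 * k ^ |-(2 * α + 1)|
  have hL : 0 < L := by positivity
  have hS : 0 ≤ S := Finset.sum_nonneg fun _ _ => abs_nonneg _
  refine ⟨L + S, by linarith, fun n hn θ hθ => ?_⟩
  have hn' : (0 : ℝ) < n := by exact_mod_cast hn
  have hθ0 := hθ.1
  have hpos : 0 < (θ + 1 / n) ^ (-(2 * α + 1)) := rpow_pos_of_pos (by positivity) _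
  rcases lt_or_ge n N with h | h
  · refine (hc n hn θ hθ).trans ?_
    rw [mul_assoc]
    refine mul_le_mul_of_nonneg_right ?_ (by positivity)
    have := Finset.single_le_sum (f := fun n => |c n|) (fun _ _ => abs_nonneg _)
      (Finset.mem_range.2 h)
    linarith [le_abs_self (c n)]
  · obtain ⟨h1, h2⟩ := hk n hn
    have hΛ : 0 < jeig α β n := lt_of_lt_of_le (by positivity) h1
    have hν1 : n / k ≤ √(jeig α β n) := le_sqrt_of_sq_le h1
    have hν2 : √(jeig α β n) ≤ k * n := sqrt_le_iff.2 ⟨by positivity, h2⟩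
    have hν0 := sqrt_pos.2 hΛ
    have hR : R ≤ √(jeig α β n) := by
      refine le_trans ?_ hν1
      rw [le_div_iff₀ hk0]
      exact hN.trans (by exact_mod_cast h)
    have h3 := hlarge n hΛ hR θ hθ
    have h4 : (θ + 1 / √(jeig α β n)) ^ (-(2 * α + 1)) ≤
        k ^ |-(2 * α + 1)| * (θ + 1 / n) ^ (-(2 * α + 1)) := by
      refine rpow_le_of_comparable _ (by positivity) (by positivity) ?_ ?_
      · have : 1 / √(jeig α β n) ≤ k * (1 / n) := by
          rw [div_le_iff₀ hν0]
          calc (1 : ℝ) = k * (1 / n) * (n / k) := by field_simp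
            _ ≤ _ := by gcongr
        nlinarith
      · have : 1 / (n : ℝ) ≤ k * (1 / √(jeig α β n)) := by
          rw [mul_one_div, div_le_div_iff₀ hn' hν0]
          linarith
        nlinarith
    have h5 : eigenEnergy (n ^ 2) (p n) θ ≤ k ^ 2 * eigenEnergy (jeig α β n) (p n) θ := by
      unfold eigenEnergy
      have e1 : (n : ℝ) ^ 2 ≤ k ^ 2 * jeig α β n := by
        rw [div_pow, div_le_iff₀ (by positivity)] at h1; linarith
      have e2 := mul_le_mul_of_nonneg_right e1 (sq_nonneg ((p n).eval (cos θ)))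
      have e3 : 1 ≤ k ^ 2 := by nlinarith
      nlinarith [sq_nonneg (dcos (p n) θ)]
    calc _ ≤ k ^ 2 * (C * jeig α β n * (θ + 1 / √(jeig α β n)) ^ (-(2 * α + 1))) :=
          h5.trans (by gcongr)
      _ ≤ k ^ 2 * (C * (k * n) ^ 2 * (k ^ |-(2 * α + 1)| * (θ + 1 / n) ^ (-(2 * α + 1)))) := by
          gcongr
      _ = L * n ^ 2 * (θ + 1 / n) ^ (-(2 * α + 1)) := by ring
      _ ≤ _ := by gcongr; linarith

lemma exists_jscale_half (α β : ℝ) : ∃ C : ℝ, 0 < C ∧ ∀ r ∈ Ioc (0 : ℝ) 4, ∀ θ ∈ Ioc 0 (π / 2),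
    jscale α β r θ ≤ C * (θ + r) ^ (2 * α + 1) ∧ (θ + r) ^ (2 * α + 1) ≤ C * jscale α β r θ := by
  have hpi := pi_pos
  have hpi3 := pi_gt_three
  have hpi4 := pi_lt_four
  refine ⟨8 ^ |2 * β + 1|, by positivity, fun r hr θ hθ => ?_⟩
  have h1 : 0 < θ + r := by linarith [hθ.1, hr.1]
  have h2 : 0 < π - θ + r := by linarith [hθ.2, hr.1]
  have k1 := rpow_le_of_comparable (2 * β + 1) (x := 1) (y := π - θ + r) (k := 8) one_pos h2
    (by linarith [hθ.1, hr.2]) (by linarith [hθ.2, hr.1])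
  have k2 := rpow_le_of_comparable (2 * β + 1) (x := π - θ + r) (y := 1) (k := 8) h2 one_pos
    (by linarith [hθ.2, hr.1]) (by linarith [hθ.1, hr.2])
  rw [one_rpow] at k1 k2
  unfold jscale
  have hp := rpow_pos_of_pos h1 (2 * α + 1)
  constructor
  · nlinarith
  · nlinarith

lemma IsOrthoSeq.exists_energy_bound (hp : IsOrthoSeq α β p) (hα : -1 < α) (hβ : -1 < β) :
    ∃ C : ℝ, 0 < C ∧ ∀ n : ℕ, 1 ≤ n → ∀ θ ∈ Ioo 0 π,
      eigenEnergy (n ^ 2) (p n) θ ≤ C * n ^ 2 / jscale α β (1 / n) θ := by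
  have main : ∀ (α β : ℝ) (p : ℕ → Polynomial ℝ), IsOrthoSeq α β p → -1 < α → -1 < β →
      ∃ C : ℝ, 0 < C ∧ ∀ n : ℕ, 1 ≤ n → ∀ θ ∈ Ioc 0 (π / 2),
        eigenEnergy (n ^ 2) (p n) θ ≤ C * n ^ 2 / jscale α β (1 / n) θ := by
    intro α β p hp hα hβ
    obtain ⟨C, hC, h⟩ := hp.exists_half_bound hα hβ
    obtain ⟨D, hD, h'⟩ := exists_jscale_half α β
    refine ⟨C * D, by positivity, fun n hn θ hθ => ?_⟩
    have hn' : (1 : ℝ) ≤ n := by exact_mod_cast hn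
    have hr : (1 : ℝ) / n ∈ Ioc (0 : ℝ) 4 :=
      ⟨by positivity, by rw [div_le_iff₀ (by positivity)]; linarith⟩
    have hθ0 := hθ.1
    have hθ' : θ ∈ Ioo 0 π := ⟨hθ.1, by linarith [hθ.2, pi_pos]⟩
    have hj := jscale_pos α β hr.1 hθ'
    refine (h n hn θ hθ).trans ?_
    rw [rpow_neg (by positivity), le_div_iff₀ hj, ← div_eq_mul_inv, div_mul_eq_mul_div,
      div_le_iff₀ (by positivity)]
    calc C * n ^ 2 * jscale α β (1 / n) θ ≤ C * n ^ 2 * (D * (θ + 1 / n) ^ (2 * α + 1)) := by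
          gcongr
          exact (h' _ hr θ hθ).1
      _ = _ := by ring
  obtain ⟨C, hC, h⟩ := main α β p hp hα hβ
  obtain ⟨D, hD, h'⟩ := main β α _ hp.refl hβ hα
  refine ⟨C + D, by positivity, fun n hn θ hθ => ?_⟩
  have hn' : (1 : ℝ) ≤ n := by exact_mod_cast hn
  have hj := jscale_pos α β (r := 1 / n) (by positivity) hθ
  rcases le_total θ (π / 2) with h1 | h1
  · refine (h n hn θ ⟨hθ.1, h1⟩).trans ?_
    gcongr; linarith
  · have := h' n hn (π - θ) ⟨by linarith [hθ.2], by linarith⟩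
    rw [jscale_refl] at this
    have e : eigenEnergy (n ^ 2) (reflSeq p n) (π - θ) = eigenEnergy (n ^ 2) (p n) θ := by
      unfold eigenEnergy
      rw [reflSeq_eval, reflSeq_dcos, neg_sq, mul_pow, mul_pow, ← pow_mul, mul_comm n 2, pow_mul]
      simp
    rw [e] at this
    refine this.trans ?_
    gcongr; linarith

/-- Pointwise bounds for the normalized Jacobi polynomials and their derivatives. -/
lemma IsOrthoSeq.exists_sup_bound (hp : IsOrthoSeq α β p) (hα : -1 < α) (hβ : -1 < β) :
    ∃ C : ℝ, 0 < C ∧ ∀ n : ℕ, 1 ≤ n → ∀ θ ∈ Ioo 0 π,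
      |(p n).eval (cos θ)| ≤ C / √(jscale α β (1 / n) θ) ∧
      |dcos (p n) θ| ≤ C * n / √(jscale α β (1 / n) θ) := by
  obtain ⟨C, hC, h⟩ := hp.exists_energy_bound hα hβ
  refine ⟨√C, sqrt_pos.2 hC, fun n hn θ hθ => ?_⟩
  have hn' : (0 : ℝ) < n := by exact_mod_cast hn
  have h1 := h n hn θ hθ
  have hj := jscale_pos α β (r := 1 / n) (by positivity) hθ
  unfold eigenEnergy at h1
  constructor
  · rw [← sqrt_div hC.le]
    refine abs_le_sqrt ?_
    have h2 : (n : ℝ) ^ 2 * (p n).eval (cos θ) ^ 2 ≤ n ^ 2 * (C / jscale α β (1 / n) θ) := by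
      calc _ ≤ _ := le_of_add_le_of_nonneg_left h1 (sq_nonneg _)
        _ = _ := by ring
    exact le_of_mul_le_mul_left h2 (by positivity)
  · rw [← sqrt_sq hn'.le, ← sqrt_mul hC.le, ← sqrt_div (by positivity)]
    refine abs_le_sqrt ?_
    rw [sqrt_sq hn'.le]
    exact le_of_add_le_of_nonneg_right h1 (by positivity)

lemma inv_jscale_le (α β : ℝ) {n : ℕ} (hn : 1 ≤ n) {θ : ℝ} (hθ : θ ∈ Ioo 0 π) :
    (jscale α β (1 / n) θ)⁻¹ ≤ (5 * n : ℝ) ^ (|2 * α + 1| + |2 * β + 1|) := by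
  have hn' : (1 : ℝ) ≤ n := by exact_mod_cast hn
  have hpi4 := pi_lt_four
  have hr : 0 < 1 / (n : ℝ) := by positivity
  have hr1 : 1 / (n : ℝ) ≤ 1 := by rw [div_le_one (by positivity)]; exact hn'
  have hrn : 1 / (n : ℝ) * n = 1 := by field_simp
  have key : ∀ x ∈ Ioo 0 π, ∀ a : ℝ, ((x + 1 / n) ^ a)⁻¹ ≤ (5 * n : ℝ) ^ |a| := fun x hx a => by
    have h0 : 0 < x + 1 / (n : ℝ) := by linarith [hx.1]
    have := rpow_le_of_comparable (-a) (x := 1) (y := x + 1 / n) (k := 5 * n) one_pos h0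
      (by linarith [hx.2]) (by nlinarith [hx.1])
    rwa [one_rpow, mul_one, abs_neg, rpow_neg h0.le] at this
  unfold jscale
  rw [mul_inv, rpow_add (show (0 : ℝ) < 5 * n by positivity)]
  refine mul_le_mul (key θ hθ _) (key (π - θ) ⟨by linarith [hθ.2], by linarith [hθ.1]⟩ _) ?_
    (by positivity)
  have : 0 < π - θ + 1 / (n : ℝ) := by linarith [hθ.2]
  positivity

lemma IsOrthoSeq.exists_crude_bound (hp : IsOrthoSeq α β p) (hα : -1 < α) (hβ : -1 < β) :
    ∃ C : ℝ, ∃ Q : ℕ, 0 < C ∧ ∀ n : ℕ, ∀ θ ∈ Ioo 0 π,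
      |(p n).eval (cos θ)| ≤ C * (n + 1 : ℝ) ^ Q ∧ |dcos (p n) θ| ≤ C * (n + 1 : ℝ) ^ Q := by
  obtain ⟨C, hC, h⟩ := hp.exists_sup_bound hα hβ
  obtain ⟨D, hD⟩ := (isCompact_Icc (a := (0 : ℝ)) (b := π)).exists_bound_of_continuousOn
    (continuous_eval_cos (p 0)).continuousOn
  obtain ⟨D', hD'⟩ := (isCompact_Icc (a := (0 : ℝ)) (b := π)).exists_bound_of_continuousOn
    (continuous_dcos (p 0)).continuousOn
  set q := |2 * α + 1| + |2 * β + 1| with hq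
  obtain ⟨Q, hQ⟩ := exists_nat_ge q
  have hD0 : 0 ≤ D := (norm_nonneg _).trans (hD 0 ⟨le_rfl, pi_pos.le⟩)
  have hD0' : 0 ≤ D' := (norm_nonneg _).trans (hD' 0 ⟨le_rfl, pi_pos.le⟩)
  refine ⟨C * 5 ^ Q + D + D', Q + 1, by positivity, fun n θ hθ => ?_⟩
  have hθ' : θ ∈ Icc 0 π := Ioo_subset_Icc_self hθ
  have h5 : 0 < C * (5 : ℝ) ^ Q := by positivity
  rcases Nat.eq_zero_or_pos n with rfl | hn
  · have h1 := hD θ hθ'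
    have h2 := hD' θ hθ'
    simp only [Real.norm_eq_abs] at h1 h2
    simp only [CharP.cast_eq_zero, zero_add, one_pow, mul_one]
    exact ⟨by linarith, by linarith⟩
  have hn' : (1 : ℝ) ≤ n := by exact_mod_cast hn
  have hj := jscale_pos α β (r := 1 / n) (by positivity) hθ
  have h1 : 1 / √(jscale α β (1 / n) θ) ≤ (5 * (n : ℝ)) ^ Q := by
    rw [one_div, ← sqrt_inv]
    have h2 := inv_jscale_le α β hn hθ
    have h3 : (5 * n : ℝ) ^ q ≤ (5 * n) ^ Q := by
      rw [← rpow_natCast]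
      exact rpow_le_rpow_of_exponent_le (by linarith) hQ
    refine sqrt_le_iff.2 ⟨by positivity, h2.trans (h3.trans ?_)⟩
    exact le_self_pow₀ (one_le_pow₀ (by linarith)) two_ne_zero
  obtain ⟨a, b⟩ := h n hn θ hθ
  have h2 : C * n / √(jscale α β (1 / n) θ) ≤ (C * 5 ^ Q + D + D') * (n + 1 : ℝ) ^ (Q + 1) := by
    calc _ = C * n * (1 / √(jscale α β (1 / n) θ)) := by ring
      _ ≤ C * n * (5 * (n : ℝ)) ^ Q := by gcongr
      _ = C * 5 ^ Q * (n : ℝ) ^ (Q + 1) := by rw [mul_pow, pow_succ]; ring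
      _ ≤ C * 5 ^ Q * (n + 1 : ℝ) ^ (Q + 1) := by gcongr; linarith
      _ ≤ _ := by gcongr; linarith
  refine ⟨(a.trans ?_).trans h2, b.trans h2⟩
  gcongr
  nlinarith

end

/-- The finite combination `∑ c k • p k`. -/
def polySum (p : ℕ → Polynomial ℝ) (N : ℕ) (c : ℕ → ℝ) : Polynomial ℝ :=
  ∑ k ∈ Finset.range N, Polynomial.C (c k) * p k

lemma polySum_eval (p : ℕ → Polynomial ℝ) (N : ℕ) (c : ℕ → ℝ) (x : ℝ) :
    (polySum p N c).eval x = ∑ k ∈ Finset.range N, c k * (p k).eval x := by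
  simp [polySum, Polynomial.eval_finsetSum]

lemma polySum_dcos (p : ℕ → Polynomial ℝ) (N : ℕ) (c : ℕ → ℝ) (θ : ℝ) :
    dcos (polySum p N c) θ = ∑ k ∈ Finset.range N, c k * dcos (p k) θ := by
  unfold dcos polySum
  rw [Polynomial.derivative_sum, Polynomial.eval_finsetSum, Finset.mul_sum]
  refine Finset.sum_congr rfl fun k _ => ?_
  simp
  ring

lemma jop_add (α β : ℝ) (q r : Polynomial ℝ) : jop α β (q + r) = jop α β q + jop α β r := by
  unfold jop
  simp only [Polynomial.derivative_add]
  ring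

lemma jop_C_mul (α β c : ℝ) (q : Polynomial ℝ) :
    jop α β (Polynomial.C c * q) = Polynomial.C c * jop α β q := by
  unfold jop
  simp only [Polynomial.derivative_C_mul]
  ring

lemma jop_zero (α β : ℝ) : jop α β 0 = 0 := by simp [jop]

lemma IsOrthoSeq.jop_polySum_eval {α β : ℝ} {p : ℕ → Polynomial ℝ} (hp : IsOrthoSeq α β p)
    (hα : -1 < α) (hβ : -1 < β) (N : ℕ) (c : ℕ → ℝ) (x : ℝ) :
    (jop α β (polySum p N c)).eval x =
      ∑ k ∈ Finset.range N, c k * (-jeig α β k * (p k).eval x) := by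
  induction N with
  | zero => simp [polySum, jop_zero]
  | succ N ih =>
    have : polySum p (N + 1) c = polySum p N c + Polynomial.C (c N) * p N := by
      simp [polySum, Finset.sum_range_succ]
    rw [this, jop_add, Polynomial.eval_add, ih, jop_C_mul, hp.jop_eq hα hβ,
      Finset.sum_range_succ, Polynomial.eval_C_mul, Polynomial.eval_C_mul]
    rfl

/-- `sin (s ω) / ω`, extended by `s` at `ω = 0`. -/
def sinOver (ω s : ℝ) : ℝ := if ω = 0 then s else sin (s * ω) / ω

lemma hasDerivAt_sinOver (ω s : ℝ) : HasDerivAt (sinOver ω) (cos (s * ω)) s := by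
  rcases eq_or_ne ω 0 with rfl | h
  · have : sinOver 0 = fun s => s := by funext s; simp [sinOver]
    rw [this]
    simpa using hasDerivAt_id' s
  · have : sinOver ω = fun s => sin (s * ω) / ω := by funext s; simp [sinOver, h]
    rw [this]
    refine ((((hasDerivAt_id' s).mul_const ω).sin).div_const ω).congr_deriv ?_
    field_simp

lemma hasDerivAt_cos_mul (ω s : ℝ) :
    HasDerivAt (fun s => cos (s * ω)) (-ω ^ 2 * sinOver ω s) s := by
  refine (((hasDerivAt_id' s).mul_const ω).cos).congr_deriv ?_
  rcases eq_or_ne ω 0 with rfl | h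
  · simp
  · simp only [sinOver, h, if_false]
    field_simp

lemma continuous_sinOver (ω : ℝ) : Continuous (sinOver ω) :=
  continuous_iff_continuousAt.2 fun s => (hasDerivAt_sinOver ω s).continuousAt

/-- A continuously differentiable cutoff, increasing and vanishing exactly on `(-∞, 0]`. -/
lemma hasDerivAt_sq_max (x : ℝ) : HasDerivAt (fun x : ℝ => max x 0 ^ 2) (2 * max x 0) x := by
  rcases lt_trichotomy x 0 with h | rfl | h
  · have : (fun x : ℝ => max x 0 ^ 2) =ᶠ[𝓝 x] fun _ => 0 := by
      filter_upwards [Iio_mem_nhds h] with y hy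
      rw [max_eq_right (le_of_lt hy)]; simp
    refine ((hasDerivAt_const x (0 : ℝ)).congr_of_eventuallyEq this).congr_deriv ?_
    rw [max_eq_right h.le]; simp
  · rw [hasDerivAt_iff_isLittleO]
    simp only [max_self, ne_eq, OfNat.ofNat_ne_zero, not_false_eq_true, zero_pow, sub_zero,
      mul_zero, smul_zero]
    refine Asymptotics.IsBigO.trans_isLittleO (g := fun x : ℝ => x ^ 2) ?_ ?_
    · refine Asymptotics.IsBigO.of_bound 1 (Eventually.of_forall fun x => ?_)
      simp only [norm_pow, Real.norm_eq_abs, one_mul]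
      refine pow_le_pow_left₀ (abs_nonneg _) ?_ 2
      rw [abs_of_nonneg (le_max_right _ _)]
      exact max_le (le_abs_self _) (abs_nonneg _)
    · have := Asymptotics.isLittleO_pow_id (𝕜 := ℝ) (n := 2) (by norm_num)
      exact this
  · have : (fun x : ℝ => max x 0 ^ 2) =ᶠ[𝓝 x] fun x => x ^ 2 := by
      filter_upwards [Ioi_mem_nhds h] with y hy
      rw [max_eq_left (le_of_lt hy)]
    refine ((hasDerivAt_pow 2 x).congr_of_eventuallyEq this).congr_deriv ?_
    rw [max_eq_left h.le]; simp

/-- Differentiation under the integral sign for jointly continuous derivatives. -/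
lemma hasDerivAt_integral_μJ {α β : ℝ} [IsFiniteMeasure (μJ α β)] {F F' : ℝ → ℝ → ℝ}
    (hF : ∀ s, Continuous (F s)) (hF' : Continuous (Function.uncurry F'))
    (h : ∀ s θ, HasDerivAt (fun s => F s θ) (F' s θ) s) (s : ℝ) :
    HasDerivAt (fun s => ∫ θ, F s θ ∂(μJ α β)) (∫ θ, F' s θ ∂(μJ α β)) s := by
  obtain ⟨C, hC⟩ := ((isCompact_Icc (a := s - 1) (b := s + 1)).prod
    (isCompact_Icc (a := (0 : ℝ)) (b := π))).exists_bound_of_continuousOn hF'.continuousOn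
  refine (hasDerivAt_integral_of_dominated_loc_of_deriv_le (bound := fun _ => C)
    (Icc_mem_nhds (by linarith) (by linarith) : Icc (s - 1) (s + 1) ∈ 𝓝 s)
    (Eventually.of_forall fun s => (hF s).aestronglyMeasurable)
    (integrable_of_continuous (hF s)) ?_ ?_ (integrable_const C)
    (Eventually.of_forall fun θ s _ => h s θ)).2
  · exact (hF'.comp (by fun_prop : Continuous fun θ : ℝ => (s, θ))).aestronglyMeasurable
  · filter_upwards [ae_mem_Ioo α β] with θ hθ s' hs'
    exact hC (s', θ) ⟨hs', Ioo_subset_Icc_self hθ⟩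

section
variable {α β : ℝ} {p : ℕ → Polynomial ℝ}

lemma lam_eq (α β : ℝ) (k : ℕ) : lam α β k = jeig α β k + ((α + β + 1) / 2) ^ 2 := by
  unfold lam jeig; ring

lemma lam_nonneg (α β : ℝ) (k : ℕ) : 0 ≤ lam α β k := sq_nonneg _

/-- Domain-of-influence estimate for finite combinations of the wave equation modes. -/
lemma IsOrthoSeq.wave_energy_le (hp : IsOrthoSeq α β p) (hα : -1 < α) (hβ : -1 < β)
    (N : ℕ) (f : ℕ → ℝ) (b : ℝ) {s : ℝ} (hs : 0 ≤ s) :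
    ∫ θ, max (θ - s - b) 0 ^ 2 *
        (∑ k ∈ Finset.range N, cos (s * √(lam α β k)) * f k * (p k).eval (cos θ)) ^ 2 ∂(μJ α β) ≤
      ∫ θ, max (θ - b) 0 ^ 2 *
        (∑ k ∈ Finset.range N, f k * (p k).eval (cos θ)) ^ 2 ∂(μJ α β) := by
  have := hp.isFiniteMeasure
  set ρ := (α + β + 1) / 2 with hρ
  set ω : ℕ → ℝ := fun k => √(lam α β k) with hω
  have hω2 : ∀ k, ω k ^ 2 = jeig α β k + ρ ^ 2 := fun k => by
    rw [hω]; simp only; rw [sq_sqrt (lam_nonneg α β k), lam_eq]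
  set V : ℝ → ℝ → ℝ := fun s θ =>
    ∑ k ∈ Finset.range N, sinOver (ω k) s * f k * (p k).eval (cos θ) with hV
  set A : ℝ → ℝ → ℝ := fun s θ =>
    ∑ k ∈ Finset.range N, cos (s * ω k) * f k * (p k).eval (cos θ) with hA
  set B : ℝ → ℝ → ℝ := fun s θ =>
    ∑ k ∈ Finset.range N, sinOver (ω k) s * f k * dcos (p k) θ with hB
  set A' : ℝ → ℝ → ℝ := fun s θ =>
    ∑ k ∈ Finset.range N, (-ω k ^ 2 * sinOver (ω k) s) * f k * (p k).eval (cos θ) with hA'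
  set D : ℝ → ℝ → ℝ := fun s θ =>
    ∑ k ∈ Finset.range N, cos (s * ω k) * f k * dcos (p k) θ with hD
  have cS : ∀ k, Continuous (sinOver (ω k)) := fun k => continuous_sinOver _
  have cP : ∀ k, Continuous fun θ => (p k).eval (cos θ) := fun k => continuous_eval_cos _
  have cD : ∀ k, Continuous (dcos (p k)) := fun k => continuous_dcos _
  have jV : Continuous (Function.uncurry V) := by
    refine continuous_finsetSum _ fun k _ => ?_
    have := cS k; have := cP k
    fun_prop
  have jA : Continuous (Function.uncurry A) := by
    refine continuous_finsetSum _ fun k _ => ?_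
    have := cP k
    fun_prop
  have jB : Continuous (Function.uncurry B) := by
    refine continuous_finsetSum _ fun k _ => ?_
    have := cS k; have := cD k
    fun_prop
  have jA' : Continuous (Function.uncurry A') := by
    refine continuous_finsetSum _ fun k _ => ?_
    have := cS k; have := cP k
    fun_prop
  have jD : Continuous (Function.uncurry D) := by
    refine continuous_finsetSum _ fun k _ => ?_
    have := cD k
    fun_prop
  have sect : ∀ {G : ℝ → ℝ → ℝ}, Continuous (Function.uncurry G) → ∀ s, Continuous (G s) :=
    fun hG s => hG.comp (by fun_prop : Continuous fun θ : ℝ => (s, θ))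
  have dV : ∀ s θ, HasDerivAt (fun s => V s θ) (A s θ) s := fun s θ =>
    HasDerivAt.fun_sum fun k _ => ((hasDerivAt_sinOver (ω k) s).mul_const _).mul_const _
  have dA : ∀ s θ, HasDerivAt (fun s => A s θ) (A' s θ) s := fun s θ =>
    HasDerivAt.fun_sum fun k _ => ((hasDerivAt_cos_mul (ω k) s).mul_const _).mul_const _
  have dB : ∀ s θ, HasDerivAt (fun s => B s θ) (D s θ) s := fun s θ =>
    HasDerivAt.fun_sum fun k _ => ((hasDerivAt_sinOver (ω k) s).mul_const _).mul_const _
  have dAθ : ∀ s θ, HasDerivAt (fun θ => A s θ) (D s θ) θ := fun s θ =>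
    HasDerivAt.fun_sum fun k _ => (hasDerivAt_eval_cos (p k) θ).const_mul _
  set ψ : ℝ → ℝ := fun x => max (x - b) 0 ^ 2 with hψ
  set ψ' : ℝ → ℝ := fun x => 2 * max (x - b) 0 with hψ'
  have dψ : ∀ x, HasDerivAt ψ (ψ' x) x := fun x => by
    exact (hasDerivAt_sq_max (x - b)).comp_sub_const x b
  have cψ : Continuous ψ := by fun_prop
  have cψ' : Continuous ψ' := by fun_prop
  have ψ0 : ∀ x, 0 ≤ ψ x := fun x => sq_nonneg _
  have ψ'0 : ∀ x, 0 ≤ ψ' x := fun x => by positivity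
  set e : ℝ → ℝ → ℝ := fun s θ => ψ (θ - s) * (A s θ ^ 2 + B s θ ^ 2 + ρ ^ 2 * V s θ ^ 2) with he
  set e' : ℝ → ℝ → ℝ := fun s θ =>
    -ψ' (θ - s) * (A s θ ^ 2 + B s θ ^ 2 + ρ ^ 2 * V s θ ^ 2) +
      ψ (θ - s) * (2 * A s θ * A' s θ + 2 * B s θ * D s θ + ρ ^ 2 * (2 * V s θ * A s θ)) with he'
  have je : Continuous (Function.uncurry e) := by
    simp only [he, Function.uncurry_def] at jV jA jB ⊢
    fun_prop
  have je' : Continuous (Function.uncurry e') := by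
    simp only [he', Function.uncurry_def] at jV jA jB jA' jD ⊢
    fun_prop
  have de : ∀ s θ, HasDerivAt (fun s => e s θ) (e' s θ) s := fun s θ => by
    have h1 : HasDerivAt (fun s => ψ (θ - s)) (-ψ' (θ - s)) s := by
      exact (dψ (θ - s)).comp_const_sub θ s
    refine (h1.mul ((((dA s θ).pow 2).add ((dB s θ).pow 2)).add
      (((dV s θ).pow 2).const_mul (ρ ^ 2)))).congr_deriv ?_
    simp only [he', Pi.add_apply, Pi.pow_apply]
    push_cast
    ring
  have dE := hasDerivAt_integral_μJ (α := α) (β := β) (sect je) je' de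
  have hneg : ∀ s, ∫ θ, e' s θ ∂(μJ α β) ≤ 0 := fun s => by
    set q := polySum p N fun k => sinOver (ω k) s * f k with hq
    have q0 : ∀ θ, q.eval (cos θ) = V s θ := fun θ => polySum_eval _ _ _ _
    have q1 : ∀ θ, dcos q θ = B s θ := fun θ => polySum_dcos _ _ _ _
    have q2 : ∀ θ, (jop α β q).eval (cos θ) = A' s θ + ρ ^ 2 * V s θ := fun θ => by
      rw [hq, hp.jop_polySum_eval hα hβ, hA', hV]
      simp only
      rw [Finset.mul_sum, ← Finset.sum_add_distrib]
      refine Finset.sum_congr rfl fun k _ => ?_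
      rw [hω2]; ring
    have h1 := integral_mul_jop hα hβ (g := fun θ => ψ (θ - s) * A s θ)
      (g' := fun θ => ψ' (θ - s) * A s θ + ψ (θ - s) * D s θ) (fun θ => by
        have h1 : HasDerivAt (fun θ => ψ (θ - s)) (ψ' (θ - s)) θ := by
          exact (dψ (θ - s)).comp_sub_const θ s
        exact h1.mul (dAθ s θ)) (by
        have := sect jA s; have := sect jD s
        fun_prop) q
    simp_rw [q1, q2] at h1
    have cA := sect jA s
    have cA' := sect jA' s
    have cB := sect jB s
    have cV := sect jV s
    have cD := sect jD s
    have h2 : ∫ θ, e' s θ ∂(μJ α β) = -∫ θ, ψ' (θ - s) *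
        ((A s θ + B s θ) ^ 2 + ρ ^ 2 * V s θ ^ 2) ∂(μJ α β) := by
      have h3 : ∫ θ, e' s θ ∂(μJ α β) = (∫ θ, -(ψ' (θ - s) *
          ((A s θ + B s θ) ^ 2 + ρ ^ 2 * V s θ ^ 2)) ∂(μJ α β)) +
          2 * ((∫ θ, ψ (θ - s) * A s θ * (A' s θ + ρ ^ 2 * V s θ) ∂(μJ α β)) +
          ∫ θ, (ψ' (θ - s) * A s θ + ψ (θ - s) * D s θ) * B s θ ∂(μJ α β)) := by
        rw [← integral_add (integrable_of_continuous (by fun_prop))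
          (integrable_of_continuous (by fun_prop)), ← integral_const_mul,
          ← integral_add (integrable_of_continuous (by fun_prop))
          (integrable_of_continuous (by fun_prop))]
        refine integral_congr_ae (Eventually.of_forall fun θ => ?_)
        simp only [he']
        ring
      rw [h3, h1, integral_neg]
      ring
    rw [h2, neg_nonpos]
    exact integral_nonneg fun θ => mul_nonneg (ψ'0 _) (by positivity)
  have hanti : Antitone fun s => ∫ θ, e s θ ∂(μJ α β) := by
    refine antitone_of_deriv_nonpos (fun s => (dE s).differentiableAt) fun s => ?_
    rw [(dE s).deriv]
    exact hneg s
  have hfin := hanti hs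
  simp only at hfin
  have hV0 : ∀ θ, V 0 θ = 0 := fun θ =>
    Finset.sum_eq_zero fun k _ => by simp [sinOver]
  have hB0 : ∀ θ, B 0 θ = 0 := fun θ =>
    Finset.sum_eq_zero fun k _ => by simp [sinOver]
  have hA0 : ∀ θ, A 0 θ = ∑ k ∈ Finset.range N, f k * (p k).eval (cos θ) := fun θ =>
    Finset.sum_congr rfl fun k _ => by simp
  calc _ ≤ ∫ θ, e s θ ∂(μJ α β) := by
        refine integral_mono (integrable_of_continuous ?_) (integrable_of_continuous (sect je s)) ?_
        · have := sect jA s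
          exact ((by fun_prop : Continuous fun θ : ℝ => max (θ - s - b) 0 ^ 2)).mul (this.pow 2)
        · intro θ
          simp only [he]
          refine mul_le_mul_of_nonneg_left ?_ (ψ0 _)
          have := sq_nonneg (B s θ)
          have : 0 ≤ ρ ^ 2 * V s θ ^ 2 := by positivity
          change A s θ ^ 2 ≤ _
          linarith
    _ ≤ ∫ θ, e 0 θ ∂(μJ α β) := hfin
    _ = _ := by
        refine integral_congr_ae (Eventually.of_forall fun θ => ?_)
        simp only [he, hV0, hB0, hA0, hψ]
        simp

end

section
variable {α β : ℝ} {p : ℕ → Polynomial ℝ}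

lemma IsOrthoSeq.abs_fcoef_le (hp : IsOrthoSeq α β p) {f : ℝ → ℝ} (hf : Continuous f) {M : ℝ}
    (hM : ∀ θ ∈ Ioo 0 π, |f θ| ≤ M) (k : ℕ) :
    |fcoef α β p f k| ≤ M * ((μJ α β).real univ + 1) := by
  have := hp.isFiniteMeasure
  have hP := continuous_eval_cos (p k)
  have hM0 : 0 ≤ M := (abs_nonneg _).trans (hM (π / 2) ⟨by positivity, by linarith [pi_pos]⟩)
  have hk := hp.ortho k k
  simp only [if_true] at hk
  have h1 : ∫ θ, M * (1 + (p k).eval (cos θ) * (p k).eval (cos θ)) ∂(μJ α β) =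
      M * ((μJ α β).real univ + 1) := by
    rw [integral_const_mul, integral_add (integrable_const _)
      (integrable_of_continuous (by fun_prop)), hk, integral_const]
    simp
  rw [← h1]
  unfold fcoef
  refine (abs_integral_le_integral_abs).trans (integral_mono_ae
    (integrable_of_continuous (by fun_prop)) (integrable_of_continuous (by fun_prop)) ?_)
  filter_upwards [ae_mem_Ioo α β] with θ hθ
  rw [abs_mul]
  refine mul_le_mul (hM θ hθ) ?_ (abs_nonneg _) hM0
  rw [← abs_mul_abs_self ((p k).eval (cos θ))]
  nlinarith [sq_nonneg (|(p k).eval (cos θ)| - 1)]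

lemma IsOrthoSeq.wave_pairing_le (hp : IsOrthoSeq α β p) (hα : -1 < α) (hβ : -1 < β)
    {f g : ℝ → ℝ} (hg : Continuous g) {b c s η ε : ℝ} (hb : 0 ≤ b)
    (hη : 0 < η) (hε : 0 < ε) (hc : b + |s| + η ≤ c) (hfb : ∀ θ, b ≤ θ → f θ = 0)
    (hgc : ∀ θ, θ ≤ c → g θ = 0) {q : Polynomial ℝ}
    (hq : ∀ θ ∈ Ioo 0 π, |q.eval (cos θ) - f θ| ≤ ε) {N : ℕ} (hN : q.degree < N) :
    |∑ k ∈ Finset.range N, cos (s * √(lam α β k)) *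
        fcoef α β p (fun θ => q.eval (cos θ)) k * fcoef α β p g k| ≤
      ε * ((2 * η ^ 2)⁻¹ * (π ^ 2 * (μJ α β).real univ) + (∫ θ, g θ ^ 2 ∂(μJ α β)) / 2) := by
  have := hp.isFiniteMeasure
  wlog hs : 0 ≤ s generalizing s
  · have := this (s := -s) (by rwa [abs_neg]) (by linarith)
    simpa only [neg_mul, cos_neg] using this
  rw [abs_of_nonneg hs] at hc
  have cP : ∀ k, Continuous fun θ => (p k).eval (cos θ) := fun k => continuous_eval_cos _
  set a := fcoef α β p (fun θ => q.eval (cos θ)) with ha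
  set A : ℝ → ℝ := fun θ => ∑ k ∈ Finset.range N, cos (s * √(lam α β k)) * a k *
    (p k).eval (cos θ) with hA
  have cA : Continuous A := continuous_finsetSum _ fun k _ => by fun_prop
  have h1 : ∑ k ∈ Finset.range N, cos (s * √(lam α β k)) * a k * fcoef α β p g k =
      ∫ θ, A θ * g θ ∂(μJ α β) := by
    simp only [hA, Finset.sum_mul]
    rw [integral_finsetSum _ fun k _ => integrable_of_continuous (by fun_prop)]
    refine Finset.sum_congr rfl fun k _ => ?_
    rw [fcoef, ← integral_const_mul]
    refine integral_congr_ae (Eventually.of_forall fun θ => ?_)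
    simp only; ring
  have hqe : ∀ θ, q.eval (cos θ) = ∑ k ∈ Finset.range N, a k * (p k).eval (cos θ) := fun θ => by
    conv_lhs => rw [hp.expansion hN]
    simp [Polynomial.eval_finsetSum, ha]
  have hw := hp.wave_energy_le hα hβ N a b hs
  simp_rw [← hqe] at hw
  have cq := continuous_eval_cos q
  have h2 : ∫ θ, max (θ - b) 0 ^ 2 * q.eval (cos θ) ^ 2 ∂(μJ α β) ≤
      π ^ 2 * ε ^ 2 * (μJ α β).real univ := by
    have : ∫ _, π ^ 2 * ε ^ 2 ∂(μJ α β) = π ^ 2 * ε ^ 2 * (μJ α β).real univ := by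
      rw [integral_const, smul_eq_mul, mul_comm]
    rw [← this]
    refine integral_mono_ae (integrable_of_continuous (by fun_prop)) (integrable_const _) ?_
    filter_upwards [ae_mem_Ioo α β] with θ hθ
    rcases le_total θ b with h | h
    · rw [max_eq_right (by linarith)]; simp; positivity
    · have := hq θ hθ
      rw [hfb θ h, sub_zero] at this
      refine mul_le_mul ?_ ?_ (sq_nonneg _) (sq_nonneg _)
      · rw [max_eq_left (by linarith)]
        exact pow_le_pow_left₀ (by linarith) (by linarith [hθ.2]) 2
      · rw [← sq_abs]; exact pow_le_pow_left₀ (abs_nonneg _) this 2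
  rw [h1]
  have cm : Continuous fun θ : ℝ => max (θ - s - b) 0 ^ 2 * A θ ^ 2 := by fun_prop
  calc |∫ θ, A θ * g θ ∂(μJ α β)| ≤ ∫ θ, |A θ * g θ| ∂(μJ α β) := abs_integral_le_integral_abs
    _ ≤ ∫ θ, ((2 * η ^ 2 * ε)⁻¹ * (max (θ - s - b) 0 ^ 2 * A θ ^ 2) + ε / 2 * g θ ^ 2)
          ∂(μJ α β) := by
        refine integral_mono (integrable_of_continuous (by fun_prop))
          (integrable_of_continuous (by fun_prop)) fun θ => ?_
        simp only
        rcases le_total θ c with h | h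
        · rw [hgc θ h]; simp; positivity
        · have h3 : η ^ 2 ≤ max (θ - s - b) 0 ^ 2 := by
            rw [max_eq_left (by linarith)]
            exact pow_le_pow_left₀ hη.le (by linarith) 2
          have h4 : (2 * ε)⁻¹ * A θ ^ 2 ≤
              (2 * η ^ 2 * ε)⁻¹ * (max (θ - s - b) 0 ^ 2 * A θ ^ 2) := by
            calc _ = (2 * η ^ 2 * ε)⁻¹ * (η ^ 2 * A θ ^ 2) := by field_simp
              _ ≤ _ := by gcongr
          refine le_trans ?_ (add_le_add_left h4 _)
          have h5 : (2 * ε)⁻¹ * A θ ^ 2 + ε / 2 * g θ ^ 2 - |A θ * g θ| =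
              (2 * ε)⁻¹ * (|A θ| - ε * |g θ|) ^ 2 := by
            rw [abs_mul, ← sq_abs (A θ), ← sq_abs (g θ)]; field_simp; ring
          have : 0 ≤ (2 * ε)⁻¹ * (|A θ| - ε * |g θ|) ^ 2 := by positivity
          linarith
    _ = (2 * η ^ 2 * ε)⁻¹ * (∫ θ, max (θ - s - b) 0 ^ 2 * A θ ^ 2 ∂(μJ α β)) +
          ε / 2 * ∫ θ, g θ ^ 2 ∂(μJ α β) := by
        rw [integral_add (integrable_of_continuous (by fun_prop))
          (integrable_of_continuous (by fun_prop)), integral_const_mul, integral_const_mul]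
    _ ≤ (2 * η ^ 2 * ε)⁻¹ * (π ^ 2 * ε ^ 2 * (μJ α β).real univ) +
          ε / 2 * ∫ θ, g θ ^ 2 ∂(μJ α β) := by
        gcongr
        exact hw.trans h2
    _ = _ := by field_simp

/-- A cosine transform of a kernel supported in `[-s₀, s₀]`, evaluated at the frequencies, gives an
operator whose bilinear form vanishes on functions supported at distance more than `s₀`. -/
lemma IsOrthoSeq.tsum_fcoef_mul_eq_zero (hp : IsOrthoSeq α β p) (hα : -1 < α) (hβ : -1 < β)
    {ker : ℝ → ℝ} (hker : Integrable ker) {s₀ : ℝ} (hsupp : ∀ τ, s₀ < |τ| → ker τ = 0)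
    {G : ℕ → ℝ} (hG : ∀ k, G k = ∫ τ, ker τ * cos (τ * √(lam α β k)))
    (hsum : Summable fun k => |G k|)
    {f g : ℝ → ℝ} (hf : Continuous f) (hg : Continuous g) {Mg : ℝ}
    (hMg : ∀ θ ∈ Ioo 0 π, |g θ| ≤ Mg) {b c : ℝ} (hb : 0 ≤ b) (hbc : b + s₀ < c)
    (hfb : ∀ θ, b ≤ θ → f θ = 0) (hgc : ∀ θ, θ ≤ c → g θ = 0) :
    ∑' k, G k * fcoef α β p f k * fcoef α β p g k = 0 := by
  have := hp.isFiniteMeasure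
  set m := (μJ α β).real univ with hm
  have hm0 : 0 ≤ m := measureReal_nonneg
  set η := c - b - s₀ with hη
  have hη0 : 0 < η := by linarith
  set M := (2 * η ^ 2)⁻¹ * (π ^ 2 * m) + (∫ θ, g θ ^ 2 ∂(μJ α β)) / 2 with hMdef
  have hM0 : 0 ≤ M := add_nonneg (by positivity)
    (div_nonneg (integral_nonneg fun _ => sq_nonneg _) (by norm_num))
  have hMg0 : 0 ≤ Mg := (abs_nonneg _).trans (hMg (π / 2) ⟨by positivity, by linarith [pi_pos]⟩)
  have hgk := hp.abs_fcoef_le hg hMg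
  obtain ⟨Mf, hMf⟩ := (isCompact_Icc (a := (0 : ℝ)) (b := π)).exists_bound_of_continuousOn
    hf.continuousOn
  have hsumm : ∀ u : ℕ → ℝ, ∀ D, (∀ k, |u k| ≤ D) →
      Summable fun k => G k * u k * fcoef α β p g k := fun u D hu => by
    refine Summable.of_norm_bounded (hsum.mul_right (D * (Mg * (m + 1)))) fun k => ?_
    rw [norm_eq_abs, abs_mul, abs_mul, mul_assoc]
    exact mul_le_mul_of_nonneg_left (mul_le_mul (hu k) (hgk k) (abs_nonneg _)
      ((abs_nonneg _).trans (hu k))) (abs_nonneg _)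
  set K := (∫ τ, |ker τ|) * M + (∑' k, |G k|) * ((m + 1) * (Mg * (m + 1))) with hK
  have key : ∀ ε > 0, |∑' k, G k * fcoef α β p f k * fcoef α β p g k| ≤ ε * K := by
    intro ε hε
    obtain ⟨q, hq⟩ := exists_polynomial_near_of_continuousOn (-1) 1 (fun x => f (arccos x))
      (hf.comp continuous_arccos).continuousOn ε hε
    have hq' : ∀ θ ∈ Ioo 0 π, |q.eval (cos θ) - f θ| ≤ ε := fun θ hθ => by
      have := hq (cos θ) ⟨neg_one_le_cos _, cos_le_one _⟩
      simp only [arccos_cos hθ.1.le hθ.2.le] at this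
      exact this.le
    have cq := continuous_eval_cos q
    set N := q.natDegree + 1 with hN
    have hqN : q.degree < N := lt_of_le_of_lt Polynomial.degree_le_natDegree
      (by exact_mod_cast Nat.lt_succ_self _)
    set a := fcoef α β p (fun θ => q.eval (cos θ)) with ha
    have hdiff : ∀ k, |fcoef α β p f k - a k| ≤ ε * (m + 1) := fun k => by
      have h := hp.abs_fcoef_le (f := fun θ => f θ - q.eval (cos θ)) (hf.sub cq) (M := ε)
        (fun θ hθ => by rw [abs_sub_comm]; exact hq' θ hθ) k
      convert h using 2
      rw [ha, fcoef, fcoef, fcoef, ← integral_sub]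
      · simp only [sub_mul]
      · exact integrable_of_continuous (hf.mul (continuous_eval_cos _))
      · exact integrable_of_continuous (cq.mul (continuous_eval_cos _))
    have hfk := hp.abs_fcoef_le hf (M := Mf) (fun θ hθ => hMf θ ⟨hθ.1.le, hθ.2.le⟩)
    have s1 := hsumm (fun k => fcoef α β p f k - a k) _ hdiff
    have hak : ∀ k, N ≤ k → a k = 0 := fun k hk =>
      hp.fcoef_eq_zero (hqN.trans_le (by exact_mod_cast hk))
    have s2 : Summable fun k => G k * a k * fcoef α β p g k :=
      summable_of_ne_finset_zero (s := Finset.range N) fun k hk => by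
        rw [hak k (by simpa using hk)]; ring
    have hsplit : ∑' k, G k * fcoef α β p f k * fcoef α β p g k =
        (∑' k, G k * (fcoef α β p f k - a k) * fcoef α β p g k) +
        ∑' k, G k * a k * fcoef α β p g k := by
      rw [← s1.tsum_add s2]
      exact tsum_congr fun k => by ring
    have hb1 : |∑' k, G k * (fcoef α β p f k - a k) * fcoef α β p g k| ≤
        ε * ((∑' k, |G k|) * ((m + 1) * (Mg * (m + 1)))) := by
      have h := tsum_of_norm_bounded (f := fun k => G k * (fcoef α β p f k - a k) *
        fcoef α β p g k) (hsum.mul_right (ε * (m + 1) * (Mg * (m + 1)))).hasSum (fun k => by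
          rw [norm_eq_abs, abs_mul, abs_mul, mul_assoc]
          exact mul_le_mul_of_nonneg_left (mul_le_mul (hdiff k) (hgk k) (abs_nonneg _)
            (by positivity)) (abs_nonneg _))
      rw [tsum_mul_right] at h
      refine h.trans (le_of_eq (by ring))
    have hb2 : |∑' k, G k * a k * fcoef α β p g k| ≤ ε * ((∫ τ, |ker τ|) * M) := by
      rw [tsum_eq_sum (s := Finset.range N) fun k hk => by
        rw [hak k (by simpa using hk)]; ring]
      have hInteg : ∀ k, Integrable fun τ => ker τ * cos (τ * √(lam α β k)) := fun k =>
        hker.mul_bdd (c := 1) (by fun_prop)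
          (Eventually.of_forall fun τ => by simpa using abs_cos_le_one _)
      have : ∑ k ∈ Finset.range N, G k * a k * fcoef α β p g k =
          ∫ τ, ker τ * ∑ k ∈ Finset.range N, cos (τ * √(lam α β k)) * a k *
            fcoef α β p g k := by
        simp only [Finset.mul_sum]
        rw [integral_finsetSum]
        · refine Finset.sum_congr rfl fun k _ => ?_
          rw [hG, mul_assoc, ← integral_mul_const]
          exact integral_congr_ae (Eventually.of_forall fun τ => by simp only; ring)
        · intro k _
          refine ((hInteg k).mul_const (a k * fcoef α β p g k)).congr
            (Eventually.of_forall fun τ => by simp only; ring)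
      rw [this, ← integral_mul_const, ← integral_const_mul]
      refine (abs_integral_le_integral_abs).trans (integral_mono_of_nonneg
        (Eventually.of_forall fun _ => abs_nonneg _)
        ((hker.abs.mul_const _).const_mul _) (Eventually.of_forall fun τ => ?_))
      simp only
      rw [abs_mul]
      rcases le_or_gt |τ| s₀ with h | h
      · have := hp.wave_pairing_le hα hβ hg (s := τ) hb hη0 hε (by linarith) hfb hgc hq' hqN
        calc _ ≤ |ker τ| * (ε * M) := mul_le_mul_of_nonneg_left this (abs_nonneg _)
          _ = _ := by ring
      · rw [hsupp τ h]; simp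
    rw [hsplit, hK, mul_add]
    exact (abs_add_le _ _).trans (by linarith)
  have hK0 : 0 ≤ K := by
    have := key 1 one_pos
    rw [one_mul] at this
    exact (abs_nonneg _).trans this
  refine abs_eq_zero.mp (le_antisymm (le_of_forall_pos_le_add fun δ hδ => ?_) (abs_nonneg _))
  refine (key (δ / (K + 1)) (by positivity)).trans ?_
  rw [zero_add, div_mul_eq_mul_div, div_le_iff₀ (by positivity)]
  nlinarith

end

section
variable {α β : ℝ} {p : ℕ → Polynomial ℝ}

lemma continuousOn_jweight (α β : ℝ) : ContinuousOn (jweight α β) (Ioo 0 π) := fun _ hθ =>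
  (hasDerivAt_jweight α β hθ).continuousAt.continuousWithinAt

lemma IsOrthoSeq.series_eq_zero (hp : IsOrthoSeq α β p) {B c : ℕ → ℝ}
    (hB : ∀ n, ∀ θ ∈ Ioo 0 π, |(p n).eval (cos θ)| ≤ B n) (hc : Summable fun n => |c n| * B n)
    {U : Set ℝ} (hU : IsOpen U) (hU' : U ⊆ Ioo 0 π)
    (h : ∀ g : ℝ → ℝ, ContDiff ℝ (⊤ : ℕ∞) g → HasCompactSupport g → tsupport g ⊆ U →
      ∑' n, c n * fcoef α β p g n = 0) {θ : ℝ} (hθ : θ ∈ U) :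
    ∑' n, c n * (p n).eval (cos θ) = 0 := by
  have := hp.isFiniteMeasure
  set H : ℝ → ℝ := fun θ => ∑' n, c n * (p n).eval (cos θ) with hH
  have hbd : ∀ n, ∀ θ ∈ Ioo 0 π, ‖c n * (p n).eval (cos θ)‖ ≤ |c n| * B n := fun n θ hθ => by
    rw [norm_eq_abs, abs_mul]
    exact mul_le_mul_of_nonneg_left (hB n θ hθ) (abs_nonneg _)
  have cH : ContinuousOn H (Ioo 0 π) :=
    continuousOn_tsum (fun n => ((continuous_eval_cos (p n)).const_mul (c n)).continuousOn) hc hbd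
  have cwH : ContinuousOn (fun θ => jweight α β θ * H θ) U :=
    ((continuousOn_jweight α β).mul cH).mono hU'
  have hae := hU.ae_eq_zero_of_integral_contDiff_smul_eq_zero
    (cwH.locallyIntegrableOn hU.measurableSet) (μ := volume) (fun g hg hgc hgU => by
      obtain ⟨Mg, hMg⟩ := hg.continuous.bounded_above_of_compact_support hgc
      have h0 : ∫ θ, g θ • (jweight α β θ * H θ) = ∫ θ, H θ * g θ ∂(μJ α β) := by
        rw [integral_μJ, ← setIntegral_eq_integral_of_forall_compl_eq_zero (s := Ioo 0 π)]
        · refine setIntegral_congr_fun measurableSet_Ioo fun θ _ => ?_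
          simp only [smul_eq_mul]; ring
        · intro θ hθ
          have : g θ = 0 := image_eq_zero_of_notMem_tsupport fun hh => hθ (hU' (hgU hh))
          rw [this, zero_smul]
      have hgcont := hg.continuous
      have hPc := fun n => continuous_eval_cos (p n)
      have hInteg : ∀ n, Integrable (fun θ => c n * ((p n).eval (cos θ)) * g θ) (μJ α β) := fun n =>
        integrable_of_continuous (((hPc n).const_mul _).mul hgcont)
      have hs := hasSum_integral_of_summable_integral_norm hInteg (by
        refine Summable.of_nonneg_of_le (fun n => integral_nonneg fun _ => norm_nonneg _)
          (fun n => ?_) (hc.mul_right (Mg * (μJ α β).real univ))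
        have : ∫ _, |c n| * B n * Mg ∂(μJ α β) = |c n| * B n * (Mg * (μJ α β).real univ) := by
          rw [integral_const, smul_eq_mul]; ring
        rw [← this]
        refine integral_mono_ae (hInteg n).norm (integrable_const _) ?_
        filter_upwards [ae_mem_Ioo α β] with θ hθ
        rw [norm_mul]
        exact mul_le_mul (hbd n θ hθ) (hMg θ) (norm_nonneg _)
          ((norm_nonneg _).trans (hbd n θ hθ)))
      rw [h0]
      have h2 : ∫ θ, H θ * g θ ∂(μJ α β) =
          ∫ θ, ∑' n, c n * (p n).eval (cos θ) * g θ ∂(μJ α β) := by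
        simp only [hH, tsum_mul_right]
      rw [h2, ← hs.tsum_eq, ← h g hg hgc hgU]
      refine tsum_congr fun n => ?_
      rw [fcoef, ← integral_const_mul]
      exact integral_congr_ae (Eventually.of_forall fun θ => by simp only; ring))
  have h3 := Measure.eqOn_open_of_ae_eq (μ := volume) (g := fun _ => (0 : ℝ))
    ((ae_restrict_iff' hU.measurableSet).mpr hae) hU cwH continuousOn_const hθ
  simp only [mul_eq_zero] at h3
  exact h3.resolve_left (jweight_pos α β (hU' hθ)).ne'

/-- Finite propagation speed at the level of kernels. -/
lemma IsOrthoSeq.kernel_eq_zero (hp : IsOrthoSeq α β p) (hα : -1 < α) (hβ : -1 < β)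
    {ker : ℝ → ℝ} (hker : Integrable ker) {s₀ : ℝ} (hs₀ : 0 ≤ s₀)
    (hsupp : ∀ τ, s₀ < |τ| → ker τ = 0)
    {G : ℕ → ℝ} (hG : ∀ k, G k = ∫ τ, ker τ * cos (τ * √(lam α β k)))
    {B : ℕ → ℝ} (hB1 : ∀ n, 1 ≤ B n) (hB : ∀ n, ∀ θ ∈ Ioo 0 π, |(p n).eval (cos θ)| ≤ B n)
    (hsum : Summable fun k => |G k| * B k ^ 2) {θ φ : ℝ} (hθ : θ ∈ Ioo 0 π) (hφ : φ ∈ Ioo 0 π)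
    (hd : s₀ < |θ - φ|) :
    ∑' n, G n * (p n).eval (cos θ) * (p n).eval (cos φ) = 0 := by
  wlog hlt : θ < φ generalizing θ φ
  · have := this hφ hθ (by rwa [abs_sub_comm]) (by
      rcases lt_trichotomy θ φ with h | h | h
      · exact absurd h hlt
      · rw [h, sub_self, abs_zero] at hd; linarith
      · exact h)
    rw [← this]
    exact tsum_congr fun n => by ring
  rw [abs_of_neg (by linarith)] at hd
  have hsum0 : Summable fun k => |G k| := by
    refine Summable.of_nonneg_of_le (fun _ => abs_nonneg _) (fun k => ?_) hsum
    exact le_mul_of_one_le_right (abs_nonneg _) (one_le_pow₀ (hB1 k))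
  have hsum1 : Summable fun k => |G k| * B k := by
    refine Summable.of_nonneg_of_le (fun k => mul_nonneg (abs_nonneg _) (by linarith [hB1 k]))
      (fun k => ?_) hsum
    exact mul_le_mul_of_nonneg_left (le_self_pow₀ (hB1 k) two_ne_zero) (abs_nonneg _)
  have := hp.isFiniteMeasure
  set δ := (φ - θ - s₀) / 3 with hδ
  have hδ0 : 0 < δ := by linarith
  have h1 : ∀ f : ℝ → ℝ, ContDiff ℝ (⊤ : ℕ∞) f → HasCompactSupport f → tsupport f ⊆ Ioo 0 (θ + δ) →
      ∑' n, G n * (p n).eval (cos φ) * fcoef α β p f n = 0 := by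
    intro f hf hfc hfs
    obtain ⟨Mf, hMf⟩ := hf.continuous.bounded_above_of_compact_support hfc
    have hfk := hp.abs_fcoef_le hf.continuous (M := Mf) fun θ _ => hMf θ
    have := hp.series_eq_zero (c := fun n => G n * fcoef α β p f n) hB (by
        refine Summable.of_nonneg_of_le (fun k => mul_nonneg (abs_nonneg _) (by linarith [hB1 k]))
          (fun k => ?_) (hsum1.mul_right (Mf * ((μJ α β).real univ + 1)))
        rw [abs_mul]
        have := mul_le_mul_of_nonneg_left (hfk k)
          (mul_nonneg (abs_nonneg (G k)) (by linarith [hB1 k] : 0 ≤ B k))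
        linarith) (U := Ioo (φ - δ) π) isOpen_Ioo
        (fun x hx => ⟨by linarith [hx.1, hθ.1], hx.2⟩) (fun g hg hgc hgs => by
        obtain ⟨Mg, hMg⟩ := hg.continuous.bounded_above_of_compact_support hgc
        refine hp.tsum_fcoef_mul_eq_zero hα hβ hker hsupp hG hsum0 hf.continuous hg.continuous
          (fun θ _ => hMg θ) (b := θ + δ) (c := φ - δ) (by linarith [hθ.1]) (by linarith)
          (fun x hx => image_eq_zero_of_notMem_tsupport fun hh => ?_)
          (fun x hx => image_eq_zero_of_notMem_tsupport fun hh => ?_)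
        · exact absurd (hfs hh).2 (not_lt.mpr hx)
        · exact absurd (hgs hh).1 (not_lt.mpr hx)) (θ := φ) ⟨by linarith, hφ.2⟩
    rw [← this]
    exact tsum_congr fun n => by ring
  have := hp.series_eq_zero (c := fun n => G n * (p n).eval (cos φ)) hB (by
    refine Summable.of_nonneg_of_le (fun k => mul_nonneg (abs_nonneg _) (by linarith [hB1 k]))
      (fun k => ?_) hsum
    rw [abs_mul, pow_two, ← mul_assoc]
    exact mul_le_mul_of_nonneg_right (mul_le_mul_of_nonneg_left (hB k φ hφ) (abs_nonneg _))
      (by linarith [hB1 k])) (U := Ioo 0 (θ + δ)) isOpen_Ioo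
      (fun x hx => ⟨hx.1, by linarith [hx.2, hφ.2]⟩) h1 (θ := θ) ⟨hθ.1, by linarith⟩
  rw [← this]
  exact tsum_congr fun n => by ring

end

open scoped FourierTransform

/-- The function `x ↦ x₊^γ e^{-εx}`. -/
def posPow (γ ε x : ℝ) : ℝ := max x 0 ^ γ * exp (-(ε * x))

lemma posPow_of_nonpos {γ : ℝ} (hγ : 0 < γ) (ε : ℝ) {x : ℝ} (hx : x ≤ 0) : posPow γ ε x = 0 := by
  rw [posPow, max_eq_right hx, zero_rpow hγ.ne', zero_mul]

lemma posPow_of_nonneg (γ ε : ℝ) {x : ℝ} (hx : 0 ≤ x) :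
    posPow γ ε x = x ^ γ * exp (-(ε * x)) := by rw [posPow, max_eq_left hx]

lemma continuous_posPow {γ : ℝ} (hγ : 0 < γ) (ε : ℝ) : Continuous (posPow γ ε) := by
  unfold posPow
  exact ((continuous_id.max continuous_const).rpow_const fun _ => Or.inr hγ.le).mul (by fun_prop)

lemma integrable_posPow {γ ε : ℝ} (hγ : 0 < γ) (hε : 0 < ε) : Integrable (posPow γ ε) := by
  have h := integrableOn_rpow_mul_exp_neg_mul_rpow (s := γ) (p := 1) (by linarith) one_pos hε
  have h2 : IntegrableOn (posPow γ ε) (Ioi 0) := h.congr_fun (fun x hx => by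
    simp only [posPow_of_nonneg γ ε (le_of_lt hx), rpow_one, neg_mul]) measurableSet_Ioi
  exact h2.integrable_of_forall_notMem_eq_zero fun x hx => posPow_of_nonpos hγ ε (by simpa using hx)

lemma integral_posPow {γ ε : ℝ} (hγ : 0 < γ) (hε : 0 < ε) :
    ∫ x, posPow γ ε x = Gamma (γ + 1) * ε ^ (-(γ + 1)) := by
  rw [← setIntegral_eq_integral_of_forall_compl_eq_zero (s := Ioi 0)
    (fun x hx => posPow_of_nonpos hγ ε (by simpa using hx)),
    setIntegral_congr_fun (g := fun x => x ^ (γ + 1 - 1) * exp (-(ε * x))) measurableSet_Ioi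
    (fun x hx => by simp only [posPow_of_nonneg γ ε (le_of_lt hx), add_sub_cancel_right]),
    integral_rpow_mul_exp_neg_mul_Ioi (by linarith) hε, mul_comm, one_div, inv_rpow hε.le,
    rpow_neg hε.le]

lemma hasDerivAt_posPow {γ : ℝ} (hγ : 0 < γ) (ε x : ℝ) :
    HasDerivAt (posPow (γ + 1) ε) ((γ + 1) * posPow γ ε x - ε * posPow (γ + 1) ε x) x := by
  have h1 : HasDerivAt (fun x : ℝ => max x 0 ^ (γ + 1)) ((γ + 1) * max x 0 ^ γ) x := by
    rcases lt_trichotomy x 0 with hx | hx | hx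
    · refine ((hasDerivAt_const x (0 : ℝ)).congr_of_eventuallyEq ?_).congr_deriv ?_
      · filter_upwards [Iio_mem_nhds hx] with y hy
        rw [max_eq_right (le_of_lt hy), zero_rpow (by linarith)]
      · rw [max_eq_right hx.le, zero_rpow hγ.ne', mul_zero]
    · subst hx
      rw [max_self, zero_rpow hγ.ne', mul_zero, hasDerivAt_iff_isLittleO_nhds_zero]
      simp only [zero_add, max_self, smul_zero, sub_zero]
      rw [zero_rpow (by linarith)]
      simp only [sub_zero]
      refine Asymptotics.isLittleO_of_tendsto' (Eventually.of_forall fun h h0 => ?_) ?_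
      · rw [h0, max_self, zero_rpow (by linarith)]
      · have h2 : Tendsto (fun h : ℝ => max h 0 ^ γ) (𝓝 0) (𝓝 0) := by
          have : Continuous fun h : ℝ => max h 0 ^ γ :=
            (continuous_id.max continuous_const).rpow_const fun _ => Or.inr hγ.le
          have h3 := this.tendsto 0
          simpa [zero_rpow hγ.ne'] using h3
        refine squeeze_zero_norm (fun h => ?_) h2
        rcases le_or_gt h 0 with hh | hh
        · rw [max_eq_right hh, zero_rpow (by linarith), zero_rpow hγ.ne']; simp
        · rw [max_eq_left hh.le, rpow_add hh, rpow_one, mul_div_assoc, div_self hh.ne', mul_one,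
            norm_of_nonneg (rpow_nonneg hh.le _)]
    · refine ((hasDerivAt_rpow_const (p := γ + 1) (Or.inl hx.ne')).congr_of_eventuallyEq
        ?_).congr_deriv ?_
      · filter_upwards [Ioi_mem_nhds hx] with y hy
        rw [max_eq_left (le_of_lt hy)]
      · rw [max_eq_left hx.le, add_sub_cancel_right]
  have h2 : HasDerivAt (fun x : ℝ => exp (-(ε * x))) (exp (-(ε * x)) * (-ε)) x := by
    refine (((hasDerivAt_id' x).const_mul ε).neg.exp).congr_deriv ?_
    simp
  refine (h1.mul h2).congr_deriv ?_
  simp only [posPow]; ring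

lemma add_I_mul_mem_slitPlane {ε : ℝ} (hε : 0 < ε) (ξ : ℝ) :
    (ε + 2 * π * Complex.I * ξ : ℂ) ∈ Complex.slitPlane := by
  left; simpa using hε

lemma hasDerivAt_cpow_line {ε : ℝ} (hε : 0 < ε) (a : ℂ) (ξ : ℝ) :
    HasDerivAt (fun ξ : ℝ => (ε + 2 * π * Complex.I * ξ : ℂ) ^ a)
      (2 * π * Complex.I * a * (ε + 2 * π * Complex.I * ξ : ℂ) ^ (a - 1)) ξ := by
  have h1 : HasDerivAt (fun w : ℂ => (ε + 2 * π * Complex.I * w : ℂ)) (2 * π * Complex.I) ξ := by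
    refine (((hasDerivAt_id' (ξ : ℂ)).const_mul (2 * π * Complex.I)).const_add
      (ε : ℂ)).congr_deriv ?_
    simp
  refine (h1.cpow_const (c := a) (add_I_mul_mem_slitPlane hε ξ)).comp_ofReal.congr_deriv ?_
  ring

lemma fourier_posPow {γ ε : ℝ} (hγ : 0 < γ) (hε : 0 < ε) (ξ : ℝ) :
    𝓕 (fun x : ℝ => (posPow γ ε x : ℂ)) ξ =
      Gamma (γ + 1) * (ε + 2 * π * Complex.I * ξ : ℂ) ^ (-(γ + 1) : ℂ) := by
  set f : ℝ → ℂ := fun x => (posPow γ ε x : ℂ) with hf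
  set g : ℝ → ℂ := fun x => (posPow (γ + 1) ε x : ℂ) with hg
  have hfi : Integrable f := (integrable_posPow hγ hε).ofReal
  have hgi : Integrable g := (integrable_posPow (by linarith : 0 < γ + 1) hε).ofReal
  have hgf : ∀ x : ℝ, x • f x = g x := fun x => by
    simp only [hf, hg, Complex.real_smul, ← Complex.ofReal_mul]
    congr 1
    rcases le_or_gt x 0 with hx | hx
    · rw [posPow_of_nonpos hγ ε hx, posPow_of_nonpos (by linarith) ε hx, mul_zero]
    · rw [posPow_of_nonneg _ _ hx.le, posPow_of_nonneg _ _ hx.le, rpow_add hx, rpow_one]; ring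
  have hdg : ∀ x, HasDerivAt g ((γ + 1 : ℂ) * f x - ε * g x) x := fun x => by
    refine (hasDerivAt_posPow hγ ε x).ofReal_comp.congr_deriv ?_
    simp [hf, hg]
  have hderiv : deriv g = fun x => (γ + 1 : ℂ) * f x - ε * g x := funext fun x => (hdg x).deriv
  have hF1 : ∀ ξ : ℝ, HasDerivAt (𝓕 f) (-2 * π * Complex.I * 𝓕 g ξ) ξ := fun ξ => by
    have := Real.hasDerivAt_fourier hfi (by simpa only [hgf] using hgi) ξ
    refine this.congr_deriv ?_
    have h2 : (fun x : ℝ => (-2 * π * Complex.I * x) • f x) =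
        fun x => (-2 * π * Complex.I) • g x := by
      funext x
      rw [← hgf, smul_eq_mul, smul_eq_mul, Complex.real_smul]; ring
    rw [h2]
    rw [Real.fourier_eq', Real.fourier_eq', ← integral_const_mul]
    refine integral_congr_ae (Eventually.of_forall fun x => ?_)
    simp only [smul_eq_mul]; ring
  have hF2 : ∀ ξ : ℝ, (ε + 2 * π * Complex.I * ξ : ℂ) * 𝓕 g ξ = (γ + 1) * 𝓕 f ξ := fun ξ => by
    have h := congrFun (Real.fourier_deriv hgi (fun x => (hdg x).differentiableAt) (by
      rw [hderiv]; exact (hfi.const_mul _).sub (hgi.const_mul _))) ξ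
    rw [hderiv, Real.fourier_eq'] at h
    have hb : ∀ {u : ℝ → ℂ}, Integrable u → Integrable fun v : ℝ =>
        Complex.exp (↑(-2 * π * inner ℝ v ξ) * Complex.I) * u v := fun {u} hu => by
      refine hu.bdd_mul (c := 1) (Continuous.aestronglyMeasurable (by fun_prop))
        (Eventually.of_forall fun v => ?_)
      rw [Complex.norm_exp_ofReal_mul_I]
    have h3 : (∫ v : ℝ, Complex.exp (↑(-2 * π * inner ℝ v ξ) * Complex.I) •
        ((γ + 1 : ℂ) * f v - ε * g v)) = (γ + 1) * 𝓕 f ξ - ε * 𝓕 g ξ := by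
      rw [Real.fourier_eq', Real.fourier_eq', ← integral_const_mul, ← integral_const_mul,
        ← integral_sub]
      · refine integral_congr_ae (Eventually.of_forall fun x => ?_)
        simp only [smul_eq_mul]; ring
      · exact (hb hfi).const_mul _
      · exact (hb hgi).const_mul _
    rw [h3, smul_eq_mul] at h
    linear_combination -h
  set z : ℝ → ℂ := fun ξ => (ε + 2 * π * Complex.I * ξ : ℂ) with hz
  have hz0 : ∀ ξ, z ξ ≠ 0 := fun ξ => Complex.slitPlane_ne_zero (add_I_mul_mem_slitPlane hε ξ)
  have hconst : ∀ ξ, HasDerivAt (fun ξ => 𝓕 f ξ * z ξ ^ (γ + 1 : ℂ)) 0 ξ := fun ξ => by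
    refine ((hF1 ξ).mul (hasDerivAt_cpow_line hε (γ + 1 : ℂ) ξ)).congr_deriv ?_
    have h4 : z ξ ^ (γ + 1 : ℂ) = z ξ ^ (γ + 1 - 1 : ℂ) * z ξ := by
      rw [Complex.cpow_sub _ _ (hz0 ξ), Complex.cpow_one, div_mul_cancel₀ _ (hz0 ξ)]
    change -2 * π * Complex.I * 𝓕 g ξ * z ξ ^ (γ + 1 : ℂ) + 𝓕 f ξ * (2 * π * Complex.I * (γ + 1) *
      z ξ ^ (γ + 1 - 1 : ℂ)) = 0
    rw [h4]
    linear_combination (-2 * π * Complex.I * z ξ ^ (γ + 1 - 1 : ℂ)) * hF2 ξ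
  have hc := is_const_of_deriv_eq_zero (fun ξ => (hconst ξ).differentiableAt)
    (fun ξ => (hconst ξ).deriv) ξ 0
  have h0 : 𝓕 f 0 = ((Gamma (γ + 1) * ε ^ (-(γ + 1)) : ℝ) : ℂ) := by
    rw [← integral_posPow hγ hε, Real.fourier_eq', ← integral_complex_ofReal]
    refine integral_congr_ae (Eventually.of_forall fun x => ?_)
    simp [hf]
  have hz00 : z 0 = (ε : ℂ) := by simp [hz]
  rw [h0, hz00] at hc
  have h5 : ((ε : ℝ) : ℂ) ^ (γ + 1 : ℂ) = ((ε ^ (γ + 1) : ℝ) : ℂ) := by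
    rw [Complex.ofReal_cpow hε.le]; simp
  rw [h5, ← Complex.ofReal_mul, mul_assoc, ← rpow_add hε, neg_add_cancel, rpow_zero, mul_one] at hc
  rw [Complex.cpow_neg, ← hc, mul_assoc, mul_inv_cancel₀, mul_one]
  rw [Ne, Complex.cpow_eq_zero_iff]
  exact fun h => hz0 ξ h.1

/-- Smooth bounded functions, constant near infinity on both sides, vanishing on `(-r, r)`. -/
structure IsHighPass (r : ℝ) (b : ℝ → ℂ) : Prop where
  contDiff : ContDiff ℝ (⊤ : ℕ∞) b
  bounded : ∃ C, ∀ ξ, ‖b ξ‖ ≤ C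
  deriv_supp : HasCompactSupport (deriv b)
  vanish : ∀ ξ, |ξ| < r → b ξ = 0

lemma IsHighPass.deriv {r : ℝ} {b : ℝ → ℂ} (h : IsHighPass r b) : IsHighPass r (deriv b) where
  contDiff := ContDiff.deriv' (n := (⊤ : ℕ∞)) (by simpa using h.contDiff)
  bounded := (h.contDiff.continuous_deriv (by simp)).bounded_above_of_compact_support h.deriv_supp
  deriv_supp := h.deriv_supp.deriv
  vanish ξ hξ := by
    have : b =ᶠ[𝓝 ξ] fun _ => 0 := by
      filter_upwards [(isOpen_lt continuous_abs continuous_const).mem_nhds hξ] with y hy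
      exact h.vanish y hy
    rw [this.deriv_eq, deriv_const]

lemma IsHighPass.const_mul {r : ℝ} {b : ℝ → ℂ} (h : IsHighPass r b) (c : ℂ) :
    IsHighPass r (fun ξ => c * b ξ) where
  contDiff := contDiff_const.mul h.contDiff
  bounded := by
    obtain ⟨C, hC⟩ := h.bounded
    exact ⟨‖c‖ * C, fun ξ => by
      rw [norm_mul]; exact mul_le_mul_of_nonneg_left (hC ξ) (norm_nonneg _)⟩
  deriv_supp := by
    have : _root_.deriv (fun ξ => c * b ξ) = fun ξ => c * _root_.deriv b ξ := funext fun ξ =>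
      deriv_const_mul c (h.contDiff.differentiable (by simp) ξ)
    rw [this]
    exact h.deriv_supp.mul_left
  vanish ξ hξ := by rw [h.vanish ξ hξ, mul_zero]

lemma norm_cpow_neg_line {ε : ℝ} (hε : 0 < ε) (a ξ : ℝ) :
    ‖(ε + 2 * π * Complex.I * ξ : ℂ) ^ (-a : ℂ)‖ = ‖(ε + 2 * π * Complex.I * ξ : ℂ)‖ ^ (-a) := by
  rw [Complex.norm_cpow_of_ne_zero (Complex.slitPlane_ne_zero (add_I_mul_mem_slitPlane hε ξ))]
  simp

lemma abs_le_norm_line (ε ξ : ℝ) : 2 * π * |ξ| ≤ ‖(ε + 2 * π * Complex.I * ξ : ℂ)‖ := by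
  refine le_trans (le_of_eq ?_) (Complex.abs_im_le_norm _)
  simp [abs_mul, abs_of_pos pi_pos]

lemma contDiff_cpow_line {ε : ℝ} (hε : 0 < ε) (a : ℂ) :
    ContDiff ℝ (⊤ : ℕ∞) (fun ξ : ℝ => (ε + 2 * π * Complex.I * ξ : ℂ) ^ a) := by
  rw [contDiff_iff_contDiffAt]
  intro ξ
  have h1 : AnalyticAt ℂ (fun w : ℂ => (ε + 2 * π * Complex.I * w : ℂ) ^ a) (ξ : ℂ) :=
    AnalyticAt.cpow (by fun_prop) analyticAt_const (add_I_mul_mem_slitPlane hε ξ)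
  have h2 : ContDiffAt ℝ (⊤ : ℕ∞) (fun w : ℂ => (ε + 2 * π * Complex.I * w : ℂ) ^ a) (ξ : ℂ) :=
    h1.contDiffAt.restrict_scalars ℝ
  exact h2.comp ξ Complex.ofRealCLM.contDiff.contDiffAt

lemma IsHighPass.exists_iteratedDeriv_bound {r : ℝ} (hr : 0 < r) (k : ℕ) :
    ∀ {b : ℝ → ℂ}, IsHighPass r b → ∀ {a : ℝ}, 0 < a → ∃ C, 0 ≤ C ∧ ∀ ε ∈ Ioc (0 : ℝ) 1, ∀ ξ : ℝ,
      ‖iteratedDeriv k (fun ξ : ℝ => b ξ * (ε + 2 * π * Complex.I * ξ : ℂ) ^ (-a : ℂ)) ξ‖ ≤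
        C * (1 + |ξ|) ^ (-a) := by
  induction k with
  | zero =>
    intro b hb a ha
    obtain ⟨C, hC⟩ := hb.bounded
    have hC0 : 0 ≤ C := (norm_nonneg _).trans (hC 0)
    set c := 2 * π * (r / (1 + r)) with hc
    have hc0 : 0 < c := by positivity
    refine ⟨C * c ^ (-a), by positivity, fun ε hε ξ => ?_⟩
    rw [iteratedDeriv_zero, norm_mul]
    rcases lt_or_ge |ξ| r with h | h
    · rw [hb.vanish ξ h, norm_zero, zero_mul]; positivity
    · rw [mul_assoc C, ← mul_rpow hc0.le (by positivity), norm_cpow_neg_line hε.1]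
      refine mul_le_mul (hC ξ) ?_ (by positivity) hC0
      refine rpow_le_rpow_of_nonpos (by positivity) ?_ (by linarith)
      refine le_trans ?_ (abs_le_norm_line ε ξ)
      rw [hc, mul_assoc]
      refine mul_le_mul_of_nonneg_left ?_ (by positivity)
      rw [div_mul_eq_mul_div, div_le_iff₀ (by positivity)]
      nlinarith
  | succ k ih =>
    intro b hb a ha
    obtain ⟨C1, hC1, h1⟩ := ih hb.deriv ha
    obtain ⟨C2, hC2, h2⟩ := ih (hb.const_mul (2 * π * Complex.I * (-a))) (by linarith : 0 < a + 1)
    refine ⟨C1 + C2, by positivity, fun ε hε ξ => ?_⟩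
    have hd : _root_.deriv (fun ξ : ℝ => b ξ * (ε + 2 * π * Complex.I * ξ : ℂ) ^ (-a : ℂ)) =
        (fun ξ : ℝ => _root_.deriv b ξ * (ε + 2 * π * Complex.I * ξ : ℂ) ^ (-a : ℂ)) +
        fun ξ : ℝ => 2 * π * Complex.I * (-a) * b ξ *
          (ε + 2 * π * Complex.I * ξ : ℂ) ^ (-(a + 1 : ℝ) : ℂ) := by
      funext ξ
      rw [((hb.contDiff.differentiable (by simp) ξ).hasDerivAt.fun_mul
        (hasDerivAt_cpow_line hε.1 (-a : ℂ) ξ)).deriv, Pi.add_apply]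
      have : (-(a + 1 : ℝ) : ℂ) = -a - 1 := by push_cast; ring
      rw [this]
      ring
    rw [iteratedDeriv_succ', hd, iteratedDeriv_add, add_mul]
    · refine (norm_add_le _ _).trans (add_le_add (h1 ε hε ξ) ((h2 ε hε ξ).trans ?_))
      refine mul_le_mul_of_nonneg_left ?_ hC2
      exact rpow_le_rpow_of_exponent_le (by linarith [abs_nonneg ξ]) (by linarith)
    · exact ((hb.deriv.contDiff.mul (contDiff_cpow_line hε.1 _)).of_le
        (by exact_mod_cast le_top)).contDiffAt
    · exact (((hb.const_mul _).contDiff.mul (contDiff_cpow_line hε.1 _)).of_le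
        (by exact_mod_cast le_top)).contDiffAt

lemma integrable_one_add_abs_rpow {a : ℝ} (ha : 1 < a) :
    Integrable fun ξ : ℝ => (1 + |ξ|) ^ (-a) := by
  have := integrable_one_add_norm (E := ℝ) (μ := volume) (r := a) (by simpa using ha)
  simpa using this

lemma IsHighPass.exists_fourier_bound {r : ℝ} (hr : 0 < r) {b : ℝ → ℂ} (hb : IsHighPass r b)
    {a : ℝ} (ha : 1 < a) (N : ℕ) : ∃ C, 0 ≤ C ∧ ∀ ε ∈ Ioc (0 : ℝ) 1, ∀ x : ℝ,
      ‖𝓕 (fun ξ : ℝ => b ξ * (ε + 2 * π * Complex.I * ξ : ℂ) ^ (-a : ℂ)) x‖ ≤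
        C / (1 + |x|) ^ N := by
  choose C hC0 hC using fun k => IsHighPass.exists_iteratedDeriv_bound hr k hb
    (by linarith : 0 < a)
  set J := ∫ ξ : ℝ, (1 + |ξ|) ^ (-a) with hJ
  have hJ0 : 0 ≤ J := integral_nonneg fun ξ => by positivity
  have key : ∀ k : ℕ, ∀ ε ∈ Ioc (0 : ℝ) 1, ∀ x : ℝ, |x| ^ k *
      ‖𝓕 (fun ξ : ℝ => b ξ * (ε + 2 * π * Complex.I * ξ : ℂ) ^ (-a : ℂ)) x‖ ≤ C k * J := by
    intro k ε hε x
    set F := fun ξ : ℝ => b ξ * (ε + 2 * π * Complex.I * ξ : ℂ) ^ (-a : ℂ) with hF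
    have hFs : ContDiff ℝ (⊤ : ℕ∞) F := hb.contDiff.mul (contDiff_cpow_line hε.1 _)
    have h := congrFun (Real.fourier_iteratedDeriv (N := ⊤) (n := k) hFs (fun n _ => by
      refine ((integrable_one_add_abs_rpow ha).const_mul (C n)).mono'
        (hFs.continuous_iteratedDeriv n (by exact_mod_cast le_top)).aestronglyMeasurable
        (Eventually.of_forall fun ξ => hC n ε hε ξ)) le_top) x
    have h1 : ‖𝓕 (iteratedDeriv k F) x‖ ≤ C k * J := by
      rw [Real.fourier_eq', hJ, ← integral_const_mul]
      refine norm_integral_le_of_norm_le ((integrable_one_add_abs_rpow ha).const_mul (C k))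
        (Eventually.of_forall fun ξ => ?_)
      rw [norm_smul, Complex.norm_exp_ofReal_mul_I, one_mul]
      exact hC k ε hε ξ
    rw [h, norm_smul, norm_pow] at h1
    refine le_trans (mul_le_mul_of_nonneg_right (pow_le_pow_left₀ (abs_nonneg _) ?_ k)
      (norm_nonneg _)) h1
    simp only [norm_mul, Complex.norm_real, Complex.norm_I, Complex.norm_ofNat, norm_eq_abs,
      abs_of_pos pi_pos, mul_one]
    nlinarith [abs_nonneg x, pi_gt_three]
  refine ⟨2 ^ N * (C 0 * J + C N * J), by have := hC0 0; have := hC0 N; positivity,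
    fun ε hε x => ?_⟩
  rw [le_div_iff₀ (by positivity)]
  have h0 := key 0 ε hε x
  have hN := key N ε hε x
  rw [pow_zero, one_mul] at h0
  set A := ‖𝓕 (fun ξ : ℝ => b ξ * (ε + 2 * π * Complex.I * ξ : ℂ) ^ (-a : ℂ)) x‖
  have hA : 0 ≤ A := norm_nonneg _
  have h3 : (1 + |x|) ^ N ≤ 2 ^ N * (1 + |x| ^ N) := by
    have : (1 + |x|) ≤ 2 * max 1 |x| := by
      linarith [le_max_left 1 |x|, le_max_right 1 |x|]
    refine (pow_le_pow_left₀ (by positivity) this N).trans ?_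
    rw [mul_pow]
    refine mul_le_mul_of_nonneg_left ?_ (by positivity)
    rcases max_cases 1 |x| with ⟨h, _⟩ | ⟨h, _⟩ <;> rw [h]
    · rw [one_pow]; linarith [pow_nonneg (abs_nonneg x) N]
    · linarith
  calc A * (1 + |x|) ^ N ≤ A * (2 ^ N * (1 + |x| ^ N)) := mul_le_mul_of_nonneg_left h3 hA
    _ = 2 ^ N * (A + |x| ^ N * A) := by ring
    _ ≤ _ := by gcongr

lemma fourier_add_fourier_neg {u : ℝ → ℂ} (hu : Integrable u) (x : ℝ) :
    𝓕 u x + 𝓕 u (-x) = ∫ ξ : ℝ, u ξ * ((2 * cos (2 * π * ξ * x) : ℝ) : ℂ) := by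
  have hb : ∀ x : ℝ, Integrable fun v : ℝ =>
      Complex.exp (↑(-2 * π * v * x) * Complex.I) • u v := fun x => by
    simp only [smul_eq_mul]
    refine hu.bdd_mul (c := 1) (Continuous.aestronglyMeasurable (by fun_prop))
      (Eventually.of_forall fun v => ?_)
    rw [Complex.norm_exp_ofReal_mul_I]
  rw [Real.fourier_real_eq_integral_exp_smul, Real.fourier_real_eq_integral_exp_smul,
    ← integral_add (hb x) (hb (-x))]
  refine integral_congr_ae (Eventually.of_forall fun ξ => ?_)
  simp only [smul_eq_mul]
  have h1 : Complex.exp (↑(-2 * π * ξ * x) * Complex.I) +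
      Complex.exp (↑(-2 * π * ξ * -x) * Complex.I) = ((2 * cos (2 * π * ξ * x) : ℝ) : ℂ) := by
    push_cast
    rw [Complex.two_cos, add_comm]
    congr 2 <;> ring
  rw [← h1]; ring

/-- The multiplier `x^γ e^{-εx}`, `0 < ε ≤ 1`, splits as a cosine transform of a kernel supported in
`[-1/8, 1/8]` plus a rapidly decaying remainder, uniformly in `ε`. -/
lemma exists_multiplier_split {γ : ℝ} (hγ : 0 < γ) (N : ℕ) :
    ∃ C, 0 ≤ C ∧ ∀ ε ∈ Ioc (0 : ℝ) 1, ∃ ker : ℝ → ℝ, Integrable ker ∧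
      (∀ ξ, 1 / 8 < |ξ| → ker ξ = 0) ∧
      ∀ x, 0 ≤ x → |x ^ γ * exp (-(ε * x)) - ∫ ξ, ker ξ * cos (2 * π * ξ * x)| ≤
        C / (1 + x) ^ N := by
  let b : ContDiffBump (0 : ℝ) := ⟨1 / 16, 1 / 8, by norm_num, by norm_num⟩
  have hb1 : ∀ ξ : ℝ, |ξ| ≤ 1 / 16 → b ξ = 1 := fun ξ hξ =>
    b.one_of_mem_closedBall (by simpa [b] using hξ)
  have hb0 : ∀ ξ : ℝ, 1 / 8 ≤ |ξ| → b ξ = 0 := fun ξ hξ =>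
    b.zero_of_le_dist (by simpa [b] using hξ)
  have hbc : Continuous b := b.continuous
  have hhp : IsHighPass (1 / 16) fun ξ : ℝ => ((1 - b ξ : ℝ) : ℂ) := by
    refine ⟨Complex.ofRealCLM.contDiff.comp (contDiff_const.sub b.contDiff), ⟨1, fun ξ => ?_⟩, ?_,
      fun ξ hξ => by simp [hb1 ξ hξ.le]⟩
    · rw [Complex.norm_real, norm_eq_abs, abs_le]
      constructor <;> linarith [b.nonneg (x := ξ), b.le_one (x := ξ)]
    · refine HasCompactSupport.intro (isCompact_closedBall (0 : ℝ) (1 / 8)) fun ξ hξ => ?_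
      have hξ' : 1 / 8 < |ξ| := by simpa using hξ
      have : (fun ξ : ℝ => ((1 - b ξ : ℝ) : ℂ)) =ᶠ[𝓝 ξ] fun _ => 1 := by
        filter_upwards [(isOpen_lt continuous_const continuous_abs).mem_nhds hξ'] with y hy
        simp [hb0 y (le_of_lt hy)]
      rw [this.deriv_eq, deriv_const]
  obtain ⟨C, hC0, hC⟩ := hhp.exists_fourier_bound (by norm_num) (by linarith : 1 < γ + 1) N
  have hΓ : 0 < Gamma (γ + 1) := Gamma_pos_of_pos (by linarith)
  refine ⟨Gamma (γ + 1) * (2 * C), by positivity, fun ε hε => ?_⟩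
  set Z : ℝ → ℂ := fun ξ => (ε + 2 * π * Complex.I * ξ : ℂ) ^ (-((γ + 1 : ℝ) : ℂ)) with hZ
  set h : ℝ → ℂ := fun ξ => Gamma (γ + 1) * Z ξ with hh
  have hF : 𝓕 (fun x : ℝ => (posPow γ ε x : ℂ)) = h := funext fun ξ => by
    rw [fourier_posPow hγ hε.1]
    simp [hh, hZ]
  have hZc : Continuous Z := (contDiff_cpow_line hε.1 _).continuous
  have hZi : Integrable Z := by
    refine ((integrable_one_add_abs_rpow (by linarith : 1 < γ + 1)).const_mul
      ((ε / 2) ^ (-(γ + 1)))).mono' hZc.aestronglyMeasurable (Eventually.of_forall fun ξ => ?_)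
    rw [← mul_rpow (by linarith [hε.1]) (by positivity), hZ]
    simp only
    rw [norm_cpow_neg_line hε.1]
    refine rpow_le_rpow_of_nonpos (mul_pos (by linarith [hε.1]) (by positivity)) ?_ (by linarith)
    have h1 := abs_le_norm_line ε ξ
    have h2 : ε ≤ ‖(ε + 2 * π * Complex.I * ξ : ℂ)‖ := by
      refine le_trans ?_ (Complex.abs_re_le_norm _)
      simp [le_abs_self]
    have h3 : ε * |ξ| ≤ 1 * |ξ| := mul_le_mul_of_nonneg_right hε.2 (abs_nonneg _)
    nlinarith [abs_nonneg ξ, pi_gt_three]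
  have hhi : Integrable h := hZi.const_mul _
  have hhb : Integrable fun ξ => h ξ * ((b ξ : ℝ) : ℂ) :=
    hhi.mul_bdd (c := 1) (by fun_prop) (Eventually.of_forall fun ξ => by
      rw [Complex.norm_real, norm_eq_abs, abs_of_nonneg b.nonneg]; exact b.le_one)
  have hcos : ∀ {u : ℝ → ℂ}, Integrable u → ∀ x : ℝ,
      Integrable fun ξ => u ξ * ((2 * cos (2 * π * ξ * x) : ℝ) : ℂ) := fun {u} hu x =>
    hu.mul_bdd (c := 2) (by fun_prop) (Eventually.of_forall fun ξ => by
      rw [Complex.norm_real, norm_eq_abs, abs_mul, abs_two]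
      linarith [abs_cos_le_one (2 * π * ξ * x)])
  have hinv : 𝓕⁻ h = fun x : ℝ => (posPow γ ε x : ℂ) := by
    have hc : Continuous fun x : ℝ => (posPow γ ε x : ℂ) :=
      Complex.continuous_ofReal.comp (continuous_posPow hγ ε)
    rw [← hF]
    exact hc.fourierInv_fourier_eq (integrable_posPow hγ hε.1).ofReal (by rw [hF]; exact hhi)
  refine ⟨fun ξ => 2 * (h ξ * ((b ξ : ℝ) : ℂ)).re, hhb.re.const_mul 2, fun ξ hξ => by
    simp [hb0 ξ hξ.le], fun x hx => ?_⟩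
  have e1 : ((x ^ γ * exp (-(ε * x)) : ℝ) : ℂ) =
      ∫ ξ, h ξ * ((2 * cos (2 * π * ξ * x) : ℝ) : ℂ) := by
    rw [← fourier_add_fourier_neg hhi, ← Real.fourierInv_eq_fourier_neg, hinv]
    have h4 := congrFun hinv (-x)
    rw [Real.fourierInv_eq_fourier_neg, neg_neg] at h4
    beta_reduce
    rw [h4, posPow_of_nonneg γ ε hx, posPow_of_nonpos hγ ε (by linarith : -x ≤ 0)]
    simp
  have e2 : ((∫ ξ, 2 * (h ξ * ((b ξ : ℝ) : ℂ)).re * cos (2 * π * ξ * x) : ℝ)) =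
      (∫ ξ, h ξ * ((b ξ : ℝ) : ℂ) * ((2 * cos (2 * π * ξ * x) : ℝ) : ℂ)).re := by
    have := Complex.reCLM.integral_comp_comm (hcos hhb x)
    simp only [Complex.reCLM_apply] at this
    rw [← this]
    refine integral_congr_ae (Eventually.of_forall fun ξ => ?_)
    simp only [Complex.re_mul_ofReal]; ring
  have e3 : (x ^ γ * exp (-(ε * x)) - ∫ ξ, 2 * (h ξ * ((b ξ : ℝ) : ℂ)).re * cos (2 * π * ξ * x)) =
      (Gamma (γ + 1) * (𝓕 (fun ξ : ℝ => ((1 - b ξ : ℝ) : ℂ) * Z ξ) x +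
        𝓕 (fun ξ : ℝ => ((1 - b ξ : ℝ) : ℂ) * Z ξ) (-x)) : ℂ).re := by
    have hbZ : Integrable fun ξ => ((1 - b ξ : ℝ) : ℂ) * Z ξ :=
      hZi.bdd_mul (c := 1) (by fun_prop) (Eventually.of_forall fun ξ => by
        rw [Complex.norm_real, norm_eq_abs, abs_le]
        constructor <;> linarith [b.nonneg (x := ξ), b.le_one (x := ξ)])
    rw [e2, ← Complex.ofReal_re (x ^ γ * exp (-(ε * x))), e1, ← Complex.sub_re,
      ← integral_sub (hcos hhi x) (hcos hhb x), fourier_add_fourier_neg hbZ, ← integral_const_mul]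
    congr 1
    refine integral_congr_ae (Eventually.of_forall fun ξ => ?_)
    simp only [hh]; push_cast; ring
  rw [e3]
  refine (Complex.abs_re_le_norm _).trans ?_
  rw [norm_mul, Complex.norm_real, norm_of_nonneg hΓ.le, mul_div_assoc]
  refine mul_le_mul_of_nonneg_left ((norm_add_le _ _).trans ?_) hΓ.le
  have c1 := hC ε hε x
  have c2 := hC ε hε (-x)
  rw [abs_neg] at c2
  rw [abs_of_nonneg hx] at c1 c2
  rw [mul_div_assoc, two_mul]
  exact add_le_add c1 c2

/-- The largest order of vanishing of `r ↦ 1 / jscale α β r θ` as `r → 0`. -/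
def jkap (α β : ℝ) : ℝ := max 0 (max (-(2 * α + 1)) (-(2 * β + 1)))

/-- An integer dominating the growth of `r ↦ jscale α β r θ`. -/
def jgrow (α β : ℝ) : ℕ := ⌈|2 * α + 1| + |2 * β + 1|⌉₊

lemma jkap_nonneg (α β : ℝ) : 0 ≤ jkap α β := le_max_left _ _

lemma jkap_lt_one {α β : ℝ} (hα : -1 < α) (hβ : -1 < β) : jkap α β < 1 :=
  max_lt one_pos (max_lt (by linarith) (by linarith))

lemma jkap_comm (α β : ℝ) : jkap β α = jkap α β := by
  unfold jkap; rw [max_comm (-(2 * β + 1))]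

lemma jgrow_comm (α β : ℝ) : jgrow β α = jgrow α β := by
  unfold jgrow; rw [add_comm]

lemma exists_jscale_ratio_half (α β : ℝ) : ∃ C : ℝ, 0 < C ∧
    ∀ r ∈ Ioc (0 : ℝ) 4, ∀ s ∈ Ioc (0 : ℝ) 4, ∀ θ ∈ Ioc 0 (π / 2),
      jscale α β r θ ≤ C * ((r / (s + r)) ^ (-jkap α β) * (1 + r / s) ^ jgrow α β) *
        jscale α β s θ := by
  obtain ⟨D, hD, h⟩ := exists_jscale_half α β
  refine ⟨D * D, by positivity, fun r hr s hs θ hθ => ?_⟩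
  have hr0 := hr.1
  have hs0 := hs.1
  have hθ0 := hθ.1
  set a := 2 * α + 1 with ha
  set l := r / (s + r) with hl
  set g := 1 + r / s with hg
  have hl0 : 0 < l := by positivity
  have hl1 : l ≤ 1 := by rw [hl, div_le_one (by positivity)]; linarith
  have hrs : 0 < r / s := by positivity
  have hg1 : 1 ≤ g := by linarith
  have key : ((θ + r) / (θ + s)) ^ a ≤ l ^ (-jkap α β) * g ^ jgrow α β := by
    refine (rpow_le_max_rpow (l := l) (h := g) hl0 ?_ ?_ a).trans (max_le ?_ ?_)
    · rw [hl, div_le_div_iff₀ (by positivity) (by positivity)]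
      nlinarith [mul_pos hθ0 hs0, mul_pos hr0 hr0]
    · rw [hg, div_le_iff₀ (by positivity)]
      have : r / s * s = r := by field_simp
      nlinarith
    · refine le_trans ?_ (le_mul_of_one_le_right (by positivity) (one_le_pow₀ hg1))
      refine rpow_le_rpow_of_exponent_ge hl0 hl1 ?_
      have : -a ≤ jkap α β := (le_max_left _ _).trans (le_max_right _ _)
      linarith
    · refine le_trans ?_ (le_mul_of_one_le_left (by positivity)
        (one_le_rpow_of_pos_of_le_one_of_nonpos hl0 hl1 (by linarith [jkap_nonneg α β])))
      rw [← rpow_natCast]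
      refine rpow_le_rpow_of_exponent_le hg1 (le_trans ?_ (Nat.le_ceil _))
      linarith [le_abs_self a, abs_nonneg (2 * β + 1)]
  have h1 := (h r hr θ hθ).1
  have h2 := (h s hs θ hθ).2
  have hθs : 0 < θ + s := by positivity
  have hsplit : (θ + r) ^ a = ((θ + r) / (θ + s)) ^ a * (θ + s) ^ a := by
    rw [← mul_rpow (by positivity) hθs.le, div_mul_cancel₀ _ hθs.ne']
  calc jscale α β r θ ≤ D * (θ + r) ^ a := h1
    _ ≤ D * (l ^ (-jkap α β) * g ^ jgrow α β * (D * jscale α β s θ)) := by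
        rw [hsplit]; gcongr
    _ = _ := by ring

lemma exists_jscale_ratio (α β : ℝ) : ∃ C : ℝ, 0 < C ∧
    ∀ r ∈ Ioc (0 : ℝ) 4, ∀ s ∈ Ioc (0 : ℝ) 4, ∀ θ ∈ Ioo 0 π,
      jscale α β r θ ≤ C * ((r / (s + r)) ^ (-jkap α β) * (1 + r / s) ^ jgrow α β) *
        jscale α β s θ := by
  obtain ⟨C, hC, h⟩ := exists_jscale_ratio_half α β
  obtain ⟨C', hC', h'⟩ := exists_jscale_ratio_half β α
  refine ⟨max C C', lt_max_of_lt_left hC, fun r hr s hs θ hθ => ?_⟩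
  have hr0 := hr.1
  have hs0 := hs.1
  have hj := jscale_pos α β hs0 hθ
  rcases le_total θ (π / 2) with hθ' | hθ'
  · refine (h r hr s hs θ ⟨hθ.1, hθ'⟩).trans ?_
    gcongr
    exact le_max_left _ _
  · have := h' r hr s hs (π - θ) ⟨by linarith [hθ.2], by linarith⟩
    rw [jscale_refl, jscale_refl, jkap_comm, jgrow_comm] at this
    refine this.trans ?_
    gcongr
    exact le_max_right _ _

/-- Monotonicity of the ball-measure surrogate `r * jscale α β r θ`. -/
lemma exists_mul_jscale_le (α β : ℝ) : ∃ C : ℝ, 0 < C ∧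
    ∀ r ∈ Ioc (0 : ℝ) 4, ∀ d ∈ Ioc (0 : ℝ) r, ∀ θ ∈ Ioo 0 π,
      d * jscale α β d θ ≤ C * (d / r) ^ (1 - jkap α β) * (r * jscale α β r θ) := by
  obtain ⟨C, hC, h⟩ := exists_jscale_ratio α β
  refine ⟨C * (2 ^ jkap α β * 2 ^ jgrow α β), by positivity, fun r hr d hd θ hθ => ?_⟩
  have hr0 := hr.1
  have hd0 := hd.1
  have hj := jscale_pos α β hr0 hθ
  have hdr : d / r ≤ 1 := (div_le_one hr0).2 hd.2
  have h0 : 0 < d / r := by positivity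
  have h1 := h d ⟨hd0, hd.2.trans hr.2⟩ r hr θ hθ
  have h2 : (d / (r + d)) ^ (-jkap α β) ≤ 2 ^ jkap α β * (d / r) ^ (-jkap α β) := by
    have : (2 : ℝ) ^ jkap α β = (1 / 2 : ℝ) ^ (-jkap α β) := by
      rw [one_div, inv_rpow (by norm_num), rpow_neg (by norm_num), inv_inv]
    rw [this, ← mul_rpow (by norm_num) h0.le]
    refine rpow_le_rpow_of_nonpos (by positivity) ?_ (by linarith [jkap_nonneg α β])
    rw [show 1 / 2 * (d / r) = d / (2 * r) by field_simp]
    gcongr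
    linarith [hd.2]
  calc d * jscale α β d θ ≤ d * (C * ((2 ^ jkap α β * (d / r) ^ (-jkap α β)) * 2 ^ jgrow α β) *
        jscale α β r θ) := by
        refine mul_le_mul_of_nonneg_left (h1.trans ?_) hd0.le
        gcongr
        linarith
    _ = C * (2 ^ jkap α β * 2 ^ jgrow α β) * ((d / r) * (d / r) ^ (-jkap α β)) *
        (r * jscale α β r θ) := by field_simp
    _ = _ := by
        rw [sub_eq_add_neg, rpow_add h0, rpow_one]

lemma exists_mul_jscale_le_rpow (α β : ℝ) : ∃ C : ℝ, 0 < C ∧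
    ∀ d ∈ Ioc (0 : ℝ) 4, ∀ θ ∈ Ioo 0 π,
      d * jscale α β d θ ≤ C * d ^ (1 - jkap α β) := by
  obtain ⟨C, hC, h⟩ := exists_mul_jscale_le α β
  have h4 : ∀ θ ∈ Ioo 0 π, jscale α β 4 θ ≤ 8 ^ |2 * α + 1| * 8 ^ |2 * β + 1| := fun θ hθ => by
    have hpi := pi_lt_four
    have k : ∀ x ∈ Ioo 0 π, ∀ a : ℝ, (x + 4) ^ a ≤ 8 ^ |a| := fun x hx a => by
      have := rpow_le_of_comparable a (x := 1) (y := x + 4) (k := 8) one_pos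
        (by linarith [hx.1]) (by linarith [hx.2]) (by linarith [hx.1])
      simpa using this
    exact mul_le_mul (k θ hθ _) (k (π - θ) ⟨by linarith [hθ.2], by linarith [hθ.1]⟩ _)
      (rpow_nonneg (by linarith [hθ.2]) _) (by positivity)
  refine ⟨C * ((4 : ℝ)⁻¹ ^ (1 - jkap α β)) * (4 * (8 ^ |2 * α + 1| * 8 ^ |2 * β + 1|)),
    by positivity, fun d hd θ hθ => ?_⟩
  refine (h 4 ⟨by norm_num, le_rfl⟩ d hd θ hθ).trans ?_
  rw [div_eq_inv_mul, mul_rpow (by norm_num) hd.1.le]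
  have hd0 := hd.1
  calc _ ≤ C * ((4 : ℝ)⁻¹ ^ (1 - jkap α β) * d ^ (1 - jkap α β)) *
        (4 * (8 ^ |2 * α + 1| * 8 ^ |2 * β + 1|)) := by gcongr; exact h4 θ hθ
    _ = _ := by ring

lemma jscale_le_jscale (α β : ℝ) {r θ φ : ℝ} (hr : 0 < r) (hθ : θ ∈ Ioo 0 π) (hφ : φ ∈ Ioo 0 π)
    (hd : |θ - φ| ≤ r) :
    jscale α β r θ ≤ 2 ^ |2 * α + 1| * 2 ^ |2 * β + 1| * jscale α β r φ := by
  rw [abs_le] at hd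
  have h1 := rpow_le_of_comparable (2 * α + 1) (x := φ + r) (y := θ + r) (k := 2)
    (by linarith [hφ.1]) (by linarith [hθ.1]) (by linarith [hφ.1]) (by linarith [hθ.1])
  have h2 := rpow_le_of_comparable (2 * β + 1) (x := π - φ + r) (y := π - θ + r) (k := 2)
    (by linarith [hφ.2]) (by linarith [hθ.2]) (by linarith [hφ.2]) (by linarith [hθ.2])
  unfold jscale
  calc _ ≤ (2 ^ |2 * α + 1| * (φ + r) ^ (2 * α + 1)) *
        (2 ^ |2 * β + 1| * (π - φ + r) ^ (2 * β + 1)) :=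
        mul_le_mul h1 h2 (rpow_nonneg (by linarith [hθ.2]) _)
          (mul_nonneg (by positivity) (rpow_nonneg (by linarith [hφ.1]) _))
    _ = _ := by ring

/-- A Riemann-sum bound for `∫₀^∞ (x/(1+x))^(-κ) (1+x)⁻² dx`. -/
lemma sum_rpow_le {κ r : ℝ} (h0 : 0 ≤ κ) (h1 : κ < 1) (hr : 0 < r) (N : ℕ) :
    ∑ n ∈ Finset.range N, (((n + 1 : ℝ) * r) / (1 + (n + 1) * r)) ^ (-κ) / (1 + (n + 1) * r) ^ 2 ≤
      1 / ((1 - κ) * r) := by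
  set u : ℕ → ℝ := fun n => (n * r) / (1 + n * r) with hu
  have hterm : ∀ n : ℕ, (((n + 1 : ℝ) * r) / (1 + (n + 1) * r)) ^ (-κ) / (1 + (n + 1) * r) ^ 2 ≤
      1 / ((1 - κ) * r) * (u (n + 1) ^ (1 - κ) - u n ^ (1 - κ)) := fun n => by
    have hn : (0 : ℝ) ≤ n := Nat.cast_nonneg n
    have hv : u (n + 1) = ((n + 1 : ℝ) * r) / (1 + (n + 1) * r) := by simp [hu]
    have hv0 : 0 < u (n + 1) := by rw [hv]; positivity
    have hu0 : 0 ≤ u n := by simp only [hu]; positivity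
    have hdiff : r / (1 + (n + 1) * r) ^ 2 ≤ u (n + 1) - u n := by
      rw [hv, hu, div_sub_div _ _ (by positivity) (by positivity),
        div_le_div_iff₀ (by positivity) (by positivity)]
      have : 0 ≤ r * r * (1 + (n + 1) * r) := by positivity
      have h3 : 0 ≤ n * r := by positivity
      nlinarith [mul_nonneg h3 this]
    have hb := rpow_one_add_le_one_add_mul_self (s := u n / u (n + 1) - 1) (p := 1 - κ)
      (by have := div_nonneg hu0 hv0.le; linarith) (by linarith) (by linarith)
    rw [add_sub_cancel, div_rpow hu0 hv0.le, div_le_iff₀ (rpow_pos_of_pos hv0 _)] at hb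
    have hs : u (n + 1) ^ (1 - κ) = u (n + 1) * u (n + 1) ^ (-κ) := by
      rw [sub_eq_add_neg, rpow_add hv0, rpow_one]
    have hb' : (1 - κ) * ((u (n + 1) - u n) * u (n + 1) ^ (-κ)) ≤
        u (n + 1) ^ (1 - κ) - u n ^ (1 - κ) := by
      have : (1 + (1 - κ) * (u n / u (n + 1) - 1)) * u (n + 1) ^ (1 - κ) = u (n + 1) ^ (1 - κ) -
          (1 - κ) * ((u (n + 1) - u n) * u (n + 1) ^ (-κ)) := by
        rw [hs]; field_simp; ring
      linarith
    have hk : 0 < 1 - κ := by linarith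
    rw [← hv, one_div_mul_eq_div, le_div_iff₀ (by positivity)]
    refine le_trans ?_ hb'
    have h5 : 0 < u (n + 1) ^ (-κ) := rpow_pos_of_pos hv0 _
    calc _ = (1 - κ) * (r / (1 + (n + 1) * r) ^ 2 * u (n + 1) ^ (-κ)) := by ring
      _ ≤ _ := by gcongr
  refine (Finset.sum_le_sum fun n _ => hterm n).trans ?_
  have hk : 0 < 1 - κ := by linarith
  rw [← Finset.mul_sum, Finset.sum_range_sub (fun n => u n ^ (1 - κ))]
  refine mul_le_of_le_one_right (by positivity) ?_
  have : u N ^ (1 - κ) ≤ 1 := by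
    refine rpow_le_one (by simp only [hu]; positivity) ?_ hk.le
    simp only [hu]
    rw [div_le_one (by positivity)]
    linarith
  have h6 : 0 ≤ u 0 ^ (1 - κ) := rpow_nonneg (by simp [hu]) _
  linarith

lemma exists_sqrt_lam_ge {α β : ℝ} (hα : -1 < α) (hβ : -1 < β) : ∃ k : ℝ, 1 ≤ k ∧
    ∀ n : ℕ, n / k ≤ √(lam α β n) := by
  obtain ⟨k, hk1, hk⟩ := exists_jeig_bounds hα hβ
  refine ⟨k, hk1, fun n => ?_⟩
  rcases Nat.eq_zero_or_pos n with rfl | hn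
  · simp
  · refine le_sqrt_of_sq_le ((hk n hn).1.trans ?_)
    rw [lam_eq]
    linarith [sq_nonneg ((α + β + 1) / 2)]

section
variable {α β : ℝ} {p : ℕ → Polynomial ℝ}

/-- Uniform bounds for multiplier series with multipliers localized at frequencies `≲ 1/r`. -/
lemma IsOrthoSeq.exists_series_bound (hp : IsOrthoSeq α β p) (hα : -1 < α) (hβ : -1 < β) :
    ∃ C : ℝ, 0 < C ∧ ∀ r ∈ Ioc (0 : ℝ) 4, ∀ θ ∈ Ioo 0 π, ∀ φ ∈ Ioo 0 π, ∀ G : ℕ → ℝ,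
      (∀ n, |G n| ≤ 1 / (1 + r * √(lam α β n)) ^ (jgrow α β + 3)) →
      |∑' n, G n * (p n).eval (cos θ) * (p n).eval (cos φ)| ≤
        C / (r * (√(jscale α β r θ) * √(jscale α β r φ))) ∧
      |∑' n, G n * dcos (p n) θ * (p n).eval (cos φ)| ≤
        C / (r * (√(jscale α β r θ) * √(jscale α β r φ))) / r := by
  obtain ⟨k, hk1, hk⟩ := exists_sqrt_lam_ge hα hβ
  obtain ⟨A, hA, hsup⟩ := hp.exists_sup_bound hα hβ
  obtain ⟨A0, Q, hA0, hcr⟩ := hp.exists_crude_bound hα hβ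
  obtain ⟨D, hD, hrat⟩ := exists_jscale_ratio α β
  obtain ⟨M, hM, hW⟩ := exists_mul_jscale_le_rpow α β
  have hκ := jkap_lt_one hα hβ
  have hκ0 := jkap_nonneg α β
  set κ := jkap α β with hκd
  set K := jgrow α β with hKd
  set M' := M * 4 ^ (1 - κ) with hM'
  have hk' : 0 < 1 - κ := by linarith
  have hk0 : 0 < k := by linarith
  refine ⟨4 * (A0 * A0 * M') + k ^ (K + 3) * (A * A * D) / (1 - κ), by positivity,
    fun r hr θ hθ φ hφ G hG => ?_⟩
  have hr0 := hr.1
  have hjθ := jscale_pos α β hr0 hθ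
  have hjφ := jscale_pos α β hr0 hφ
  set J := √(jscale α β r θ) * √(jscale α β r φ) with hJ
  have hJ0 : 0 < J := mul_pos (sqrt_pos.2 hjθ) (sqrt_pos.2 hjφ)
  have hWr : ∀ x ∈ Ioo 0 π, r * jscale α β r x ≤ M' := fun x hx =>
    (hW r hr x hx).trans (mul_le_mul_of_nonneg_left (rpow_le_rpow hr0.le hr.2 hk'.le) hM.le)
  have hrJ : r * J ≤ M' := by
    have h1 : J ≤ (jscale α β r θ + jscale α β r φ) / 2 := by
      nlinarith [sq_nonneg (√(jscale α β r θ) - √(jscale α β r φ)), sq_sqrt hjθ.le, sq_sqrt hjφ.le]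
    have := mul_le_mul_of_nonneg_left h1 hr0.le
    linarith [hWr θ hθ, hWr φ hφ]
  set v : ℕ → ℝ := fun n =>
    (((n + 1 : ℝ) * r) / (1 + (n + 1) * r)) ^ (-κ) / (1 + (n + 1) * r) ^ 2 with hv
  have hv0 : ∀ n, 0 ≤ v n := fun n => by simp only [hv]; positivity
  have hvs : Summable v := summable_of_sum_range_le hv0 (sum_rpow_le hκ0 hκ hr0)
  have hvt : ∑' n, v n ≤ 1 / ((1 - κ) * r) := Real.tsum_le_of_sum_range_le hv0 (sum_rpow_le hκ0 hκ hr0)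
  set B := k ^ (K + 3) * (A * A * D) / J with hB
  have hG0 : |G 0| ≤ 1 := (hG 0).trans (by
    rw [div_le_one (by positivity)]
    exact one_le_pow₀ (le_add_of_nonneg_right (by positivity)))
  have hG1 : ∀ n : ℕ, |G (n + 1)| ≤ k ^ (K + 3) / (1 + (n + 1) * r) ^ (K + 3) := fun n => by
    refine (hG (n + 1)).trans ?_
    rw [div_le_div_iff₀ (by positivity) (by positivity), one_mul, ← mul_pow]
    refine pow_le_pow_left₀ (by positivity) ?_ _
    have h1 := hk (n + 1)
    rw [div_le_iff₀ hk0] at h1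
    push_cast at h1 ⊢
    nlinarith [mul_le_mul_of_nonneg_left h1 hr0.le]
  have hinv : ∀ n : ℕ, ∀ x ∈ Ioo 0 π, 1 / √(jscale α β (1 / (n + 1 : ℕ)) x) ≤
      √(D * ((((n + 1 : ℝ) * r) / (1 + (n + 1) * r)) ^ (-κ) * (1 + (n + 1) * r) ^ K)) /
        √(jscale α β r x) := fun n x hx => by
    have hn : (0 : ℝ) < (n + 1 : ℕ) := by positivity
    have hs1 : (1 : ℝ) / (n + 1 : ℕ) ≤ 1 := by
      rw [div_le_one hn]; push_cast; linarith [(Nat.cast_nonneg n : (0 : ℝ) ≤ n)]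
    have h1 := hrat r hr (1 / (n + 1 : ℕ)) ⟨by positivity, by linarith⟩ x hx
    have hj := jscale_pos α β (r := 1 / (n + 1 : ℕ)) (by positivity) hx
    have hj' := jscale_pos α β hr0 hx
    rw [← sqrt_div' _ hj'.le]
    refine le_sqrt_of_sq_le ?_
    rw [div_pow, sq_sqrt hj.le, one_pow]
    rw [div_le_div_iff₀ hj hj', one_mul]
    have e1 : r / (1 / ((n + 1 : ℕ) : ℝ) + r) = ((n + 1 : ℝ) * r) / (1 + (n + 1) * r) := by
      push_cast; field_simp
    have e2 : r / (1 / ((n + 1 : ℕ) : ℝ)) = (n + 1 : ℝ) * r := by push_cast; field_simp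
    rwa [e1, e2] at h1
  have hprod : ∀ n : ℕ, 1 / √(jscale α β (1 / (n + 1 : ℕ)) θ) *
      (1 / √(jscale α β (1 / (n + 1 : ℕ)) φ)) ≤
      D * ((((n + 1 : ℝ) * r) / (1 + (n + 1) * r)) ^ (-κ) * (1 + (n + 1) * r) ^ K) / J :=
    fun n => by
    refine (mul_le_mul (hinv n θ hθ) (hinv n φ hφ) (by positivity) (by positivity)).trans
      (le_of_eq ?_)
    rw [div_mul_div_comm, mul_self_sqrt (by positivity)]
  have hPP : ∀ n : ℕ, ∀ s ≤ 1 + (n + 1) * r, 0 ≤ s → |G (n + 1)| * (A * s / √(jscale α β (1 / (n + 1 : ℕ)) θ)) *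
      (A / √(jscale α β (1 / (n + 1 : ℕ)) φ)) ≤ B * v n := fun n s hs hs0 => by
    have hy : 0 < 1 + (n + 1) * r := by positivity
    calc _ = |G (n + 1)| * (A * A) * s * (1 / √(jscale α β (1 / (n + 1 : ℕ)) θ) *
          (1 / √(jscale α β (1 / (n + 1 : ℕ)) φ))) := by ring
      _ ≤ k ^ (K + 3) / (1 + (n + 1) * r) ^ (K + 3) * (A * A) * (1 + (n + 1) * r) *
          (D * ((((n + 1 : ℝ) * r) / (1 + (n + 1) * r)) ^ (-κ) * (1 + (n + 1) * r) ^ K) / J) := by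
        gcongr
        · exact hG1 n
        · exact hprod n
      _ = B * v n := by
        simp only [hB, hv]
        field_simp
        ring
  have final : ∀ T : ℕ → ℝ, ∀ e, 0 ≤ e → |T 0| ≤ e * (4 * (A0 * A0)) →
      (∀ n, |T (n + 1)| ≤ e * (B * v n)) →
      |∑' n, T n| ≤ e * ((4 * (A0 * A0 * M') + k ^ (K + 3) * (A * A * D) / (1 - κ)) / (r * J)) :=
    fun T e he h0 h1 => by
    have hs1 : Summable fun n => T (n + 1) :=
      Summable.of_norm_bounded ((hvs.mul_left B).mul_left e) h1
    have hs : Summable T := (summable_nat_add_iff 1).1 hs1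
    rw [hs.tsum_eq_zero_add]
    refine (abs_add_le _ _).trans ?_
    have h2 : |∑' n, T (n + 1)| ≤ e * (B * (1 / ((1 - κ) * r))) := by
      refine (tsum_of_norm_bounded (f := fun n => T (n + 1)) ((hvs.mul_left B).mul_left e).hasSum h1).trans ?_
      rw [tsum_mul_left, tsum_mul_left]
      gcongr
    have h3 : 4 * (A0 * A0) ≤ 4 * (A0 * A0 * M') / (r * J) := by
      rw [le_div_iff₀ (by positivity)]
      calc _ ≤ 4 * (A0 * A0) * M' := by gcongr
        _ = _ := by ring
    calc _ ≤ e * (4 * (A0 * A0 * M') / (r * J)) + e * (B * (1 / ((1 - κ) * r))) :=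
          add_le_add (h0.trans (mul_le_mul_of_nonneg_left h3 he)) h2
      _ = _ := by rw [hB]; field_simp
  have hc0 : ∀ x ∈ Ioo 0 π, |(p 0).eval (cos x)| ≤ A0 ∧ |dcos (p 0) x| ≤ A0 := fun x hx => by
    simpa using hcr 0 x hx
  constructor
  · have := final (fun n => G n * (p n).eval (cos θ) * (p n).eval (cos φ)) 1 zero_le_one ?_ ?_
    · simpa using this
    · rw [abs_mul, abs_mul]
      calc _ ≤ 1 * A0 * A0 := by gcongr; exacts [(hc0 θ hθ).1, (hc0 φ hφ).1]
        _ ≤ _ := by nlinarith [mul_pos hA0 hA0]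
    · intro n
      rw [abs_mul, abs_mul, one_mul]
      refine le_trans ?_ (hPP n 1 (le_add_of_nonneg_right (by positivity)) zero_le_one)
      rw [mul_one]
      gcongr
      exacts [(hsup (n + 1) (by simp) θ hθ).1, (hsup (n + 1) (by simp) φ hφ).1]
  · have := final (fun n => G n * dcos (p n) θ * (p n).eval (cos φ)) (1 / r) (by positivity) ?_ ?_
    · rw [div_eq_inv_mul _ r, ← one_div]
      exact this
    · rw [abs_mul, abs_mul]
      have h14 : 1 ≤ 1 / r * 4 := by rw [one_div_mul_eq_div, le_div_iff₀ hr0]; linarith [hr.2]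
      calc _ ≤ 1 * A0 * A0 := by gcongr; exacts [(hc0 θ hθ).2, (hc0 φ hφ).1]
        _ ≤ _ := by nlinarith [mul_pos hA0 hA0]
    · intro n
      rw [abs_mul, abs_mul, one_div_mul_eq_div, le_div_iff₀ hr0]
      have hy : (0 : ℝ) ≤ (n + 1) * r := by positivity
      refine le_trans ?_ (hPP n ((n + 1) * r) (by linarith) hy)
      calc _ ≤ |G (n + 1)| * (A * (n + 1 : ℕ) / √(jscale α β (1 / (n + 1 : ℕ)) θ)) *
            (A / √(jscale α β (1 / (n + 1 : ℕ)) φ)) * r := by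
            gcongr
            exacts [(hsup (n + 1) (by simp) θ hθ).2, (hsup (n + 1) (by simp) φ hφ).1]
        _ = _ := by push_cast; ring
end

lemma exists_exp_decay {a : ℝ} (ha : 0 ≤ a) (M : ℕ) :
    ∃ C, 0 < C ∧ ∀ x, 0 ≤ x → x ^ a * exp (-x) ≤ C / (1 + x) ^ M := by
  set L := ⌈a⌉₊ + M with hL
  refine ⟨exp 1 * L.factorial, by positivity, fun x hx => ?_⟩
  rw [le_div_iff₀ (by positivity)]
  have h1 : x ^ a ≤ (1 + x) ^ ⌈a⌉₊ := by
    rw [← rpow_natCast]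
    exact (rpow_le_rpow hx (by linarith) ha).trans
      (rpow_le_rpow_of_exponent_le (by linarith) (Nat.le_ceil a))
  have h2 := pow_div_factorial_le_exp (1 + x) (by linarith) L
  rw [div_le_iff₀ (by positivity)] at h2
  calc x ^ a * exp (-x) * (1 + x) ^ M ≤ (1 + x) ^ ⌈a⌉₊ * exp (-x) * (1 + x) ^ M := by gcongr
    _ = (1 + x) ^ L * exp (-x) := by rw [hL, pow_add]; ring
    _ ≤ exp (1 + x) * L.factorial * exp (-x) := by gcongr
    _ = exp 1 * L.factorial := by
      rw [mul_right_comm, ← exp_add]; congr 2; ring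

lemma summable_decay {α β : ℝ} (hα : -1 < α) (hβ : -1 < β) {t : ℝ} (ht : 0 < t) (Q : ℕ) :
    Summable fun n : ℕ => 1 / (1 + t * √(lam α β n)) ^ (Q + 2) * (n + 1 : ℝ) ^ Q := by
  obtain ⟨k, hk1, hk⟩ := exists_sqrt_lam_ge hα hβ
  have hk0 : 0 < k := by linarith
  set c := min 1 (t / k) with hc
  have hc0 : 0 < c := lt_min one_pos (by positivity)
  have hs : Summable fun n : ℕ => (1 / c ^ (Q + 2)) * (1 / (n + 1 : ℝ) ^ 2) := by
    refine Summable.mul_left _ ?_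
    have := (summable_nat_add_iff 1).2 (summable_one_div_nat_pow.2 (one_lt_two : 1 < 2))
    simpa using this
  refine hs.of_nonneg_of_le (fun n => by positivity) fun n => ?_
  have hn : (0 : ℝ) ≤ n := Nat.cast_nonneg n
  have h1 : c * (n + 1) ≤ 1 + t * √(lam α β n) := by
    have h2 : c * n ≤ t * √(lam α β n) := by
      calc c * n ≤ t / k * n := by gcongr; exact min_le_right _ _
        _ = t * (n / k) := by ring
        _ ≤ _ := by gcongr; exact hk n
    have h3 : c ≤ 1 := min_le_left _ _
    linarith
  calc _ ≤ 1 / (c * (n + 1)) ^ (Q + 2) * (n + 1 : ℝ) ^ Q := by gcongr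
    _ = _ := by rw [mul_pow, pow_add (n + 1 : ℝ)]; field_simp

lemma rpow_mul_exp_le {a : ℝ} {M : ℕ} {C : ℝ}
    (h : ∀ x, 0 ≤ x → x ^ a * exp (-x) ≤ C / (1 + x) ^ M) {t ω : ℝ} (ht : 0 < t) (hω : 0 ≤ ω) :
    ω ^ a * exp (-(t * ω)) ≤ t ^ (-a) * (C / (1 + t * ω) ^ M) := by
  have h1 := mul_le_mul_of_nonneg_left (h (t * ω) (by positivity)) (rpow_nonneg ht.le (-a))
  refine le_trans (le_of_eq ?_) h1
  rw [mul_rpow ht.le hω, rpow_neg ht.le]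
  have : t ^ a ≠ 0 := (rpow_pos_of_pos ht a).ne'
  field_simp

lemma summable_rpow_mul_exp {α β : ℝ} (hα : -1 < α) (hβ : -1 < β) {t : ℝ} (ht : 0 < t) {a : ℝ}
    (ha : 0 ≤ a) (Q : ℕ) :
    Summable fun n : ℕ => √(lam α β n) ^ a * exp (-(t * √(lam α β n))) * (n + 1 : ℝ) ^ Q := by
  obtain ⟨C, hC, h⟩ := exists_exp_decay ha (Q + 2)
  refine ((summable_decay hα hβ ht Q).mul_left (t ^ (-a) * C)).of_nonneg_of_le
    (fun n => by positivity) fun n => ?_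
  calc _ ≤ t ^ (-a) * (C / (1 + t * √(lam α β n)) ^ (Q + 2)) * (n + 1 : ℝ) ^ Q := by
        exact mul_le_mul_of_nonneg_right (rpow_mul_exp_le h ht (sqrt_nonneg _)) (by positivity)
    _ = _ := by ring

section
variable {ω c : ℕ → ℝ}

lemma iteratedDeriv_exp_series (hω : ∀ n, 0 ≤ ω n)
    (hs : ∀ k : ℕ, ∀ t, 0 < t → Summable fun n => ω n ^ k * exp (-(t * ω n)) * |c n|) (k : ℕ) :
    ∀ u, 0 < u → iteratedDeriv k (fun u => ∑' n, exp (-(u * ω n)) * c n) u =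
      ∑' n, (-ω n) ^ k * exp (-(u * ω n)) * c n := by
  induction k with
  | zero => intro u _; simp
  | succ k ih =>
    intro u hu
    have hd : ∀ n, ∀ y, HasDerivAt (fun y => (-ω n) ^ k * exp (-(y * ω n)) * c n)
        ((-ω n) ^ (k + 1) * exp (-(y * ω n)) * c n) y := fun n y => by
      refine (((((hasDerivAt_id' y).mul_const (ω n)).neg.exp).const_mul
        ((-ω n) ^ k)).mul_const (c n)).congr_deriv ?_
      simp only [Pi.neg_apply]
      ring
    have hnorm : ∀ (j n : ℕ) (y : ℝ), u / 2 < y → ‖(-ω n) ^ j * exp (-(y * ω n)) * c n‖ ≤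
        ω n ^ j * exp (-(u / 2 * ω n)) * |c n| := fun j n y hy => by
      rw [norm_mul, norm_mul, norm_pow, norm_neg, norm_eq_abs, norm_eq_abs, norm_eq_abs,
        abs_of_nonneg (hω n), abs_of_pos (exp_pos _)]
      have := hω n
      gcongr
    have hu2 : u ∈ Ioi (u / 2) := by simp only [mem_Ioi]; linarith
    have key := hasDerivAt_tsum_of_isPreconnected (hs (k + 1) (u / 2) (by linarith)) isOpen_Ioi
      (convex_Ioi (u / 2)).isPreconnected (fun n y _ => hd n y)
      (fun n y hy => hnorm (k + 1) n y hy) hu2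
      (Summable.of_norm_bounded (hs k (u / 2) (by linarith)) fun n => hnorm k n u hu2) hu2
    rw [iteratedDeriv_succ, ← key.deriv]
    refine EventuallyEq.deriv_eq ?_
    filter_upwards [lt_mem_nhds hu] with y hy using ih y hy

lemma caputoR_exp_series {γ : ℝ} (hγ : 0 < γ) (hω : ∀ n, 0 ≤ ω n)
    (hs : ∀ a : ℝ, 0 ≤ a → ∀ t, 0 < t → Summable fun n => ω n ^ a * exp (-(t * ω n)) * |c n|)
    {t : ℝ} (ht : 0 < t) :
    caputoR γ (fun u => ∑' n, exp (-(u * ω n)) * c n) t =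
      (-1) ^ (⌊γ⌋₊ + 1) * ∑' n, ω n ^ γ * exp (-(t * ω n)) * c n := by
  set m := ⌊γ⌋₊ + 1 with hm
  have hmγ : 0 < (⌊γ⌋₊ : ℝ) + 1 - γ := by linarith [Nat.lt_floor_add_one γ]
  have hΓ := Gamma_pos_of_pos hmγ
  set F : ℕ → ℝ → ℝ := fun n s =>
    s ^ ((⌊γ⌋₊ : ℝ) - γ) * ((-ω n) ^ m * exp (-((t + s) * ω n)) * c n) with hF
  have hFeq : ∀ n, EqOn (F n) (fun s => ((-ω n) ^ m * exp (-(t * ω n)) * c n) *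
      (s ^ ((⌊γ⌋₊ : ℝ) + 1 - γ - 1) * exp (-(ω n * s)))) (Ioi 0) := fun n s _ => by
    simp only [hF]
    rw [show (⌊γ⌋₊ : ℝ) + 1 - γ - 1 = ⌊γ⌋₊ - γ by ring,
      show -((t + s) * ω n) = -(t * ω n) + -(ω n * s) by ring, exp_add]
    ring
  have hpow : ∀ n, 0 < ω n →
      ω n ^ m * (1 / ω n) ^ ((⌊γ⌋₊ : ℝ) + 1 - γ) = ω n ^ γ := fun n hn => by
    rw [one_div, inv_rpow hn.le, ← rpow_neg hn.le, ← rpow_natCast, ← rpow_add hn]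
    congr 1; rw [hm]; push_cast; ring
  have hInteg : ∀ n, IntegrableOn (F n) (Ioi 0) := fun n => by
    rw [integrableOn_congr_fun (hFeq n) measurableSet_Ioi]
    rcases (hω n).eq_or_lt with h0 | h0
    · simp [← h0, hm]
    · refine Integrable.const_mul ?_ _
      have := integrableOn_rpow_mul_exp_neg_mul_rpow (s := (⌊γ⌋₊ : ℝ) + 1 - γ - 1) (p := 1)
        (by linarith) one_pos h0
      simp only [rpow_one, neg_mul] at this
      exact this
  have hval : ∀ n, ∫ s in Ioi 0, F n s = Gamma ((⌊γ⌋₊ : ℝ) + 1 - γ) *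
      ((-1) ^ m * (ω n ^ γ * exp (-(t * ω n)) * c n)) := fun n => by
    rw [setIntegral_congr_fun measurableSet_Ioi (hFeq n)]
    rcases (hω n).eq_or_lt with h0 | h0
    · simp [← h0, hm, zero_rpow hγ.ne']
    · rw [integral_const_mul, integral_rpow_mul_exp_neg_mul_Ioi hmγ h0, ← hpow n h0, neg_pow]
      ring
  have hnorm : ∀ n, ∫ s in Ioi 0, ‖F n s‖ = Gamma ((⌊γ⌋₊ : ℝ) + 1 - γ) *
      (ω n ^ γ * exp (-(t * ω n)) * |c n|) := fun n => by
    have : EqOn (fun s => ‖F n s‖) (fun s => (ω n ^ m * exp (-(t * ω n)) * |c n|) *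
        (s ^ ((⌊γ⌋₊ : ℝ) + 1 - γ - 1) * exp (-(ω n * s)))) (Ioi 0) := fun s hs => by
      have hs0 : (0 : ℝ) < s := hs
      simp only [hFeq n hs]
      rw [norm_mul, norm_mul, norm_mul, norm_pow, norm_neg, norm_of_nonneg (hω n),
        norm_of_nonneg (exp_pos _).le, norm_eq_abs (c n),
        norm_of_nonneg (mul_nonneg (rpow_nonneg hs0.le _) (exp_pos _).le)]
    rw [setIntegral_congr_fun measurableSet_Ioi this]
    rcases (hω n).eq_or_lt with h0 | h0
    · simp [← h0, hm, zero_rpow hγ.ne']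
    · rw [integral_const_mul, integral_rpow_mul_exp_neg_mul_Ioi hmγ h0, ← hpow n h0]
      ring
  have hsum := integral_tsum_of_summable_integral_norm (μ := volume.restrict (Ioi 0)) hInteg
    (by simp_rw [hnorm]; exact (hs γ hγ.le t ht).mul_left _)
  unfold caputoR
  rw [setIntegral_congr_fun (g := fun s => ∑' n, F n s) measurableSet_Ioi, ← hsum]
  · simp_rw [hval]
    rw [tsum_mul_left, tsum_mul_left, inv_mul_cancel_left₀ hΓ.ne']
  · intro s hs'
    have hs0 : (0 : ℝ) < s := hs'
    simp only [hF]
    rw [iteratedDeriv_exp_series hω (fun k t ht => by simpa using hs k k.cast_nonneg t ht) _ _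
      (by positivity : 0 < t + s), tsum_mul_left]

end

section
variable {α β : ℝ} {p : ℕ → Polynomial ℝ}

/-- The kernel `∑ ω_n^γ e^{-tω_n} P_n(θ) P_n(φ)`, `ω_n = √(lam α β n)`. -/
def fracK (α β γ : ℝ) (p : ℕ → Polynomial ℝ) (t θ φ : ℝ) : ℝ :=
  ∑' n, √(lam α β n) ^ γ * exp (-(t * √(lam α β n))) * (p n).eval (cos θ) * (p n).eval (cos φ)

/-- The derivative of `fracK` in its first angular variable. -/
def fracD (α β γ : ℝ) (p : ℕ → Polynomial ℝ) (t θ φ : ℝ) : ℝ :=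
  ∑' n, √(lam α β n) ^ γ * exp (-(t * √(lam α β n))) * dcos (p n) θ * (p n).eval (cos φ)

lemma summable_series {A : ℝ} {Q : ℕ} {G a b : ℕ → ℝ} (hA : 0 < A)
    (ha : ∀ n, |a n| ≤ A * (n + 1 : ℝ) ^ Q) (hb : ∀ n, |b n| ≤ A * (n + 1 : ℝ) ^ Q)
    (hG : Summable fun n : ℕ => |G n| * (n + 1 : ℝ) ^ (2 * Q)) :
    Summable fun n => G n * a n * b n := by
  refine Summable.of_norm_bounded (hG.mul_left (A * A)) fun n => ?_
  rw [norm_mul, norm_mul]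
  calc _ ≤ |G n| * (A * (n + 1 : ℝ) ^ Q) * (A * (n + 1 : ℝ) ^ Q) := by
        gcongr; exacts [le_rfl, ha n, hb n]
    _ = _ := by rw [two_mul, pow_add]; ring

lemma hasDerivAt_series {A : ℝ} {Q : ℕ} {G : ℕ → ℝ} (hA : 0 < A)
    (hcr : ∀ n : ℕ, ∀ θ ∈ Ioo 0 π,
      |(p n).eval (cos θ)| ≤ A * (n + 1 : ℝ) ^ Q ∧ |dcos (p n) θ| ≤ A * (n + 1 : ℝ) ^ Q)
    (hG : Summable fun n : ℕ => |G n| * (n + 1 : ℝ) ^ (2 * Q))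
    {θ φ : ℝ} (hθ : θ ∈ Ioo 0 π) (hφ : φ ∈ Ioo 0 π) :
    HasDerivAt (fun θ => ∑' n, G n * (p n).eval (cos θ) * (p n).eval (cos φ))
      (∑' n, G n * dcos (p n) θ * (p n).eval (cos φ)) θ := by
  refine hasDerivAt_tsum_of_isPreconnected (hG.mul_left (A * A)) isOpen_Ioo
    (convex_Ioo 0 π).isPreconnected
    (fun n y _ => ((hasDerivAt_eval_cos (p n) y).const_mul (G n)).mul_const _) (fun n y hy => ?_)
    hθ (summable_series hA (fun n => (hcr n θ hθ).1) (fun n => (hcr n φ hφ).1) hG) hθ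
  rw [norm_mul, norm_mul]
  calc _ ≤ |G n| * (A * (n + 1 : ℝ) ^ Q) * (A * (n + 1 : ℝ) ^ Q) := by
        gcongr; exacts [le_rfl, (hcr n y hy).2, (hcr n φ hφ).1]
    _ = _ := by rw [two_mul, pow_add]; ring

lemma IsOrthoSeq.exists_series_bound_scaled (hp : IsOrthoSeq α β p) (hα : -1 < α) (hβ : -1 < β) :
    ∃ C : ℝ, 0 < C ∧ ∀ r ∈ Ioc (0 : ℝ) 4, ∀ θ ∈ Ioo 0 π, ∀ φ ∈ Ioo 0 π, ∀ G : ℕ → ℝ, ∀ B, 0 < B →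
      (∀ n, |G n| ≤ B / (1 + r * √(lam α β n)) ^ (jgrow α β + 3)) →
      |∑' n, G n * (p n).eval (cos θ) * (p n).eval (cos φ)| ≤
        B * (C / (r * (√(jscale α β r θ) * √(jscale α β r φ)))) ∧
      |∑' n, G n * dcos (p n) θ * (p n).eval (cos φ)| ≤
        B * (C / (r * (√(jscale α β r θ) * √(jscale α β r φ))) / r) := by
  obtain ⟨C, hC, h⟩ := hp.exists_series_bound hα hβ
  refine ⟨C, hC, fun r hr θ hθ φ hφ G B hB hG => ?_⟩
  have hr0 := hr.1
  obtain ⟨h1, h2⟩ := h r hr θ hθ φ hφ (fun n => B⁻¹ * G n) fun n => by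
    rw [abs_mul, abs_of_pos (inv_pos.2 hB), inv_mul_le_iff₀ hB, mul_one_div]
    exact hG n
  simp only [mul_assoc] at h1 h2 ⊢
  rw [tsum_mul_left, abs_mul, abs_of_pos (inv_pos.2 hB), inv_mul_le_iff₀ hB] at h1 h2
  exact ⟨h1, h2⟩

/-- Finite propagation speed: away from the diagonal the multiplier `ω^γ e^{-tω}` may be replaced
by one localized at frequencies `≲ 1/|θ - φ|`. -/
lemma IsOrthoSeq.exists_localized_multiplier (hp : IsOrthoSeq α β p) (hα : -1 < α) (hβ : -1 < β)
    {γ : ℝ} (hγ : 0 < γ) (M : ℕ) :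
    ∃ C : ℝ, 0 < C ∧ ∀ θ ∈ Ioo 0 π, ∀ φ ∈ Ioo 0 π, ∀ t, 0 < t → t ≤ |θ - φ| →
      ∃ H : ℕ → ℝ,
        (∀ n, |H n| ≤ |θ - φ| ^ (-γ) * C / (1 + |θ - φ| * √(lam α β n)) ^ M) ∧
        fracK α β γ p t θ φ = ∑' n, H n * (p n).eval (cos θ) * (p n).eval (cos φ) ∧
        fracD α β γ p t θ φ = ∑' n, H n * dcos (p n) θ * (p n).eval (cos φ) := by
  obtain ⟨A, Q, hA, hcr⟩ := hp.exists_crude_bound hα hβ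
  obtain ⟨C, hC, hsplit⟩ := exists_multiplier_split hγ (M + (2 * Q + 2))
  refine ⟨C + 1, by linarith, fun θ hθ φ hφ t ht htd => ?_⟩
  set d := |θ - φ| with hd
  have hd0 : 0 < d := ht.trans_le htd
  have hdγ : 0 < d ^ (-γ) := rpow_pos_of_pos hd0 _
  obtain ⟨ker, hki, hksupp, hk⟩ := hsplit (t / d) ⟨by positivity, (div_le_one hd0).2 htd⟩
  have hpi := pi_pos
  set s := 2 * π * d with hs
  have hs0 : 0 < s := by positivity
  set ker' : ℝ → ℝ := fun τ => d ^ (-γ) * s⁻¹ * ker (τ / s) with hker'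
  have hki' : Integrable ker' := (hki.comp_div hs0.ne').const_mul _
  set G0 : ℕ → ℝ := fun n => ∫ τ, ker' τ * cos (τ * √(lam α β n)) with hG0
  have hG0' : ∀ n, G0 n = d ^ (-γ) * ∫ ξ, ker ξ * cos (2 * π * ξ * (d * √(lam α β n))) := fun n => by
    have h1 := Measure.integral_comp_div
      (fun ξ => ker ξ * cos (2 * π * ξ * (d * √(lam α β n)))) s
    rw [abs_of_pos hs0, smul_eq_mul] at h1
    have h2 : ∀ τ, ker' τ * cos (τ * √(lam α β n)) = d ^ (-γ) * s⁻¹ *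
        (ker (τ / s) * cos (2 * π * (τ / s) * (d * √(lam α β n)))) := fun τ => by
      rw [show 2 * π * (τ / s) * (d * √(lam α β n)) = τ * √(lam α β n) by
        rw [hs]; field_simp]
      simp only [hker']; ring
    simp only [hG0, h2]
    rw [integral_const_mul, h1, mul_assoc, inv_mul_cancel_left₀ hs0.ne']
  set E : ℕ → ℝ := fun n => √(lam α β n) ^ γ * exp (-(t * √(lam α β n))) with hE
  set H : ℕ → ℝ := fun n => E n - G0 n with hH
  have hHb : ∀ n, |H n| ≤ d ^ (-γ) * C / (1 + d * √(lam α β n)) ^ (M + (2 * Q + 2)) := fun n => by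
    have hx : 0 ≤ d * √(lam α β n) := by positivity
    have h1 := hk _ hx
    have h2 : E n = d ^ (-γ) * ((d * √(lam α β n)) ^ γ * exp (-(t / d * (d * √(lam α β n))))) := by
      rw [mul_rpow hd0.le (sqrt_nonneg _), rpow_neg hd0.le]
      have : d ^ γ ≠ 0 := (rpow_pos_of_pos hd0 γ).ne'
      rw [show t / d * (d * √(lam α β n)) = t * √(lam α β n) by field_simp]
      simp only [hE]; field_simp
    simp only [hH]
    rw [h2, hG0', ← mul_sub, abs_mul, abs_of_pos hdγ, mul_div_assoc]
    exact mul_le_mul_of_nonneg_left h1 hdγ.le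
  have hone : ∀ n, 1 ≤ 1 + d * √(lam α β n) := fun n =>
    le_add_of_nonneg_right (by positivity)
  have hHs : Summable fun n : ℕ => |H n| * (n + 1 : ℝ) ^ (2 * Q) := by
    refine ((summable_decay hα hβ hd0 (2 * Q)).mul_left (d ^ (-γ) * C)).of_nonneg_of_le
      (fun n => by positivity) fun n => ?_
    rw [← mul_assoc]
    refine mul_le_mul_of_nonneg_right ((hHb n).trans ?_) (by positivity)
    rw [mul_one_div]
    exact div_le_div_of_nonneg_left (by positivity) (by have := hone n; positivity)
      (pow_le_pow_right₀ (hone n) (by omega))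
  have hEs : Summable fun n : ℕ => |E n| * (n + 1 : ℝ) ^ (2 * Q) := by
    refine (summable_rpow_mul_exp hα hβ ht hγ.le (2 * Q)).congr fun n => ?_
    rw [abs_of_nonneg (by simp only [hE]; positivity)]
  have hGs : Summable fun n : ℕ => |G0 n| * (n + 1 : ℝ) ^ (2 * Q) := by
    refine (hEs.add hHs).of_nonneg_of_le (fun n => by positivity) fun n => ?_
    rw [← add_mul]
    refine mul_le_mul_of_nonneg_right ?_ (by positivity)
    rw [show G0 n = E n - H n by simp [hH]]
    exact abs_sub _ _
  set A1 := max 1 A with hA1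
  have hvanish : ∀ θ' ∈ Ioo 0 π, π / 4 * d < |θ' - φ| →
      ∑' n, G0 n * (p n).eval (cos θ') * (p n).eval (cos φ) = 0 := fun θ' hθ' hd' => by
    have hn1 : ∀ n : ℕ, (1 : ℝ) ≤ (n + 1 : ℝ) ^ Q := fun n => one_le_pow₀ (by simp)
    refine hp.kernel_eq_zero hα hβ hki' (s₀ := π / 4 * d) (by positivity) (fun τ hτ => ?_)
      (fun k => rfl) (B := fun n : ℕ => A1 * (n + 1 : ℝ) ^ Q)
      (fun n => one_le_mul_of_one_le_of_one_le (le_max_left _ _) (hn1 n))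
      (fun n x hx => (hcr n x hx).1.trans
        (mul_le_mul_of_nonneg_right (le_max_right _ _) (by positivity))) ?_ hθ' hφ hd'
    · simp only [hker']
      rw [hksupp (τ / s), mul_zero]
      rw [abs_div, abs_of_pos hs0, lt_div_iff₀ hs0, hs]
      linarith
    · refine (hGs.mul_left (A1 ^ 2)).congr fun n => ?_
      ring
  have heq : ∀ θ' ∈ Ioo 0 π, π / 4 * d < |θ' - φ| → fracK α β γ p t θ' φ =
      ∑' n, H n * (p n).eval (cos θ') * (p n).eval (cos φ) := fun θ' hθ' hd' => by
    have h1 := summable_series (a := fun n => (p n).eval (cos θ'))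
      (b := fun n => (p n).eval (cos φ)) hA (fun n => (hcr n θ' hθ').1)
      (fun n => (hcr n φ hφ).1) hHs
    have h2 := summable_series (a := fun n => (p n).eval (cos θ'))
      (b := fun n => (p n).eval (cos φ)) hA (fun n => (hcr n θ' hθ').1)
      (fun n => (hcr n φ hφ).1) hGs
    rw [← add_zero (∑' n, _), ← hvanish θ' hθ' hd', ← h1.tsum_add h2]
    unfold fracK
    refine tsum_congr fun n => ?_
    simp only [hH, hE]; ring
  have hπd : π / 4 * d < |θ - φ| := by
    rw [← hd]; nlinarith [pi_lt_four]
  refine ⟨H, fun n => (hHb n).trans ?_, heq θ hθ hπd, ?_⟩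
  · have := hone n
    calc _ ≤ d ^ (-γ) * C / (1 + d * √(lam α β n)) ^ M :=
          div_le_div_of_nonneg_left (by positivity) (by positivity)
            (pow_le_pow_right₀ this (by omega))
      _ ≤ _ := by gcongr; linarith
  · have h1 := hasDerivAt_series hA hcr hEs hθ hφ
    have h2 := hasDerivAt_series hA hcr hHs hθ hφ
    refine h1.deriv.symm.trans (Eq.trans ?_ h2.deriv)
    refine EventuallyEq.deriv_eq ?_
    have ho : IsOpen {x : ℝ | π / 4 * d < |x - φ|} :=
      isOpen_lt continuous_const (by fun_prop)
    filter_upwards [isOpen_Ioo.mem_nhds hθ, ho.mem_nhds hπd] with x hx hx' using heq x hx hx'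

end

section
variable {α β : ℝ} {p : ℕ → Polynomial ℝ}

/-- The symmetric surrogate for the measure of a ball of radius `r` containing `θ` and `φ`. -/
def ballScale (α β r θ φ : ℝ) : ℝ := r * (√(jscale α β r θ) * √(jscale α β r φ))

lemma ballScale_pos (α β : ℝ) {r θ φ : ℝ} (hr : 0 < r) (hθ : θ ∈ Ioo 0 π) (hφ : φ ∈ Ioo 0 π) :
    0 < ballScale α β r θ φ :=
  mul_pos hr (mul_pos (sqrt_pos.2 (jscale_pos α β hr hθ)) (sqrt_pos.2 (jscale_pos α β hr hφ)))

lemma ballScale_eq (α β : ℝ) {r : ℝ} (hr : 0 < r) (θ φ : ℝ) :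
    ballScale α β r θ φ = √(r * jscale α β r θ) * √(r * jscale α β r φ) := by
  rw [sqrt_mul hr.le, sqrt_mul hr.le, ballScale]
  rw [mul_mul_mul_comm, mul_self_sqrt hr.le]

lemma sqrt_mul_sqrt_le {c x y x' y' : ℝ} (hc : 0 ≤ c) (hx : x ≤ c * x') (hy : y ≤ c * y') :
    √x * √y ≤ c * (√x' * √y') := by
  calc √x * √y ≤ √(c * x') * √(c * y') :=
        mul_le_mul (sqrt_le_sqrt hx) (sqrt_le_sqrt hy) (sqrt_nonneg _) (sqrt_nonneg _)
    _ = _ := by rw [sqrt_mul hc, sqrt_mul hc, mul_mul_mul_comm, mul_self_sqrt hc]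

lemma exists_ballScale_le (α β : ℝ) : ∃ C : ℝ, 0 < C ∧
    ∀ θ ∈ Ioo 0 π, ∀ φ ∈ Ioo 0 π,
      (∀ r ∈ Ioc (0 : ℝ) 4, ∀ d ∈ Ioc (0 : ℝ) r,
        ballScale α β d θ φ ≤ C * (d / r) ^ (1 - jkap α β) * ballScale α β r θ φ) ∧
      ∀ d ∈ Ioc (0 : ℝ) 4, ballScale α β d θ φ ≤ C * d ^ (1 - jkap α β) := by
  obtain ⟨C, hC, h⟩ := exists_mul_jscale_le α β
  obtain ⟨C', hC', h'⟩ := exists_mul_jscale_le_rpow α β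
  refine ⟨max C C', lt_max_of_lt_left hC, fun θ hθ φ hφ => ⟨fun r hr d hd => ?_, fun d hd => ?_⟩⟩
  · have hr0 := hr.1
    have hd0 := hd.1
    rw [ballScale_eq α β hr0, ballScale_eq α β hd0]
    refine (sqrt_mul_sqrt_le (by positivity) (h r hr d hd θ hθ) (h r hr d hd φ hφ)).trans ?_
    gcongr
    exact le_max_left _ _
  · have hd0 := hd.1
    rw [ballScale_eq α β hd0]
    refine (sqrt_mul_sqrt_le (c := C' * d ^ (1 - jkap α β)) (x' := 1) (y' := 1) (by positivity)
      (by simpa using h' d hd θ hθ) (by simpa using h' d hd φ hφ)).trans ?_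
    rw [sqrt_one, mul_one, mul_one]
    gcongr
    exact le_max_right _ _

/-- Large-time decay of the kernel. -/
lemma IsOrthoSeq.exists_frac_bound_large (hp : IsOrthoSeq α β p) (hα : -1 < α) (hβ : -1 < β)
    {γ : ℝ} (hγ : 0 < γ) :
    ∃ C : ℝ, 0 < C ∧ ∀ θ ∈ Ioo 0 π, ∀ φ ∈ Ioo 0 π, ∀ t, 1 ≤ t →
      |fracK α β γ p t θ φ| ≤ C * t ^ (-γ - 1) ∧ |fracD α β γ p t θ φ| ≤ C * t ^ (-γ - 1) := by
  obtain ⟨A, Q, hA, hcr⟩ := hp.exists_crude_bound hα hβ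
  obtain ⟨k, hk1, hk⟩ := exists_sqrt_lam_ge hα hβ
  obtain ⟨C, hC, hdec⟩ := exists_exp_decay (a := γ + 1) (by linarith) (2 * Q + 2)
  have hsum := summable_decay hα hβ one_pos (2 * Q)
  set ω : ℕ → ℝ := fun n => √(lam α β n) with hω
  have hω0 : ∀ n, 0 ≤ ω n := fun n => sqrt_nonneg _
  set L := k + (ω 0)⁻¹ with hL
  have hL0 : 0 < L := by have := inv_nonneg.2 (hω0 0); linarith
  have hinv : ∀ n, (ω n)⁻¹ ≤ L := fun n => by
    rcases Nat.eq_zero_or_pos n with rfl | hn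
    · linarith
    · have hn' : (1 : ℝ) ≤ n := by exact_mod_cast hn
      have h1 : k⁻¹ ≤ ω n := le_trans (by rw [inv_eq_one_div]; gcongr) (hk n)
      have h2 : (ω n)⁻¹ ≤ k := inv_le_of_inv_le₀ (by linarith) h1
      linarith [inv_nonneg.2 (hω0 0)]
  have hterm : ∀ t, 1 ≤ t → ∀ n, |ω n ^ γ * exp (-(t * ω n))| ≤
      t ^ (-γ - 1) * (L * C) * (1 / (1 + 1 * ω n) ^ (2 * Q + 2)) := fun t ht n => by
    have ht0 : 0 < t := by linarith
    have hn := hω0 n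
    rw [abs_of_nonneg (by positivity)]
    rcases hn.eq_or_lt with h0 | h0
    · rw [← h0, zero_rpow hγ.ne', zero_mul]; positivity
    · have h1 := rpow_mul_exp_le hdec ht0 hn
      have h2 : ω n ^ γ * exp (-(t * ω n)) = (ω n)⁻¹ * (ω n ^ (γ + 1) * exp (-(t * ω n))) := by
        rw [rpow_add h0, rpow_one]; field_simp
      rw [h2]
      calc _ ≤ L * (t ^ (-(γ + 1)) * (C / (1 + t * ω n) ^ (2 * Q + 2))) :=
            mul_le_mul (hinv n) h1 (by positivity) hL0.le
        _ ≤ L * (t ^ (-(γ + 1)) * (C / (1 + 1 * ω n) ^ (2 * Q + 2))) := by gcongr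
        _ = _ := by rw [show -(γ + 1) = -γ - 1 by ring]; ring
  set S := ∑' n : ℕ, 1 / (1 + 1 * ω n) ^ (2 * Q + 2) * (n + 1 : ℝ) ^ (2 * Q) with hS
  have hS0 : 0 ≤ S := tsum_nonneg fun n => by have := hω0 n; positivity
  refine ⟨L * C * (A * A) * S + 1, by positivity, fun θ hθ φ hφ t ht => ?_⟩
  have ht0 : 0 < t := by linarith
  have gen : ∀ a : ℕ → ℝ, (∀ n, |a n| ≤ A * (n + 1 : ℝ) ^ Q) →
      |∑' n, ω n ^ γ * exp (-(t * ω n)) * a n * (p n).eval (cos φ)| ≤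
        (L * C * (A * A) * S + 1) * t ^ (-γ - 1) := fun a ha => by
    have h1 : ∀ n, ‖ω n ^ γ * exp (-(t * ω n)) * a n * (p n).eval (cos φ)‖ ≤
        t ^ (-γ - 1) * (L * C * (A * A)) *
          (1 / (1 + 1 * ω n) ^ (2 * Q + 2) * (n + 1 : ℝ) ^ (2 * Q)) := fun n => by
      have := hω0 n
      rw [norm_mul, norm_mul]
      calc _ ≤ t ^ (-γ - 1) * (L * C) * (1 / (1 + 1 * ω n) ^ (2 * Q + 2)) *
            (A * (n + 1 : ℝ) ^ Q) * (A * (n + 1 : ℝ) ^ Q) := by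
            refine mul_le_mul (mul_le_mul (hterm t ht n) (ha n) (by positivity) (by positivity))
              (hcr n φ hφ).1 (by positivity) (by positivity)
        _ = _ := by rw [two_mul Q, pow_add (n + 1 : ℝ)]; ring
    refine (tsum_of_norm_bounded (hsum.mul_left _).hasSum h1).trans ?_
    rw [tsum_mul_left, ← hS]
    nlinarith [rpow_pos_of_pos ht0 (-γ - 1)]
  exact ⟨gen _ fun n => (hcr n θ hθ).1, gen _ fun n => (hcr n θ hθ).2⟩

/-- Pointwise kernel bounds in terms of `d = |θ - φ|` and `t`. -/
lemma IsOrthoSeq.exists_frac_bound (hp : IsOrthoSeq α β p) (hα : -1 < α) (hβ : -1 < β)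
    {γ : ℝ} (hγ : 0 < γ) :
    ∃ C : ℝ, 0 < C ∧ ∀ θ ∈ Ioo 0 π, ∀ φ ∈ Ioo 0 π, θ ≠ φ → ∀ t, 0 < t → ∀ d, d = |θ - φ| →
      ∀ g, (t ≤ d → g = d ^ (-γ)) → (d < t → g = t ^ (-γ) * (d / t) ^ (1 - jkap α β)) →
      |fracK α β γ p t θ φ| * ballScale α β d θ φ ≤ C * g ∧
      |fracD α β γ p t θ φ| * (d * ballScale α β d θ φ) ≤ C * g := by
  obtain ⟨C1, hC1, hloc⟩ := hp.exists_localized_multiplier hα hβ hγ (jgrow α β + 3)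
  obtain ⟨C2, hC2, hser⟩ := hp.exists_series_bound_scaled hα hβ
  obtain ⟨C3, hC3, hdec⟩ := exists_exp_decay hγ.le (jgrow α β + 3)
  obtain ⟨C4, hC4, hbs⟩ := exists_ballScale_le α β
  obtain ⟨C5, hC5, hlarge⟩ := hp.exists_frac_bound_large hα hβ hγ
  have hκ := jkap_lt_one hα hβ
  have hκ0 := jkap_nonneg α β
  refine ⟨C1 * C2 + C3 * C2 * C4 + 4 * (C5 * C4), by positivity,
    fun θ hθ φ hφ hne t ht d hd g hg1 hg2 => ?_⟩
  have hpi4 := pi_lt_four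
  have hd0 : 0 < d := by rw [hd]; exact abs_pos.2 (sub_ne_zero.2 hne)
  have hd4 : d ≤ 4 := by
    rw [hd, abs_le]; constructor <;> linarith [hθ.1, hθ.2, hφ.1, hφ.2]
  have hW := ballScale_pos α β hd0 hθ hφ
  set W := ballScale α β d θ φ with hWd
  have hsplit : ∀ {g X}, 0 ≤ g → (X ≤ C1 * C2 * g ∨ X ≤ C3 * C2 * C4 * g ∨ X ≤ 4 * (C5 * C4) * g) →
      X ≤ (C1 * C2 + C3 * C2 * C4 + 4 * (C5 * C4)) * g := fun {g X} hg h => by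
    have h1 : 0 ≤ C1 * C2 * g := by positivity
    have h2 : 0 ≤ C3 * C2 * C4 * g := by positivity
    have h3 : 0 ≤ 4 * (C5 * C4) * g := by positivity
    rcases h with h | h | h <;> nlinarith
  rcases le_or_gt t d with htd | htd
  · rw [hg1 htd]
    have hg0 : 0 < d ^ (-γ) := rpow_pos_of_pos hd0 _
    obtain ⟨H, hH, hK, hD⟩ := hloc θ hθ φ hφ t ht (hd ▸ htd)
    rw [← hd] at hH
    obtain ⟨h1, h2⟩ := hser d ⟨hd0, hd4⟩ θ hθ φ hφ H (d ^ (-γ) * C1) (by positivity) hH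
    rw [← hK] at h1
    rw [← hD] at h2
    change _ ≤ _ * (C2 / W) at h1
    change _ ≤ _ * (C2 / W / d) at h2
    refine ⟨hsplit hg0.le (Or.inl ?_), hsplit hg0.le (Or.inl ?_)⟩
    · refine (mul_le_mul_of_nonneg_right h1 hW.le).trans (le_of_eq ?_)
      field_simp
    · refine (mul_le_mul_of_nonneg_right h2 (by positivity)).trans (le_of_eq ?_)
      field_simp
  · have hdt : 0 < d / t := by positivity
    have hdt1 : d / t ≤ 1 := (div_le_one ht).2 htd.le
    rw [hg2 htd]
    set y := (d / t) ^ (1 - jkap α β) with hy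
    have hy0 : 0 < y := rpow_pos_of_pos hdt _
    have ht0 : 0 < t ^ (-γ) := rpow_pos_of_pos ht _
    have hg0 : 0 ≤ t ^ (-γ) * y := by positivity
    rcases le_or_gt t 4 with h4 | h4
    · obtain ⟨h1, h2⟩ := hser t ⟨ht, h4⟩ θ hθ φ hφ
        (fun n => √(lam α β n) ^ γ * exp (-(t * √(lam α β n)))) (t ^ (-γ) * C3) (by positivity)
        (fun n => by
          rw [abs_of_nonneg (by positivity), mul_div_assoc]
          exact rpow_mul_exp_le hdec ht (sqrt_nonneg _))
      have hV := ballScale_pos α β ht hθ hφ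
      have h3 := (hbs θ hθ φ hφ).1 t ⟨ht, h4⟩ d ⟨hd0, htd.le⟩
      set V := ballScale α β t θ φ with hVd
      change |fracK α β γ p t θ φ| ≤ _ * (C2 / V) at h1
      change |fracD α β γ p t θ φ| ≤ _ * (C2 / V / t) at h2
      refine ⟨hsplit hg0 (Or.inr (Or.inl ?_)), hsplit hg0 (Or.inr (Or.inl ?_))⟩
      · refine (mul_le_mul h1 h3 hW.le (by positivity)).trans (le_of_eq ?_)
        rw [← hy]
        field_simp
      · refine (mul_le_mul h2 (mul_le_mul htd.le h3 hW.le ht.le) (by positivity)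
          (by positivity)).trans (le_of_eq ?_)
        rw [← hy]
        field_simp
    · obtain ⟨h1, h2⟩ := hlarge θ hθ φ hφ t (by linarith)
      have h3 := (hbs θ hθ φ hφ).2 d ⟨hd0, hd4⟩
      have h5 : t ^ (-γ - 1) * d ^ (1 - jkap α β) ≤ t ^ (-γ) * y := by
        rw [hy, div_rpow hd0.le ht.le, rpow_sub ht, rpow_one, div_mul_eq_mul_div, mul_div_assoc]
        gcongr
        calc t ^ (1 - jkap α β) ≤ t ^ (1 : ℝ) :=
              rpow_le_rpow_of_exponent_le (by linarith) (by linarith)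
          _ = t := rpow_one t
      have h6 : 0 < t ^ (-γ - 1) := rpow_pos_of_pos ht _
      refine ⟨hsplit hg0 (Or.inr (Or.inr ?_)), hsplit hg0 (Or.inr (Or.inr ?_))⟩
      · calc _ ≤ C5 * t ^ (-γ - 1) * (C4 * d ^ (1 - jkap α β)) :=
              mul_le_mul h1 h3 hW.le (by positivity)
          _ = C5 * C4 * (t ^ (-γ - 1) * d ^ (1 - jkap α β)) := by ring
          _ ≤ C5 * C4 * (t ^ (-γ) * y) := by gcongr
          _ ≤ _ := by
            have : 0 ≤ C5 * C4 * (t ^ (-γ) * y) := by positivity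
            linarith
      · calc _ ≤ C5 * t ^ (-γ - 1) * (4 * (C4 * d ^ (1 - jkap α β))) :=
              mul_le_mul h2 (mul_le_mul hd4 h3 hW.le (by norm_num)) (by positivity) (by positivity)
          _ = 4 * (C5 * C4) * (t ^ (-γ - 1) * d ^ (1 - jkap α β)) := by ring
          _ ≤ 4 * (C5 * C4) * (t ^ (-γ) * y) := by gcongr

end

lemma μJ_le_of_jweight_le (α β : ℝ) {S T : Set ℝ} {g : ℝ → ℝ} (hS : MeasurableSet S)
    (hT : MeasurableSet T) (hST : S ∩ Ioo 0 π ⊆ T) (hg0 : ∀ x ∈ T, 0 ≤ g x)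
    (hg : ∀ x ∈ S ∩ Ioo 0 π, jweight α β x ≤ g x) (hi : IntegrableOn g T) :
    μJ α β S ≤ ENNReal.ofReal (∫ x in T, g x) := by
  unfold μJ
  rw [withDensity_apply _ hS, Measure.restrict_restrict hS,
    ofReal_integral_eq_lintegral_ofReal hi ((ae_restrict_iff' hT).2 (ae_of_all _ hg0))]
  refine (setLIntegral_mono' (hS.inter measurableSet_Ioo) fun x hx => ?_).trans
    (lintegral_mono_set hST)
  exact ENNReal.ofReal_le_ofReal (hg x hx)

lemma measurableSet_ballI (θ r : ℝ) : MeasurableSet (ballI θ r) := measurableSet_Ioo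

lemma exists_μJ_ball_half {α β : ℝ} (hα : -1 < α) [IsFiniteMeasure (μJ α β)] :
    ∃ C : ℝ, 0 < C ∧ ∀ θ ∈ Ioc 0 (π / 2), ∀ d ∈ Ioc (0 : ℝ) 4,
      μJ α β (ballI θ d) ≤ ENNReal.ofReal (C * (d * jscale α β d θ)) := by
  have hpi3 := pi_gt_three
  have hpi4 := pi_lt_four
  obtain ⟨c, C, hc, hC, hw⟩ := exists_jweight_bounds α β
  obtain ⟨D, hD, hj⟩ := exists_jscale_half α β
  set a := 2 * α + 1 with ha
  have ha1 : 0 < a + 1 := by linarith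
  set M := (μJ α β).real univ with hM
  have hM0 : 0 ≤ M := measureReal_nonneg
  set K := C * 3 / (a + 1) + C * 3 ^ |a| * 2 + M * 8 ^ |a| * 2 with hK
  have hp3 : 0 < C * 3 / (a + 1) := by positivity
  have hp2 : 0 < C * 3 ^ |a| * 2 := by positivity
  have hp1 : 0 ≤ M * 8 ^ |a| * 2 := by positivity
  refine ⟨K * D, by positivity, fun θ hθ d hd => ?_⟩
  have hθ0 := hθ.1
  have hd0 := hd.1
  have hs : 0 < θ + d := by linarith
  have hsp : 0 < (θ + d) ^ a := rpow_pos_of_pos hs _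
  suffices h : μJ α β (ballI θ d) ≤ ENNReal.ofReal (K * (d * (θ + d) ^ a)) by
    refine h.trans (ENNReal.ofReal_le_ofReal ?_)
    have := (hj d hd θ hθ).2
    calc K * (d * (θ + d) ^ a) ≤ K * (d * (D * jscale α β d θ)) := by gcongr
      _ = _ := by ring
  have hmul : 0 < d * (θ + d) ^ a := by positivity
  rcases le_or_gt (π / 4) d with h1 | h1
  · calc μJ α β (ballI θ d) ≤ μJ α β univ := measure_mono (subset_univ _)
      _ = ENNReal.ofReal M := by rw [hM, ofReal_measureReal]
      _ ≤ _ := ENNReal.ofReal_le_ofReal ?_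
    have h2 := rpow_le_of_comparable a (x := θ + d) (y := 1) (k := 8) hs one_pos
      (by linarith) (by linarith [hθ.2, hd.2])
    rw [one_rpow] at h2
    calc M ≤ M * (8 ^ |a| * (θ + d) ^ a * (2 * d)) :=
          le_mul_of_one_le_right hM0 (one_le_mul_of_one_le_of_one_le h2 (by linarith))
      _ = M * 8 ^ |a| * 2 * (d * (θ + d) ^ a) := by ring
      _ ≤ _ := by gcongr; linarith
  rcases le_or_gt (θ / 2) d with h2 | h2
  · have hi : IntervalIntegrable (fun x : ℝ => C * x ^ a) volume 0 (θ + d) :=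
      (intervalIntegral.intervalIntegrable_rpow' (by linarith)).const_mul C
    refine (μJ_le_of_jweight_le α β (T := Ioc 0 (θ + d)) (g := fun x => C * x ^ a)
      (measurableSet_ballI θ d) measurableSet_Ioc (fun x hx => ⟨hx.2.1, hx.1.2.le⟩)
      (fun x hx => by have := hx.1; positivity)
      (fun x hx => (hw x ⟨hx.2.1, by linarith [hx.1.2, hθ.2]⟩).2)
      ((intervalIntegrable_iff_integrableOn_Ioc_of_le hs.le).1 hi)).trans
      (ENNReal.ofReal_le_ofReal ?_)
    rw [← intervalIntegral.integral_of_le hs.le, intervalIntegral.integral_const_mul,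
      integral_rpow (Or.inl (by linarith)), zero_rpow ha1.ne', sub_zero, rpow_add_one hs.ne']
    calc C * ((θ + d) ^ a * (θ + d) / (a + 1)) ≤ C * ((θ + d) ^ a * (3 * d) / (a + 1)) := by
          gcongr; linarith
      _ = C * 3 / (a + 1) * (d * (θ + d) ^ a) := by ring
      _ ≤ _ := by gcongr; linarith
  · refine (μJ_le_of_jweight_le α β (T := Ioc (θ - d) (θ + d))
      (g := fun _ => C * (3 ^ |a| * (θ + d) ^ a))
      (measurableSet_ballI θ d) measurableSet_Ioc (fun x hx => ⟨hx.1.1, hx.1.2.le⟩)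
      (fun x hx => by positivity)
      (fun x hx => (hw x ⟨hx.2.1, by linarith [hx.1.2, hθ.2]⟩).2.trans ?_)
      (integrableOn_const (by simp))).trans
      (ENNReal.ofReal_le_ofReal ?_)
    · have := rpow_le_of_comparable a (x := θ + d) (y := x) (k := 3) hs hx.2.1
        (by linarith [hx.1.2]) (by linarith [hx.1.1])
      gcongr
    · rw [setIntegral_const, Real.volume_real_Ioc_of_le (by linarith), smul_eq_mul]
      calc (θ + d - (θ - d)) * (C * (3 ^ |a| * (θ + d) ^ a)) =
            C * 3 ^ |a| * 2 * (d * (θ + d) ^ a) := by ring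
        _ ≤ _ := by gcongr; linarith

lemma μJ_ballI_refl (α β θ r : ℝ) [IsFiniteMeasure (μJ α β)] [IsFiniteMeasure (μJ β α)] :
    μJ β α (ballI (π - θ) r) = μJ α β (ballI θ r) := by
  have h := integral_μJ_refl α β ((ballI θ r).indicator 1)
  have h2 : (fun x => (ballI θ r).indicator (1 : ℝ → ℝ) (π - x)) =
      (ballI (π - θ) r).indicator 1 := by
    funext x
    simp only [indicator, ballI, mem_Ioo, Pi.one_apply]
    congr 1
    apply propext
    constructor <;> rintro ⟨h1, h2⟩ <;> constructor <;> linarith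
  rw [h2, integral_indicator_one (measurableSet_ballI _ _),
    integral_indicator_one (measurableSet_ballI _ _)] at h
  rw [← ofReal_measureReal, ← ofReal_measureReal, h]

/-- The measure of a ball is controlled by the symmetric surrogate. -/
lemma IsOrthoSeq.exists_μJ_ball_le {α β : ℝ} {p : ℕ → Polynomial ℝ} (hp : IsOrthoSeq α β p)
    (hα : -1 < α) (hβ : -1 < β) :
    ∃ C : ℝ, 0 < C ∧ ∀ θ ∈ Ioo 0 π, ∀ φ ∈ Ioo 0 π, θ ≠ φ →
      μJ α β (ballI θ |θ - φ|) ≤ ENNReal.ofReal (C * ballScale α β |θ - φ| θ φ) := by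
  have := hp.isFiniteMeasure
  have := hp.refl.isFiniteMeasure
  have hpi4 := pi_lt_four
  obtain ⟨C, hC, h⟩ := exists_μJ_ball_half (β := β) hα
  obtain ⟨C', hC', h'⟩ := exists_μJ_ball_half (β := α) hβ
  have key : ∀ θ ∈ Ioo 0 π, ∀ d ∈ Ioc (0 : ℝ) 4,
      μJ α β (ballI θ d) ≤ ENNReal.ofReal (max C C' * (d * jscale α β d θ)) := by
    intro θ hθ d hd
    have hj := jscale_pos α β hd.1 hθ
    have hd0 := hd.1
    rcases le_or_gt θ (π / 2) with h1 | h1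
    · refine (h θ ⟨hθ.1, h1⟩ d hd).trans (ENNReal.ofReal_le_ofReal ?_)
      gcongr; exact le_max_left _ _
    · have := h' (π - θ) ⟨by linarith [hθ.2], by linarith⟩ d hd
      rw [μJ_ballI_refl, jscale_refl] at this
      refine this.trans (ENNReal.ofReal_le_ofReal ?_)
      gcongr; exact le_max_right _ _
  set B : ℝ := 2 ^ |2 * α + 1| * 2 ^ |2 * β + 1| + 1 with hB
  have hB1 : 1 ≤ B := by rw [hB]; have : (0 : ℝ) ≤ 2 ^ |2 * α + 1| * 2 ^ |2 * β + 1| := by positivity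
                         linarith
  have hM : 0 < max C C' := lt_max_of_lt_left hC
  refine ⟨max C C' * B, by positivity, fun θ hθ φ hφ hne => ?_⟩
  have hd0 : 0 < |θ - φ| := abs_pos.2 (sub_ne_zero.2 hne)
  have hd4 : |θ - φ| ≤ 4 := abs_le.2 ⟨by linarith [hθ.1, hφ.2], by linarith [hθ.2, hφ.1]⟩
  refine (key θ hθ _ ⟨hd0, hd4⟩).trans (ENNReal.ofReal_le_ofReal ?_)
  have hjθ := jscale_pos α β hd0 hθ
  have hjφ := jscale_pos α β hd0 hφ
  have h2 := sqrt_mul_sqrt_le (c := B) (x := jscale α β |θ - φ| θ) (x' := jscale α β |θ - φ| θ)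
    (y := jscale α β |θ - φ| θ) (y' := jscale α β |θ - φ| φ) (by linarith)
    (le_mul_of_one_le_left hjθ.le hB1)
    ((jscale_le_jscale α β hd0 hθ hφ le_rfl).trans (by gcongr; linarith))
  rw [mul_self_sqrt hjθ.le] at h2
  calc max C C' * (|θ - φ| * jscale α β |θ - φ| θ) ≤ max C C' * (|θ - φ| * (B *
        (√(jscale α β |θ - φ| θ) * √(jscale α β |θ - φ| φ)))) := by gcongr
    _ = _ := by unfold ballScale; ring

/-- The time profile bounding the fractional derivatives of the kernel at distance `d`. -/
def timeProfile (γ ε d t : ℝ) : ℝ :=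
  if t ≤ d then d ^ (-γ) else t ^ (-γ) * (d / t) ^ ε

lemma integral_timeProfile_sq {γ ε d : ℝ} (hγ : 0 < γ) (hε : 0 < ε) (hd : 0 < d) :
    IntegrableOn (fun t => timeProfile γ ε d t ^ 2 * t ^ (2 * γ - 1)) (Ioi 0) ∧
      ∫ t in Ioi 0, timeProfile γ ε d t ^ 2 * t ^ (2 * γ - 1) = 1 / (2 * γ) + 1 / (2 * ε) := by
  have e1 : EqOn (fun t : ℝ => d ^ (-(2 * γ)) * t ^ (2 * γ - 1))
      (fun t => timeProfile γ ε d t ^ 2 * t ^ (2 * γ - 1)) (Ioc 0 d) := fun t ht => by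
    simp only [timeProfile, if_pos ht.2]
    rw [← rpow_natCast, ← rpow_mul hd.le]
    congr 2; push_cast; ring
  have e2 : EqOn (fun t : ℝ => d ^ (2 * ε) * t ^ (-(2 * ε) - 1))
      (fun t => timeProfile γ ε d t ^ 2 * t ^ (2 * γ - 1)) (Ioi d) := fun t ht => by
    have ht0 : 0 < t := hd.trans ht
    simp only [timeProfile, if_neg (not_le.2 (mem_Ioi.1 ht))]
    rw [div_rpow hd.le ht0.le, ← rpow_natCast, div_eq_mul_inv, ← rpow_neg ht0.le,
      mul_rpow (by positivity) (by positivity), mul_rpow (by positivity) (by positivity),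
      ← rpow_mul ht0.le, ← rpow_mul hd.le, ← rpow_mul ht0.le]
    have : t ^ (-(2 * ε) - 1) = t ^ (-γ * ((2 : ℕ) : ℝ)) * t ^ (-ε * ((2 : ℕ) : ℝ)) *
        t ^ (2 * γ - 1) := by
      rw [← rpow_add ht0, ← rpow_add ht0]; congr 1; push_cast; ring
    rw [this, show 2 * ε = ε * ((2 : ℕ) : ℝ) by push_cast; ring]
    ring
  have i1 : IntegrableOn (fun t : ℝ => d ^ (-(2 * γ)) * t ^ (2 * γ - 1)) (Ioc 0 d) :=
    ((intervalIntegrable_iff_integrableOn_Ioc_of_le hd.le).1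
      (intervalIntegral.intervalIntegrable_rpow' (by linarith))).const_mul _
  have i2 : IntegrableOn (fun t : ℝ => d ^ (2 * ε) * t ^ (-(2 * ε) - 1)) (Ioi d) :=
    (integrableOn_Ioi_rpow_of_lt (by linarith) hd).const_mul _
  have j1 := i1.congr_fun e1 measurableSet_Ioc
  have j2 := i2.congr_fun e2 measurableSet_Ioi
  rw [← Ioc_union_Ioi_eq_Ioi hd.le]
  refine ⟨j1.union j2, ?_⟩
  rw [setIntegral_union (Ioc_disjoint_Ioi le_rfl) measurableSet_Ioi j1 j2,
    ← setIntegral_congr_fun measurableSet_Ioc e1, ← setIntegral_congr_fun measurableSet_Ioi e2,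
    integral_const_mul, integral_const_mul, integral_Ioi_rpow_of_lt (by linarith) hd,
    ← intervalIntegral.integral_of_le hd.le, integral_rpow (Or.inl (by linarith))]
  rw [sub_add_cancel, sub_add_cancel, zero_rpow (by linarith), sub_zero, rpow_neg hd.le,
    rpow_neg hd.le]
  have h1 : d ^ (2 * γ) ≠ 0 := (rpow_pos_of_pos hd _).ne'
  have h2 : d ^ (2 * ε) ≠ 0 := (rpow_pos_of_pos hd _).ne'
  field_simp

lemma sqrt_integral_mul_le {γ ε d W C : ℝ} {f : ℝ → ℝ} (hγ : 0 < γ) (hε : 0 < ε) (hd : 0 < d)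
    (hW : 0 < W) (hC : 0 ≤ C) (hf : ∀ t, 0 < t → |f t| * W ≤ C * timeProfile γ ε d t) :
    √(∫ t in Ioi 0, f t ^ 2 * t ^ (2 * γ - 1)) * W ≤ C * √(1 / (2 * γ) + 1 / (2 * ε)) := by
  obtain ⟨hi, hv⟩ := integral_timeProfile_sq hγ hε hd
  have key : ∫ t in Ioi 0, f t ^ 2 * t ^ (2 * γ - 1) ≤
      (C / W) ^ 2 * (1 / (2 * γ) + 1 / (2 * ε)) := by
    rw [← hv, ← integral_const_mul]
    refine integral_mono_of_nonneg
      ((ae_restrict_iff' measurableSet_Ioi).2 (ae_of_all _ fun t (ht : 0 < t) => ?_))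
      (hi.const_mul _)
      ((ae_restrict_iff' measurableSet_Ioi).2 (ae_of_all _ fun t (ht : 0 < t) => ?_))
    · simp only [Pi.zero_apply]; positivity
    · have h1 : |f t| ≤ C / W * timeProfile γ ε d t := by
        rw [div_mul_eq_mul_div, le_div_iff₀ hW]; exact hf t ht
      have h2 : f t ^ 2 ≤ (C / W * timeProfile γ ε d t) ^ 2 := by
        rw [← sq_abs]; exact pow_le_pow_left₀ (abs_nonneg _) h1 2
      calc f t ^ 2 * t ^ (2 * γ - 1) ≤ (C / W * timeProfile γ ε d t) ^ 2 * t ^ (2 * γ - 1) := by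
            gcongr
        _ = _ := by ring
  calc _ ≤ √((C / W) ^ 2 * (1 / (2 * γ) + 1 / (2 * ε))) * W := by gcongr
    _ = _ := by
      rw [sqrt_mul (sq_nonneg _), sqrt_sq (by positivity)]
      field_simp

section
variable {α β γ : ℝ} {p : ℕ → Polynomial ℝ} {Pn : ℕ → ℝ → ℝ}

lemma fracK_comm (α β γ : ℝ) (p : ℕ → Polynomial ℝ) (t θ φ : ℝ) :
    fracK α β γ p t θ φ = fracK α β γ p t φ θ :=
  tsum_congr fun n => by ring

lemma IsOrthoSeq.caputoR_kernelP (hp : IsOrthoSeq α β p) (hα : -1 < α) (hβ : -1 < β)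
    (hγ : 0 < γ) (hPn : ∀ n θ, Pn n θ = (p n).eval (cos θ)) {θ φ t : ℝ} (hθ : θ ∈ Ioo 0 π)
    (hφ : φ ∈ Ioo 0 π) (ht : 0 < t) :
    caputoR γ (fun u => kernelP α β Pn u θ φ) t = (-1) ^ (⌊γ⌋₊ + 1) * fracK α β γ p t θ φ := by
  obtain ⟨A, Q, hA, hcr⟩ := hp.exists_crude_bound hα hβ
  have h := caputoR_exp_series (ω := fun n => √(lam α β n))
    (c := fun n => (p n).eval (cos θ) * (p n).eval (cos φ)) hγ (fun n => sqrt_nonneg _) (by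
      intro a ha t ht
      refine Summable.of_nonneg_of_le (fun n => by positivity) (fun n => ?_)
        ((summable_rpow_mul_exp hα hβ ht ha (2 * Q)).mul_left (A * A))
      rw [abs_mul]
      calc _ ≤ √(lam α β n) ^ a * exp (-(t * √(lam α β n))) *
            ((A * (n + 1 : ℝ) ^ Q) * (A * (n + 1 : ℝ) ^ Q)) := by
            gcongr
            · exact (hcr n θ hθ).1
            · exact (hcr n φ hφ).1
        _ = _ := by rw [two_mul, pow_add]; ring) ht
  have h1 : (fun u => kernelP α β Pn u θ φ) = fun u => ∑' n, exp (-(u * √(lam α β n))) *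
      ((p n).eval (cos θ) * (p n).eval (cos φ)) := by
    funext u
    exact tsum_congr fun n => by rw [hPn, hPn, mul_assoc]
  rw [h1, h]
  congr 1
  exact tsum_congr fun n => by ring

lemma IsOrthoSeq.hasDerivAt_fracK (hp : IsOrthoSeq α β p) (hα : -1 < α) (hβ : -1 < β)
    (hγ : 0 < γ) {θ φ t : ℝ} (hθ : θ ∈ Ioo 0 π) (hφ : φ ∈ Ioo 0 π) (ht : 0 < t) :
    HasDerivAt (fun θ => fracK α β γ p t θ φ) (fracD α β γ p t θ φ) θ := by
  obtain ⟨A, Q, hA, hcr⟩ := hp.exists_crude_bound hα hβ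
  refine hasDerivAt_series (G := fun n => √(lam α β n) ^ γ * exp (-(t * √(lam α β n)))) hA hcr
    ?_ hθ hφ
  refine (summable_rpow_mul_exp hα hβ ht hγ.le (2 * Q)).congr fun n => ?_
  rw [abs_of_nonneg (by positivity)]

lemma IsOrthoSeq.deriv_caputoR_left (hp : IsOrthoSeq α β p) (hα : -1 < α) (hβ : -1 < β)
    (hγ : 0 < γ) (hPn : ∀ n θ, Pn n θ = (p n).eval (cos θ)) {θ φ t : ℝ} (hθ : θ ∈ Ioo 0 π)
    (hφ : φ ∈ Ioo 0 π) (ht : 0 < t) :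
    deriv (fun θ => caputoR γ (fun u => kernelP α β Pn u θ φ) t) θ =
      (-1) ^ (⌊γ⌋₊ + 1) * fracD α β γ p t θ φ := by
  have h := (hp.hasDerivAt_fracK hα hβ hγ hθ hφ ht).const_mul ((-1 : ℝ) ^ (⌊γ⌋₊ + 1))
  refine (h.congr_of_eventuallyEq ?_).deriv
  filter_upwards [isOpen_Ioo.mem_nhds hθ] with x hx
  exact hp.caputoR_kernelP hα hβ hγ hPn hx hφ ht

lemma IsOrthoSeq.deriv_caputoR_right (hp : IsOrthoSeq α β p) (hα : -1 < α) (hβ : -1 < β)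
    (hγ : 0 < γ) (hPn : ∀ n θ, Pn n θ = (p n).eval (cos θ)) {θ φ t : ℝ} (hθ : θ ∈ Ioo 0 π)
    (hφ : φ ∈ Ioo 0 π) (ht : 0 < t) :
    deriv (fun φ => caputoR γ (fun u => kernelP α β Pn u θ φ) t) φ =
      (-1) ^ (⌊γ⌋₊ + 1) * fracD α β γ p t φ θ := by
  have h := (hp.hasDerivAt_fracK hα hβ hγ hφ hθ ht).const_mul ((-1 : ℝ) ^ (⌊γ⌋₊ + 1))
  refine (h.congr_of_eventuallyEq ?_).deriv
  filter_upwards [isOpen_Ioo.mem_nhds hφ] with x hx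
  rw [hp.caputoR_kernelP hα hβ hγ hPn hθ hx ht, fracK_comm]

/-- The kernel estimates with the ball measure replaced by its symmetric surrogate. -/
lemma IsOrthoSeq.exists_kernelBNorm_bound (hp : IsOrthoSeq α β p) (hα : -1 < α) (hβ : -1 < β)
    (hγ : 0 < γ) (hPn : ∀ n θ, Pn n θ = (p n).eval (cos θ)) :
    ∃ C : ℝ, 0 < C ∧ ∀ θ ∈ Ioo 0 π, ∀ φ ∈ Ioo 0 π, θ ≠ φ →
      kernelBNorm α β γ Pn θ φ * ballScale α β |θ - φ| θ φ ≤ C ∧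
      kernelBNormDθ α β γ Pn θ φ * (|θ - φ| * ballScale α β |θ - φ| θ φ) ≤ C ∧
      kernelBNormDψ α β γ Pn θ φ * (|θ - φ| * ballScale α β |θ - φ| θ φ) ≤ C := by
  obtain ⟨C, hC, h⟩ := hp.exists_frac_bound hα hβ hγ
  have hε : 0 < 1 - jkap α β := by linarith [jkap_lt_one hα hβ]
  refine ⟨C * √(1 / (2 * γ) + 1 / (2 * (1 - jkap α β))), by positivity, fun θ hθ φ hφ hne => ?_⟩
  have hd : 0 < |θ - φ| := abs_pos.2 (sub_ne_zero.2 hne)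
  have hb := ballScale_pos α β hd hθ hφ
  have hsgn : ∀ x : ℝ, |(-1 : ℝ) ^ (⌊γ⌋₊ + 1) * x| = |x| := fun x => by
    rw [abs_mul, abs_pow, abs_neg, abs_one, one_pow, one_mul]
  have hprof : ∀ t, (t ≤ |θ - φ| → timeProfile γ (1 - jkap α β) |θ - φ| t = |θ - φ| ^ (-γ)) ∧
      (|θ - φ| < t → timeProfile γ (1 - jkap α β) |θ - φ| t =
        t ^ (-γ) * (|θ - φ| / t) ^ (1 - jkap α β)) := fun t =>
    ⟨fun ht => if_pos ht, fun ht => if_neg (not_le.2 ht)⟩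
  refine ⟨sqrt_integral_mul_le hγ hε hd hb hC.le fun t ht => ?_,
    sqrt_integral_mul_le hγ hε hd (mul_pos hd hb) hC.le fun t ht => ?_,
    sqrt_integral_mul_le hγ hε hd (mul_pos hd hb) hC.le fun t ht => ?_⟩
  · rw [hp.caputoR_kernelP hα hβ hγ hPn hθ hφ ht, hsgn]
    exact (h θ hθ φ hφ hne t ht _ rfl _ (hprof t).1 (hprof t).2).1
  · rw [hp.deriv_caputoR_left hα hβ hγ hPn hθ hφ ht, hsgn]
    exact (h θ hθ φ hφ hne t ht _ rfl _ (hprof t).1 (hprof t).2).2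
  · rw [hp.deriv_caputoR_right hα hβ hγ hPn hθ hφ ht, hsgn]
    have h3 := (h φ hφ θ hθ hne.symm t ht _ (abs_sub_comm θ φ) _ (hprof t).1 (hprof t).2).2
    rwa [show ballScale α β |θ - φ| φ θ = ballScale α β |θ - φ| θ φ by
      unfold ballScale; ring] at h3
end

/-- The vector-valued kernel `𝒢_{α,β}^γ(θ,ψ) = {∂_t^γ ℋ_t^{α,β}(θ,ψ)}_{t>0}`
satisfies the standard Calderón–Zygmund estimates with respect to the space of homogeneous
type `((0,π), dμ_{α,β}, |·|)` and the Banach space `B = L²((0,∞), t^{2γ-1}dt)`: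
the growth bound `‖𝒢(θ,ψ)‖_B ≤ C/μ_{α,β}(B(θ,|θ-ψ|))` and the gradient bound
`‖∂_θ 𝒢(θ,ψ)‖_B + ‖∂_ψ 𝒢(θ,ψ)‖_B ≤ C/(|θ-ψ| μ_{α,β}(B(θ,|θ-ψ|)))`. -/
theorem statement17
    (α β : ℝ) (hα : -1 < α) (hβ : -1 < β) (γ : ℝ) (hγ : 0 < γ)
    (Pn : ℕ → ℝ → ℝ) (hPn : IsJacobiPolySystem α β Pn) :
    ∃ C : ℝ, 0 < C ∧ ∀ θ ∈ Ioo (0 : ℝ) π, ∀ ψ ∈ Ioo (0 : ℝ) π, θ ≠ ψ →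
      ENNReal.ofReal (kernelBNorm α β γ Pn θ ψ) * μJ α β (ballI θ |θ - ψ|) ≤
        ENNReal.ofReal C ∧
      ENNReal.ofReal (kernelBNormDθ α β γ Pn θ ψ + kernelBNormDψ α β γ Pn θ ψ) *
          (ENNReal.ofReal |θ - ψ| * μJ α β (ballI θ |θ - ψ|)) ≤
        ENNReal.ofReal C := by
  choose p hdeg hlead hform using hPn.form
  have hp : IsOrthoSeq α β p := ⟨hdeg, hlead, fun n m => by
    rw [← hPn.ortho n m]
    simp only [hform]⟩
  obtain ⟨C, hC, h⟩ := hp.exists_kernelBNorm_bound hα hβ hγ hform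
  obtain ⟨D, hD, hball⟩ := hp.exists_μJ_ball_le hα hβ
  refine ⟨2 * C * D, by positivity, fun θ hθ ψ hψ hne => ?_⟩
  obtain ⟨h1, h2, h3⟩ := h θ hθ ψ hψ hne
  have hμ := hball θ hθ ψ hψ hne
  have hn1 : 0 ≤ kernelBNorm α β γ Pn θ ψ := sqrt_nonneg _
  have hn2 : 0 ≤ kernelBNormDθ α β γ Pn θ ψ + kernelBNormDψ α β γ Pn θ ψ :=
    add_nonneg (sqrt_nonneg _) (sqrt_nonneg _)
  constructor
  · refine (mul_le_mul_right hμ _).trans ?_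
    rw [← ENNReal.ofReal_mul hn1]
    refine ENNReal.ofReal_le_ofReal ?_
    calc _ = kernelBNorm α β γ Pn θ ψ * ballScale α β |θ - ψ| θ ψ * D := by ring
      _ ≤ C * D := by gcongr
      _ ≤ _ := by gcongr; linarith
  · refine (mul_le_mul_right (mul_le_mul_right hμ _) _).trans ?_
    rw [← ENNReal.ofReal_mul (abs_nonneg _), ← ENNReal.ofReal_mul hn2]
    refine ENNReal.ofReal_le_ofReal ?_
    calc _ = (kernelBNormDθ α β γ Pn θ ψ * (|θ - ψ| * ballScale α β |θ - ψ| θ ψ) +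
          kernelBNormDψ α β γ Pn θ ψ * (|θ - ψ| * ballScale α β |θ - ψ| θ ψ)) * D := by ring
      _ ≤ (C + C) * D := by gcongr
      _ = _ := by ring

end JacobiPaper
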